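/- Finite time blow up for the supercritical Córdoba–Córdoba–Fontelos model (Theorem CCFbu): Let 0 ≤ α < 1/4. There exists initial data θ₀ : ℝ → ℝ which is smooth, bounded, positive, even, nonincreasing on (0,∞), and integrable, such that there is no function θ : ℝ × [0,∞) → ℝ which is smooth (C^∞) on ℝ × [0,∞), bounded, with all spatial derivatives bounded on ℝ × [0,T] for each T > 0, and which solves ∂_t θ = (Hθ) ∂_x θ − L_α θ on ℝ × [0,∞) with θ(·,0) = θ₀. Here Hθ(x,t) = (1/π) lim_{R→∞} lim_{ε→0+} ∫_{ε<|x−y|<R} θ(y,t)/(x−y) dy is the Hilbert transform in x, and L_α f(x) = P.V. ∫_ℝ (f(x) − f(x+y))/|y|^{1+2α} dy for α > 0, with L_0 = 0 when α = 0. (That is, the solution forms a singularity in finite time.) -/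

import Mathlib

open Set MeasureTheory Filter Topology

/-- `HilbertPVAt f x v` says that the iterated principal value
`lim_{R→∞} lim_{ε→0+} ∫_{ε<|x−y|<R} f(y)/(x−y) dy` exists and equals `v`
(so that the Hilbert transform of `f` at `x` is `v/π`). -/
def HilbertPVAt (f : ℝ → ℝ) (x v : ℝ) : Prop :=
  ∃ g : ℝ → ℝ,
    (∀ R, 0 < R → Tendsto (fun ε => ∫ y in {y : ℝ | ε < |x - y| ∧ |x - y| < R}, f y / (x - y))
      (nhdsWithin 0 (Ioi 0)) (nhds (g R))) ∧
    Tendsto g atTop (nhds v)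

/-! ### The Hilbert transform as a symmetric integral -/

lemma abs_sub_le_of_hasDerivAt {f f' : ℝ → ℝ} {M : ℝ} (hf : ∀ x, HasDerivAt f (f' x) x)
    (hb : ∀ x, |f' x| ≤ M) (x y : ℝ) : |f x - f y| ≤ M * |x - y| := by
  have := Convex.norm_image_sub_le_of_norm_hasDerivWithin_le (f := f) (f' := f') (C := M)
    (s := univ) (x := y) (y := x) (fun z _ => (hf z).hasDerivWithinAt) (fun z _ => hb z)
    convex_univ (mem_univ _) (mem_univ _)
  simpa [Real.norm_eq_abs] using this

/-- The symmetric quotient whose integral over `(0, ∞)` is `π` times the Hilbert transform. -/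
noncomputable def symmQuot (f : ℝ → ℝ) (x y : ℝ) : ℝ := (f (x - y) - f (x + y)) / y

lemma measurable_symmQuot {f : ℝ → ℝ} (hf : Continuous f) (x : ℝ) :
    Measurable (symmQuot f x) := by
  unfold symmQuot
  have h1 : Measurable (fun y => f (x - y)) := (hf.comp (by fun_prop)).measurable
  have h2 : Measurable (fun y => f (x + y)) := (hf.comp (by fun_prop)).measurable
  exact (h1.sub h2).div measurable_id

lemma abs_symmQuot_le {f f' : ℝ → ℝ} {M : ℝ} (hf : ∀ x, HasDerivAt f (f' x) x)
    (hb : ∀ x, |f' x| ≤ M) (x y : ℝ) : |symmQuot f x y| ≤ 2 * M := by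
  have hM : 0 ≤ M := (abs_nonneg _).trans (hb 0)
  unfold symmQuot
  rcases eq_or_ne y 0 with rfl | hy
  · simpa using hM
  rw [abs_div, div_le_iff₀ (abs_pos.2 hy)]
  have := abs_sub_le_of_hasDerivAt hf hb (x - y) (x + y)
  have h2 : |x - y - (x + y)| = 2 * |y| := by
    rw [show x - y - (x + y) = -(2 * y) by ring, abs_neg, abs_mul]; norm_num
  rw [h2] at this
  linarith

lemma intervalIntegrable_symmQuot {f f' : ℝ → ℝ} {M : ℝ} (hf : ∀ x, HasDerivAt f (f' x) x)
    (hb : ∀ x, |f' x| ≤ M) (x a b : ℝ) : IntervalIntegrable (symmQuot f x) volume a b := by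
  have hc : Continuous f := continuous_iff_continuousAt.2 fun x => (hf x).continuousAt
  refine (intervalIntegrable_const (c := 2 * M)).mono_fun
    (measurable_symmQuot hc x).aestronglyMeasurable ?_
  refine Eventually.of_forall fun y => ?_
  have h := abs_symmQuot_le hf hb x y
  simp only [Real.norm_eq_abs]
  exact h.trans (le_abs_self _)

lemma setIntegral_annulus_eq_symmQuot {f : ℝ → ℝ} (hf : Continuous f) (x : ℝ) {ε R : ℝ}
    (hε : 0 < ε) (hR : ε < R) :
    ∫ y in {y : ℝ | ε < |x - y| ∧ |x - y| < R}, f y / (x - y)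
      = ∫ y in ε..R, symmQuot f x y := by
  have hmeas : MeasurableSet {y : ℝ | ε < |x - y| ∧ |x - y| < R} := by
    have hcd : Continuous fun y : ℝ => |x - y| := by fun_prop
    exact ((isOpen_lt continuous_const hcd).inter (isOpen_lt hcd continuous_const)).measurableSet
  have hset : {z : ℝ | ε < |z| ∧ |z| < R} = Ioo ε R ∪ Ioo (-R) (-ε) := by
    ext z
    simp only [mem_ofPred_eq, mem_union, mem_Ioo]
    rcases abs_cases z with ⟨h, h'⟩ | ⟨h, h'⟩ <;> rw [h] <;> constructor <;> intro hz
    · exact Or.inl hz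
    · rcases hz with hz | hz
      · exact hz
      · linarith [hz.1, hz.2]
    · right; constructor <;> linarith [hz.1, hz.2]
    · rcases hz with hz | hz
      · linarith [hz.1, hz.2]
      · constructor <;> linarith [hz.1, hz.2]
  have hcont : ∀ s : Set ℝ, (∀ z ∈ s, z ≠ 0) → ContinuousOn (fun z => f (x - z) / z) s := by
    intro s hs
    exact ContinuousOn.div (hf.comp (by fun_prop)).continuousOn continuousOn_id hs
  have hi1 : IntegrableOn (fun z => f (x - z) / z) (Ioo ε R) :=
    ((hcont (Icc ε R) fun z hz => (hε.trans_le hz.1).ne').integrableOn_compact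
      isCompact_Icc).mono_set Ioo_subset_Icc_self
  have hi2 : IntegrableOn (fun z => f (x - z) / z) (Ioo (-R) (-ε)) :=
    ((hcont (Icc (-R) (-ε)) fun z hz => by linarith [hz.2, hε] |> fun h : z < 0 =>
      h.ne).integrableOn_compact isCompact_Icc).mono_set Ioo_subset_Icc_self
  rw [← integral_indicator hmeas, ← integral_sub_left_eq_self _ volume x]
  have h1 : (fun z => indicator {y : ℝ | ε < |x - y| ∧ |x - y| < R} (fun y => f y / (x - y)) (x - z))
      = indicator (Ioo ε R ∪ Ioo (-R) (-ε)) (fun z => f (x - z) / z) := by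
    rw [← hset]
    ext z
    simp only [indicator, mem_ofPred_eq, sub_sub_cancel]
  rw [h1, integral_indicator (measurableSet_Ioo.union measurableSet_Ioo),
    setIntegral_union _ measurableSet_Ioo hi1 hi2]
  · rw [← integral_Ioc_eq_integral_Ioo, ← integral_Ioc_eq_integral_Ioo,
      ← intervalIntegral.integral_of_le hR.le, ← intervalIntegral.integral_of_le (by linarith)]
    have h2 := intervalIntegral.integral_comp_neg (a := ε) (b := R) (fun z => f (x - z) / z)
    rw [← h2, ← intervalIntegral.integral_add]
    · congr 1; ext z
      unfold symmQuot
      rw [sub_neg_eq_add, div_neg, sub_div]; ring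
    · exact (intervalIntegrable_iff_integrableOn_Ioo_of_le hR.le).2 hi1
    · apply ContinuousOn.intervalIntegrable
      rw [uIcc_of_le hR.le]
      exact ContinuousOn.div (hf.comp (by fun_prop)).continuousOn (by fun_prop)
        fun z hz => neg_ne_zero.2 (hε.trans_le hz.1).ne'
  · rw [Set.disjoint_left]
    intro z hz hz'
    linarith [hz.1, hz'.2]

lemma HilbertPVAt.tendsto_symmQuot {f f' : ℝ → ℝ} {M x v : ℝ} (hf : ∀ x, HasDerivAt f (f' x) x)
    (hb : ∀ x, |f' x| ≤ M) (h : HilbertPVAt f x v) :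
    Tendsto (fun R => ∫ y in (0 : ℝ)..R, symmQuot f x y) atTop (𝓝 v) := by
  have hc : Continuous f := continuous_iff_continuousAt.2 fun x => (hf x).continuousAt
  obtain ⟨g, hg, hgv⟩ := h
  refine hgv.congr' ?_
  filter_upwards [eventually_gt_atTop 0] with R hR
  refine tendsto_nhds_unique (hg R hR) ?_
  have hcont : Continuous fun ε => ∫ y in ε..R, symmQuot f x y := by
    have := intervalIntegral.continuous_primitive
      (fun a b => intervalIntegrable_symmQuot hf hb x a b) R
    have h2 : (fun ε => ∫ y in ε..R, symmQuot f x y)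
        = fun ε => -∫ y in R..ε, symmQuot f x y := by
      ext ε; rw [intervalIntegral.integral_symm]
    rw [h2]; exact this.neg
  have h3 := (hcont.tendsto 0).mono_left (nhdsWithin_le_nhds (s := Ioi 0))
  refine h3.congr' ?_
  filter_upwards [Ioo_mem_nhdsGT hR] with ε hε
  exact (setIntegral_annulus_eq_symmQuot hc x hε.1 hε.2).symm

lemma hasDerivAt_integral_symmQuot {f f' f'' : ℝ → ℝ} {M : ℝ}
    (hf : ∀ x, HasDerivAt f (f' x) x) (hf' : ∀ x, HasDerivAt f' (f'' x) x)
    (hb : ∀ x, |f' x| ≤ M) (hb' : ∀ x, |f'' x| ≤ M) (a b x : ℝ) :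
    HasDerivAt (fun x => ∫ y in a..b, symmQuot f x y) (∫ y in a..b, symmQuot f' x y) x := by
  have hc : Continuous f := continuous_iff_continuousAt.2 fun x => (hf x).continuousAt
  have hc' : Continuous f' := continuous_iff_continuousAt.2 fun x => (hf' x).continuousAt
  refine (intervalIntegral.hasDerivAt_integral_of_dominated_loc_of_deriv_le
    (bound := fun _ => 2 * M) (s := univ) univ_mem ?_ ?_ ?_ ?_ ?_ ?_).2
  · exact Eventually.of_forall fun x => (measurable_symmQuot hc x).aestronglyMeasurable
  · exact intervalIntegrable_symmQuot hf hb x a b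
  · exact (measurable_symmQuot hc' x).aestronglyMeasurable
  · exact Eventually.of_forall fun y _ x _ => abs_symmQuot_le hf' hb' x y
  · exact intervalIntegrable_const
  · refine Eventually.of_forall fun y _ x _ => ?_
    unfold symmQuot
    have h1 : HasDerivAt (fun x => f (x - y)) (f' (x - y)) x := (hf (x - y)).comp_sub_const x y
    have h2 : HasDerivAt (fun x => f (x + y)) (f' (x + y)) x := (hf (x + y)).comp_add_const x y
    exact (h1.sub h2).div_const y

/-- Integrating by parts, the far part of the Hilbert transform of a derivative is controlled by
the size of the function. -/
lemma abs_integral_symmQuot_deriv_le {f f' : ℝ → ℝ} {M : ℝ}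
    (hf : ∀ x, HasDerivAt f (f' x) x) (hc' : Continuous f') (hM : ∀ x, |f x| ≤ M)
    {a b : ℝ} (ha : 0 < a) (hab : a ≤ b) (x : ℝ) :
    |∫ y in a..b, symmQuot f' x y| ≤ 4 * M / a := by
  have hM0 : 0 ≤ M := (abs_nonneg _).trans (hM 0)
  have hc : Continuous f := continuous_iff_continuousAt.2 fun x => (hf x).continuousAt
  have hpos : ∀ y ∈ uIcc a b, 0 < y := by
    intro y hy; rw [uIcc_of_le hab] at hy; exact ha.trans_le hy.1
  have hd : ∀ y ∈ uIcc a b, HasDerivAt (fun y => -(f (x - y) + f (x + y)))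
      (f' (x - y) - f' (x + y)) y := by
    intro y _
    have h1 : HasDerivAt (fun y => f (x - y)) (-f' (x - y)) y := by
      simpa using (hf (x - y)).comp_const_sub x y
    have h2 : HasDerivAt (fun y => f (x + y)) (f' (x + y)) y := (hf (x + y)).comp_const_add x y
    exact (h1.add h2).neg.congr_deriv (by ring)
  have hd2 : ∀ y ∈ uIcc a b, HasDerivAt (fun y : ℝ => y⁻¹) (-(y ^ 2)⁻¹) y :=
    fun y hy => hasDerivAt_inv (hpos y hy).ne'
  have hcinv : ContinuousOn (fun y : ℝ => -(y ^ 2)⁻¹) (uIcc a b) :=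
    (ContinuousOn.inv₀ (by fun_prop) fun y hy => (pow_pos (hpos y hy) 2).ne').neg
  have hcs : Continuous fun y => f' (x - y) - f' (x + y) :=
    (hc'.comp (by fun_prop)).sub (hc'.comp (by fun_prop))
  have hparts := intervalIntegral.integral_mul_deriv_eq_deriv_mul hd2 hd
    hcinv.intervalIntegrable (hcs.intervalIntegrable a b)
  have hbd : ∀ y, |f (x - y) + f (x + y)| ≤ 2 * M := fun y => by
    have := abs_add_le (f (x - y)) (f (x + y)); linarith [hM (x - y), hM (x + y)]
  have heq : ∫ y in a..b, symmQuot f' x y = ∫ y in a..b, y⁻¹ * (f' (x - y) - f' (x + y)) := by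
    congr 1; ext y; unfold symmQuot; rw [div_eq_inv_mul]
  have hint : |∫ y in a..b, -(y ^ 2)⁻¹ * -(f (x - y) + f (x + y))| ≤ 2 * M * (1 / a - 1 / b) := by
    have h1 : ∫ y in a..b, (2 * M) * (y ^ 2)⁻¹ = 2 * M * (1 / a - 1 / b) := by
      rw [intervalIntegral.integral_const_mul]
      have := intervalIntegral.integral_eq_sub_of_hasDerivAt hd2 hcinv.intervalIntegrable
      rw [intervalIntegral.integral_neg] at this
      have h2 : ∫ y in a..b, ((y ^ 2)⁻¹ : ℝ) = a⁻¹ - b⁻¹ := by linarith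
      rw [h2]; simp
    rw [← h1, ← Real.norm_eq_abs]
    refine intervalIntegral.norm_integral_le_of_norm_le hab ?_ ?_
    · refine Eventually.of_forall fun y hy => ?_
      have hy0 : 0 < y := ha.trans hy.1
      rw [neg_mul_neg, Real.norm_eq_abs, abs_mul, abs_of_pos (by positivity), mul_comm]
      gcongr
      exact hbd y
    · have := hcinv.neg.intervalIntegrable (μ := volume)
      simpa using this.const_mul (2 * M)
  rw [heq, hparts]
  have hb0 : 0 < b := ha.trans_le hab
  have e1 : |b⁻¹ * -(f (x - b) + f (x + b))| ≤ 2 * M * (1 / b) := by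
    rw [abs_mul, abs_neg, abs_of_pos (inv_pos.2 hb0), mul_comm, one_div]
    gcongr; exact hbd b
  have e2 : |a⁻¹ * -(f (x - a) + f (x + a))| ≤ 2 * M * (1 / a) := by
    rw [abs_mul, abs_neg, abs_of_pos (inv_pos.2 ha), mul_comm, one_div]
    gcongr; exact hbd a
  have e3 := abs_sub (b⁻¹ * -(f (x - b) + f (x + b)) - a⁻¹ * -(f (x - a) + f (x + a)))
    (∫ y in a..b, -(y ^ 2)⁻¹ * -(f (x - y) + f (x + y)))
  have e4 := abs_sub (b⁻¹ * -(f (x - b) + f (x + b))) (a⁻¹ * -(f (x - a) + f (x + a)))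
  have : 4 * M / a = 2 * M * (1 / b) + 2 * M * (1 / a) + 2 * M * (1 / a - 1 / b) := by ring
  rw [this]
  linarith

/-- The Hilbert transform `a` of a bounded `C²` function with bounded derivatives is
differentiable with bounded derivative. -/
lemma exists_hasDerivAt_hilbert {f f' f'' : ℝ → ℝ} {M : ℝ} {a : ℝ → ℝ}
    (hf : ∀ x, HasDerivAt f (f' x) x) (hf' : ∀ x, HasDerivAt f' (f'' x) x)
    (hM : ∀ x, |f x| ≤ M) (hb : ∀ x, |f' x| ≤ M) (hb' : ∀ x, |f'' x| ≤ M)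
    (ha : ∀ x, Tendsto (fun R => ∫ y in (0 : ℝ)..R, symmQuot f x y) atTop (𝓝 (Real.pi * a x))) :
    ∀ x, HasDerivAt a (deriv a x) x ∧ |deriv a x| ≤ 6 * M := by
  have hM0 : 0 ≤ M := (abs_nonneg _).trans (hM 0)
  have hc' : Continuous f' := continuous_iff_continuousAt.2 fun x => (hf' x).continuousAt
  set F : ℝ → ℝ → ℝ := fun R x => ∫ y in (0 : ℝ)..R, symmQuot f' x y with hF
  have hdiff : ∀ x, ∀ r R : ℝ, 0 < r → r ≤ R → |F R x - F r x| ≤ 4 * M / r := by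
    intro x r R hr hrR
    have := intervalIntegral.integral_interval_sub_left
      (intervalIntegrable_symmQuot hf' hb' x 0 R) (intervalIntegrable_symmQuot hf' hb' x 0 r)
    simp only [hF]
    rw [this]
    exact abs_integral_symmQuot_deriv_le hf hc' hM hr hrR x
  have hdist : ∀ ε > 0, ∃ N : ℝ, ∀ m ≥ N, ∀ n ≥ N, ∀ x ∈ (univ : Set ℝ), dist (F m x) (F n x) < ε := by
    intro ε hε
    refine ⟨4 * M / ε + 1 , fun m hm n hn x _ => ?_⟩
    have key : ∀ r : ℝ, r ≥ 4 * M / ε + 1 → 0 < r ∧ 4 * M / r < ε := by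
      intro r hr
      have h0 : 0 ≤ 4 * M / ε := by positivity
      have hr0 : 0 < r := by linarith
      refine ⟨hr0, ?_⟩
      rw [div_lt_iff₀ hr0]
      have : 4 * M / ε < r := by linarith
      rw [div_lt_iff₀ hε] at this
      linarith
    rw [Real.dist_eq]
    rcases le_total m n with h | h
    · rw [abs_sub_comm]
      exact (hdiff x m n (key m hm).1 h).trans_lt (key m hm).2
    · exact (hdiff x n m (key n hn).1 h).trans_lt (key n hn).2
  have hucs : UniformCauchySeqOn F atTop univ := Metric.uniformCauchySeqOn_iff.2 hdist
  have hlim : ∀ x, ∃ l, Tendsto (fun R => F R x) atTop (𝓝 l) := fun x =>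
    cauchySeq_tendsto_of_complete (Metric.cauchySeq_iff.2 fun ε hε => by
      obtain ⟨N, hN⟩ := hdist ε hε
      exact ⟨N, fun m hm n hn => hN m hm n hn x (mem_univ _)⟩)
  choose g hg using hlim
  have hunif := hucs.tendstoUniformlyOn_of_tendsto (f := g) fun x _ => hg x
  have hderiv : ∀ x, HasDerivAt (fun x => Real.pi * a x) (g x) x := fun x =>
    hasDerivAt_of_tendstoUniformlyOn isOpen_univ hunif
      (Eventually.of_forall fun R x _ => hasDerivAt_integral_symmQuot hf hf' hb hb' 0 R x)
      (fun x _ => ha x) (mem_univ x)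
  have hgb : ∀ x, |g x| ≤ 6 * M := by
    intro x
    refine le_of_tendsto (hg x).abs ?_
    filter_upwards [eventually_ge_atTop 1] with R hR
    have h1 := hdiff x 1 R one_pos hR
    have h2 : |F 1 x| ≤ 2 * M := by
      have := intervalIntegral.norm_integral_le_of_norm_le_const (a := 0) (b := 1)
        (f := symmQuot f' x) (C := 2 * M) (fun y _ => abs_symmQuot_le hf' hb' x y)
      simpa using this
    have h3 := abs_sub_abs_le_abs_sub (F R x) (F 1 x)
    linarith
  intro x
  have hax : HasDerivAt a (g x / Real.pi) x := by
    have := (hderiv x).div_const Real.pi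
    refine this.congr_of_eventuallyEq (Eventually.of_forall fun z => ?_)
    simp only
    field_simp
  rw [hax.deriv]
  refine ⟨hax, ?_⟩
  rw [abs_div, abs_of_pos Real.pi_pos, div_le_iff₀ Real.pi_pos]
  have hp : 1 ≤ Real.pi := by linarith [Real.pi_gt_three]
  nlinarith [hgb x]

/-- The Hilbert transform of a bounded Lipschitz function grows at most logarithmically. -/
lemma abs_hilbert_sub_le_log {f f' f'' : ℝ → ℝ} {M : ℝ} {a : ℝ → ℝ}
    (hf : ∀ x, HasDerivAt f (f' x) x) (hf' : ∀ x, HasDerivAt f' (f'' x) x)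
    (hM : ∀ x, |f x| ≤ M) (hb : ∀ x, |f' x| ≤ M) (hb' : ∀ x, |f'' x| ≤ M)
    (ha : ∀ x, Tendsto (fun R => ∫ y in (0 : ℝ)..R, symmQuot f x y) atTop (𝓝 (Real.pi * a x)))
    (x : ℝ) : |a x - a 0| ≤ 8 * M + 4 * M * Real.log (1 + |x|) := by
  have hM0 : 0 ≤ M := (abs_nonneg _).trans (hM 0)
  have hc' : Continuous f' := continuous_iff_continuousAt.2 fun x => (hf' x).continuousAt
  set ρ := 1 + |x| with hρ
  have hρ1 : 1 ≤ ρ := by simp [hρ]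
  have hlog : 0 ≤ Real.log ρ := Real.log_nonneg hρ1
  have hint := fun x a b => intervalIntegrable_symmQuot hf hb x a b
  have hnear : ∀ z, |∫ y in (0 : ℝ)..ρ, symmQuot f z y| ≤ 2 * M + 2 * M * Real.log ρ := by
    intro z
    rw [← intervalIntegral.integral_add_adjacent_intervals (hint z 0 1) (hint z 1 ρ)]
    refine (abs_add_le _ _).trans (add_le_add ?_ ?_)
    · have := intervalIntegral.norm_integral_le_of_norm_le_const (a := 0) (b := 1)
        (f := symmQuot f z) (C := 2 * M) (fun y _ => abs_symmQuot_le hf hb z y)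
      simpa using this
    · have h1 : ∫ y in (1 : ℝ)..ρ, (2 * M) * y⁻¹ = 2 * M * Real.log ρ := by
        rw [intervalIntegral.integral_const_mul, integral_inv_of_pos one_pos (by linarith)]
        simp
      rw [← h1, ← Real.norm_eq_abs]
      refine intervalIntegral.norm_integral_le_of_norm_le hρ1 ?_ ?_
      · refine Eventually.of_forall fun y hy => ?_
        have hy0 : 0 < y := one_pos.trans hy.1
        unfold symmQuot
        rw [Real.norm_eq_abs, abs_div, abs_of_pos hy0, div_eq_mul_inv]
        gcongr
        have := abs_sub (f (z - y)) (f (z + y))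
        linarith [hM (z - y), hM (z + y)]
      · refine (ContinuousOn.intervalIntegrable ?_).const_mul _
        refine ContinuousOn.inv₀ continuousOn_id fun y hy => ?_
        rw [uIcc_of_le hρ1] at hy
        exact (one_pos.trans_le hy.1).ne'
  have hlim : Tendsto (fun R => (∫ y in (0 : ℝ)..R, symmQuot f x y)
      - ∫ y in (0 : ℝ)..R, symmQuot f 0 y) atTop (𝓝 (Real.pi * (a x - a 0))) := by
    rw [mul_sub]; exact (ha x).sub (ha 0)
  have hb2 : |Real.pi * (a x - a 0)| ≤ 8 * M + 4 * M * Real.log ρ := by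
    refine le_of_tendsto hlim.abs ?_
    filter_upwards [eventually_ge_atTop ρ] with R hR
    rw [← intervalIntegral.integral_add_adjacent_intervals (hint x 0 ρ) (hint x ρ R),
      ← intervalIntegral.integral_add_adjacent_intervals (hint 0 0 ρ) (hint 0 ρ R)]
    have h1 := abs_sub_le_of_hasDerivAt
      (fun z => hasDerivAt_integral_symmQuot hf hf' hb hb' ρ R z)
      (fun z => abs_integral_symmQuot_deriv_le hf hc' hM (by linarith) hR z) x 0
    have h2 : 4 * M / ρ * |x - 0| ≤ 4 * M := by
      rw [sub_zero, div_mul_eq_mul_div, div_le_iff₀ (by linarith)]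
      have : |x| ≤ ρ := by simp [hρ]
      gcongr
    rw [add_sub_add_comm]
    refine (abs_add_le _ _).trans ?_
    have h3 := abs_sub (∫ y in (0 : ℝ)..ρ, symmQuot f x y) (∫ y in (0 : ℝ)..ρ, symmQuot f 0 y)
    linarith [hnear x, hnear 0]
  rw [abs_mul, abs_of_pos Real.pi_pos] at hb2
  have hp : 1 ≤ Real.pi := by linarith [Real.pi_gt_three]
  nlinarith [abs_nonneg (a x - a 0)]

/-! ### The fractional dissipation as an absolutely convergent integral -/

/-- The operator `L_β` for `0 < β < 1/2`, written as an absolutely convergent integral. -/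
noncomputable def fracDiss (β : ℝ) (f : ℝ → ℝ) (x : ℝ) : ℝ :=
  ∫ y, (f x - f (x + y)) / |y| ^ (1 + 2 * β)

/-- The weight `min(1,|y|)/|y|^{1+2β}` dominating the kernel of `L_β` on bounded Lipschitz
functions. -/
noncomputable def truncKer (β : ℝ) (y : ℝ) : ℝ := min 1 |y| / |y| ^ (1 + 2 * β)

lemma truncKer_nonneg (β y : ℝ) : 0 ≤ truncKer β y := by unfold truncKer; positivity

lemma integrable_truncKer {β : ℝ} (h0 : 0 < β) (h1 : β < 1 / 2) : Integrable (truncKer β) := by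
  have key : IntegrableOn (fun y : ℝ => min 1 y / y ^ (1 + 2 * β)) (Ioi 0) := by
    rw [← Ioc_union_Ioi_eq_Ioi zero_le_one]
    refine IntegrableOn.union ?_ ?_
    · have : IntegrableOn (fun y : ℝ => y ^ (-(2 * β))) (Ioc 0 1) := by
        rw [← intervalIntegrable_iff_integrableOn_Ioc_of_le zero_le_one]
        exact intervalIntegral.intervalIntegrable_rpow' (by linarith)
      refine this.congr_fun (fun y hy => ?_) measurableSet_Ioc
      simp only
      rw [min_eq_right hy.2, Real.rpow_add hy.1, Real.rpow_one, Real.rpow_neg hy.1.le]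
      field_simp [hy.1.ne']
    · have : IntegrableOn (fun y : ℝ => y ^ (-(1 + 2 * β))) (Ioi 1) :=
        integrableOn_Ioi_rpow_of_lt (by linarith) one_pos
      refine this.congr_fun (fun y hy => ?_) measurableSet_Ioi
      have hy1 : (1 : ℝ) < y := hy
      simp only
      rw [min_eq_left hy1.le, Real.rpow_neg (by linarith), one_div]
  have := (integrable_fun_norm_addHaar (volume : Measure ℝ)
    (f := fun y : ℝ => min 1 y / y ^ (1 + 2 * β))).2 (by simpa using key)
  simp only [Real.norm_eq_abs] at this
  exact this

lemma abs_sub_add_le_min {f f' : ℝ → ℝ} {M : ℝ} (hf : ∀ x, HasDerivAt f (f' x) x)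
    (hM : ∀ x, |f x| ≤ M) (hb : ∀ x, |f' x| ≤ M) (x y : ℝ) :
    |f x - f (x + y)| ≤ 2 * M * min 1 |y| := by
  have hM0 : 0 ≤ M := (abs_nonneg _).trans (hM 0)
  have h1 := abs_sub_le_of_hasDerivAt hf hb x (x + y)
  have h2 := abs_sub (f x) (f (x + y))
  rw [show x - (x + y) = -y by ring, abs_neg] at h1
  rcases min_cases 1 |y| with ⟨h, _⟩ | ⟨h, _⟩ <;> rw [h]
  · linarith [hM x, hM (x + y)]
  · nlinarith [abs_nonneg y]

lemma abs_fracDiss_integrand_le {β M : ℝ} {f : ℝ → ℝ}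
    (hf : ∀ x y, |f x - f (x + y)| ≤ 2 * M * min 1 |y|) (x y : ℝ) :
    |(f x - f (x + y)) / |y| ^ (1 + 2 * β)| ≤ 2 * M * truncKer β y := by
  unfold truncKer
  rw [abs_div, abs_of_nonneg (Real.rpow_nonneg (abs_nonneg y) _), ← mul_div_assoc]
  gcongr
  exact hf x y

lemma measurable_fracDiss_integrand {f : ℝ → ℝ} (hf : Continuous f) (β x : ℝ) :
    Measurable fun y => (f x - f (x + y)) / |y| ^ (1 + 2 * β) := by
  have h2 : Measurable (fun y => f (x + y)) := (hf.comp (by fun_prop)).measurable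
  exact (measurable_const.sub h2).div (by fun_prop)

lemma integrable_fracDiss_integrand {β M : ℝ} {f : ℝ → ℝ} (h0 : 0 < β) (h1 : β < 1 / 2)
    (hc : Continuous f) (hf : ∀ x y, |f x - f (x + y)| ≤ 2 * M * min 1 |y|) (x : ℝ) :
    Integrable fun y => (f x - f (x + y)) / |y| ^ (1 + 2 * β) :=
  ((integrable_truncKer h0 h1).const_mul (2 * M)).mono'
    (measurable_fracDiss_integrand hc β x).aestronglyMeasurable
    (Eventually.of_forall fun y => abs_fracDiss_integrand_le hf x y)

lemma abs_fracDiss_le {β M : ℝ} {f : ℝ → ℝ} (h0 : 0 < β) (h1 : β < 1 / 2)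
    (hf : ∀ x y, |f x - f (x + y)| ≤ 2 * M * min 1 |y|) (x : ℝ) :
    |fracDiss β f x| ≤ 2 * M * ∫ y, truncKer β y := by
  unfold fracDiss
  rw [← integral_const_mul, ← Real.norm_eq_abs]
  exact norm_integral_le_of_norm_le ((integrable_truncKer h0 h1).const_mul (2 * M))
    (Eventually.of_forall fun y => abs_fracDiss_integrand_le hf x y)

lemma hasDerivAt_fracDiss {β M : ℝ} {f f' f'' : ℝ → ℝ} (h0 : 0 < β) (h1 : β < 1 / 2)
    (hf : ∀ x, HasDerivAt f (f' x) x) (hf' : ∀ x, HasDerivAt f' (f'' x) x)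
    (hM : ∀ x, |f x| ≤ M) (hb : ∀ x, |f' x| ≤ M) (hb' : ∀ x, |f'' x| ≤ M) (x : ℝ) :
    HasDerivAt (fracDiss β f) (fracDiss β f' x) x := by
  have hc : Continuous f := continuous_iff_continuousAt.2 fun x => (hf x).continuousAt
  have hc' : Continuous f' := continuous_iff_continuousAt.2 fun x => (hf' x).continuousAt
  refine (hasDerivAt_integral_of_dominated_loc_of_deriv_le
    (F := fun x y => (f x - f (x + y)) / |y| ^ (1 + 2 * β))
    (F' := fun x y => (f' x - f' (x + y)) / |y| ^ (1 + 2 * β))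
    (bound := fun y => 2 * M * truncKer β y) (s := univ) univ_mem ?_ ?_ ?_ ?_ ?_ ?_).2
  · exact Eventually.of_forall fun x =>
      (measurable_fracDiss_integrand hc β x).aestronglyMeasurable
  · exact integrable_fracDiss_integrand h0 h1 hc (abs_sub_add_le_min hf hM hb) x
  · exact (measurable_fracDiss_integrand hc' β x).aestronglyMeasurable
  · exact Eventually.of_forall fun y x _ =>
      abs_fracDiss_integrand_le (abs_sub_add_le_min hf' hb hb') x y
  · exact (integrable_truncKer h0 h1).const_mul (2 * M)
  · exact Eventually.of_forall fun y x _ =>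
      ((hf x).sub ((hf (x + y)).comp_add_const x y)).div_const _

lemma tendsto_setIntegral_fracDiss {β M : ℝ} {f : ℝ → ℝ} (h0 : 0 < β) (h1 : β < 1 / 2)
    (hc : Continuous f) (hf : ∀ x y, |f x - f (x + y)| ≤ 2 * M * min 1 |y|) (x : ℝ) :
    Tendsto (fun ε => ∫ y in {y : ℝ | ε < |y|}, (f x - f (x + y)) / |y| ^ (1 + 2 * β))
      (𝓝[>] 0) (𝓝 (fracDiss β f x)) := by
  have hms : ∀ ε : ℝ, MeasurableSet {y : ℝ | ε < |y|} := fun ε =>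
    (isOpen_lt continuous_const continuous_abs).measurableSet
  simp_rw [← integral_indicator (hms _)]
  unfold fracDiss
  refine tendsto_integral_filter_of_dominated_convergence (fun y => 2 * M * truncKer β y) ?_ ?_
    ((integrable_truncKer h0 h1).const_mul (2 * M)) ?_
  · exact Eventually.of_forall fun ε =>
      ((measurable_fracDiss_integrand hc β x).indicator (hms ε)).aestronglyMeasurable
  · refine Eventually.of_forall fun ε => Eventually.of_forall fun y => ?_
    exact (norm_indicator_le_norm_self _ _).trans (abs_fracDiss_integrand_le hf x y)
  · filter_upwards [Measure.ae_ne volume (0 : ℝ)] with y hy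
    refine tendsto_const_nhds.congr' ?_
    filter_upwards [Ioo_mem_nhdsGT (abs_pos.2 hy)] with ε hε
    rw [indicator_of_mem]
    exact hε.2

/-! ### Polynomial weights -/

/-- The weight `(1 + (εx)²)^{-s/2}`. -/
noncomputable def polyWeight (s ε x : ℝ) : ℝ := (1 + (ε * x) ^ 2) ^ (-(s / 2))

lemma polyWeight_pos (s ε x : ℝ) : 0 < polyWeight s ε x := by
  unfold polyWeight; positivity

lemma polyWeight_le_one {s : ℝ} (hs : 0 ≤ s) (ε x : ℝ) : polyWeight s ε x ≤ 1 :=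
  Real.rpow_le_one_of_one_le_of_nonpos (by nlinarith [sq_nonneg (ε * x)]) (by linarith)

lemma hasDerivAt_polyWeight (s ε x : ℝ) :
    HasDerivAt (polyWeight s ε)
      (-(s * ε ^ 2 * x / (1 + (ε * x) ^ 2)) * polyWeight s ε x) x := by
  have hpos : 0 < 1 + (ε * x) ^ 2 := by positivity
  have h1 : HasDerivAt (fun x : ℝ => 1 + (ε * x) ^ 2) (2 * ε ^ 2 * x) x := by
    have := (((hasDerivAt_id x).const_mul ε).pow 2).const_add 1
    refine this.congr_deriv ?_
    simp; ring
  refine (h1.rpow_const (p := -(s / 2)) (Or.inl hpos.ne')).congr_deriv ?_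
  unfold polyWeight
  rw [Real.rpow_sub hpos, Real.rpow_one]
  field_simp

lemma continuous_polyWeight (s ε : ℝ) : Continuous (polyWeight s ε) :=
  continuous_iff_continuousAt.2 fun x => (hasDerivAt_polyWeight s ε x).continuousAt

lemma deriv_polyWeight_bound {s ε : ℝ} (hs : 0 ≤ s) (hs2 : s ≤ 2) (hε : 0 < ε) (hε1 : ε ≤ 1)
    (x : ℝ) : (1 + |x|) * |deriv (polyWeight s ε) x| ≤ 3 * polyWeight s ε x ∧
      |deriv (polyWeight s ε) x| ≤ polyWeight s ε x := by
  have hpos : 0 < 1 + (ε * x) ^ 2 := by positivity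
  have hw := polyWeight_pos s ε x
  rw [(hasDerivAt_polyWeight s ε x).deriv, abs_mul, abs_neg, abs_of_pos hw]
  have e1 : |s * ε ^ 2 * x / (1 + (ε * x) ^ 2)| = s * ε ^ 2 * |x| / (1 + (ε * x) ^ 2) := by
    rw [abs_div, abs_of_pos hpos, abs_mul, abs_of_nonneg (by positivity : 0 ≤ s * ε ^ 2)]
  have hxx : |x| ^ 2 = x ^ 2 := sq_abs x
  have h1 : s * ε ^ 2 * |x| / (1 + (ε * x) ^ 2) ≤ 1 := by
    rw [div_le_one hpos, mul_pow, ← hxx]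
    have h3 : s * ε ^ 2 * |x| ≤ 2 * (ε * |x|) := by
      have : s * ε ^ 2 ≤ 2 * ε := by nlinarith
      nlinarith [abs_nonneg x]
    nlinarith [sq_nonneg (1 - ε * |x|)]
  have h2 : |x| * (s * ε ^ 2 * |x| / (1 + (ε * x) ^ 2)) ≤ 2 := by
    rw [mul_div_assoc', div_le_iff₀ hpos, mul_pow, ← hxx]
    have : s * (ε ^ 2 * |x| ^ 2) ≤ 2 * (ε ^ 2 * |x| ^ 2) := by gcongr
    nlinarith
  rw [e1]
  constructor
  · rw [← mul_assoc]
    gcongr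
    linarith
  · nlinarith

lemma polyWeight_le_of_le {s ε x z : ℝ} (hs : 0 ≤ s) (hs2 : s ≤ 2)
    (h : 1 + (ε * x) ^ 2 ≤ 4 * (1 + (ε * z) ^ 2)) : polyWeight s ε z ≤ 4 * polyWeight s ε x := by
  unfold polyWeight
  have hx : 0 < 1 + (ε * x) ^ 2 := by positivity
  have hz : 0 < 1 + (ε * z) ^ 2 := by positivity
  rw [Real.rpow_neg hx.le, Real.rpow_neg hz.le, ← div_eq_mul_inv, ← one_div,
    div_le_div_iff₀ (by positivity) (by positivity), one_mul]
  calc (1 + (ε * x) ^ 2) ^ (s / 2) ≤ (4 * (1 + (ε * z) ^ 2)) ^ (s / 2) := by gcongr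
    _ = 4 ^ (s / 2) * (1 + (ε * z) ^ 2) ^ (s / 2) := Real.mul_rpow (by norm_num) hz.le
    _ ≤ 4 * (1 + (ε * z) ^ 2) ^ (s / 2) := by
        gcongr
        calc (4 : ℝ) ^ (s / 2) ≤ 4 ^ (1 : ℝ) :=
              Real.rpow_le_rpow_of_exponent_le (by norm_num) (by linarith)
          _ = 4 := Real.rpow_one _

lemma abs_polyWeight_sub_le {s ε : ℝ} (hs : 0 ≤ s) (hs2 : s ≤ 2) (hε : 0 < ε) (hε1 : ε ≤ 1)
    (x y : ℝ) (hy : |y| ≤ 1) :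
    |polyWeight s ε x - polyWeight s ε (x - y)| ≤ 4 * |y| * polyWeight s ε x := by
  have hd : ∀ z ∈ uIcc x (x - y), |deriv (polyWeight s ε) z| ≤ 4 * polyWeight s ε x := by
    intro z hz
    refine (deriv_polyWeight_bound hs hs2 hε hε1 z).2.trans (polyWeight_le_of_le hs hs2 ?_)
    have hxz : |x - z| ≤ 1 := by
      have := abs_sub_left_of_mem_uIcc hz
      rw [abs_sub_comm]
      refine this.trans ?_
      rwa [show x - y - x = -y by ring, abs_neg]
    have h2 : (ε * (x - z)) ^ 2 ≤ 1 := by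
      rw [mul_pow]
      have h3 : (x - z) ^ 2 ≤ 1 := by rw [← sq_abs]; nlinarith [abs_nonneg (x - z)]
      have h4 : ε ^ 2 ≤ 1 := by nlinarith
      nlinarith [sq_nonneg (x - z), sq_nonneg ε]
    nlinarith [sq_nonneg (ε * z - ε * (x - z)), sq_nonneg (ε * z)]
  have := Convex.norm_image_sub_le_of_norm_hasDerivWithin_le (f := polyWeight s ε)
    (f' := deriv (polyWeight s ε)) (C := 4 * polyWeight s ε x) (s := uIcc x (x - y))
    (x := x - y) (y := x)
    (fun z _ => (hasDerivAt_polyWeight s ε z).differentiableAt.hasDerivAt.hasDerivWithinAt) hd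
    (convex_uIcc _ _) right_mem_uIcc left_mem_uIcc
  rw [Real.norm_eq_abs, Real.norm_eq_abs, sub_sub_cancel] at this
  linarith

lemma integrable_one_add_abs_rpow_mul_polyWeight {s ε b : ℝ} (hε : 0 < ε) (hε1 : ε ≤ 1)
    (hb : 0 ≤ b) (hsb : 1 + b < s) :
    Integrable fun x => (1 + |x|) ^ b * polyWeight s ε x := by
  have hbase : Integrable fun x : ℝ => (1 + ‖x‖ ^ 2) ^ (-(s - b) / 2) :=
    integrable_rpow_neg_one_add_norm_sq (by simp; linarith)
  have hmeas : Measurable fun x => (1 + |x|) ^ b * polyWeight s ε x :=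
    Measurable.mul (by fun_prop) (continuous_polyWeight s ε).measurable
  refine (hbase.const_mul (2 ^ b * ε ^ (-s))).mono' hmeas.aestronglyMeasurable
    (Eventually.of_forall fun x => ?_)
  have hA : 0 < 1 + x ^ 2 := by positivity
  have hw := polyWeight_pos s ε x
  rw [Real.norm_eq_abs, abs_of_nonneg (by positivity), Real.norm_eq_abs, sq_abs]
  have h1 : (1 + |x|) ^ b ≤ 2 ^ b * (1 + x ^ 2) ^ (b / 2) := by
    have : (1 + |x|) ≤ 2 * (1 + x ^ 2) ^ ((1 : ℝ) / 2) := by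
      rw [← Real.sqrt_eq_rpow]
      have h3 : 1 ≤ Real.sqrt (1 + x ^ 2) := Real.one_le_sqrt.2 (by nlinarith [sq_nonneg x])
      have h4 : |x| ≤ Real.sqrt (1 + x ^ 2) := Real.abs_le_sqrt (by linarith)
      linarith
    calc (1 + |x|) ^ b ≤ (2 * (1 + x ^ 2) ^ ((1 : ℝ) / 2)) ^ b := by gcongr
      _ = 2 ^ b * (1 + x ^ 2) ^ (b / 2) := by
        rw [Real.mul_rpow (by norm_num) (by positivity), ← Real.rpow_mul hA.le]
        congr 2; ring
  have h2 : polyWeight s ε x ≤ ε ^ (-s) * (1 + x ^ 2) ^ (-(s / 2)) := by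
    unfold polyWeight
    have e : ε ^ (-s) = (ε ^ 2) ^ (-(s / 2)) := by
      rw [← Real.rpow_natCast, ← Real.rpow_mul hε.le]; congr 1; push_cast; ring
    rw [e, ← Real.mul_rpow (by positivity) hA.le]
    refine Real.rpow_le_rpow_of_nonpos (by positivity) ?_ (by linarith)
    nlinarith [sq_nonneg x, mul_pow ε x 2]
  calc (1 + |x|) ^ b * polyWeight s ε x
      ≤ (2 ^ b * (1 + x ^ 2) ^ (b / 2)) * (ε ^ (-s) * (1 + x ^ 2) ^ (-(s / 2))) := by gcongr
    _ = 2 ^ b * ε ^ (-s) * ((1 + x ^ 2) ^ (b / 2) * (1 + x ^ 2) ^ (-(s / 2))) := by ring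
    _ = 2 ^ b * ε ^ (-s) * (1 + x ^ 2) ^ (-(s - b) / 2) := by
      rw [← Real.rpow_add hA]; congr 2; ring

lemma integrable_polyWeight {s ε : ℝ} (hε : 0 < ε) (hε1 : ε ≤ 1) (hs : 1 < s) :
    Integrable (polyWeight s ε) := by
  have := integrable_one_add_abs_rpow_mul_polyWeight hε hε1 le_rfl (by linarith : 1 + 0 < s)
  simpa using this

lemma integral_polyWeight {s ε : ℝ} (hε : 0 < ε) :
    ∫ x, polyWeight s ε x = ε⁻¹ * ∫ x, polyWeight s 1 x := by
  have := Measure.integral_comp_mul_left (polyWeight s 1) ε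
  rw [abs_of_pos (inv_pos.2 hε), smul_eq_mul] at this
  rw [← this]
  congr 1; ext x; simp [polyWeight]

lemma abs_polyWeight_sub_div_le {β ε : ℝ} (h0 : 0 < β) (h1 : β < 1 / 2) (hε : 0 < ε)
    (hε1 : ε ≤ 1) (x y : ℝ) :
    |polyWeight (1 + 2 * β) ε x - polyWeight (1 + 2 * β) ε (x - y)| / |y| ^ (1 + 2 * β)
      ≤ polyWeight (1 + 2 * β) ε x *
        (5 * truncKer β y + 4 * (ε * polyWeight (1 + 2 * β) ε (x - y))) := by
  set s := 1 + 2 * β with hs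
  have hw := polyWeight_pos s ε x
  have hw' := polyWeight_pos s ε (x - y)
  unfold truncKer
  rw [← hs]
  rcases le_or_gt |y| 1 with hy | hy
  · rw [min_eq_right hy]
    have h2 := abs_polyWeight_sub_le (s := s) (by linarith) (by linarith) hε hε1 x y hy
    have h3 : |polyWeight s ε x - polyWeight s ε (x - y)| / |y| ^ s
        ≤ 4 * |y| * polyWeight s ε x / |y| ^ s := by gcongr
    have h4 : 4 * |y| * polyWeight s ε x / |y| ^ s = polyWeight s ε x * (4 * (|y| / |y| ^ s)) := by
      ring
    rw [h4] at h3
    refine h3.trans ?_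
    gcongr
    have : 0 ≤ |y| / |y| ^ s := by positivity
    have : 0 < 4 * (ε * polyWeight s ε (x - y)) := by positivity
    linarith
  · rw [min_eq_left hy.le]
    have hypos : 0 < |y| := by linarith
    have hys : 0 < |y| ^ s := by positivity
    have habs : |polyWeight s ε x - polyWeight s ε (x - y)|
        ≤ polyWeight s ε x + polyWeight s ε (x - y) := by
      rw [abs_le]; constructor <;> linarith
    have hkey : polyWeight s ε (x - y) / |y| ^ s ≤ polyWeight s ε x *
        (4 * (1 / |y| ^ s) + 4 * (ε * polyWeight s ε (x - y))) := by
      rcases le_or_gt ((ε * y) ^ 2) (1 + (ε * (x - y)) ^ 2) with h | h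
      · have h5 := polyWeight_le_of_le (s := s) (ε := ε) (x := x) (z := x - y) (by linarith)
          (by linarith) (by nlinarith [sq_nonneg (ε * (x - y) - ε * y)])
        have h6 : polyWeight s ε (x - y) / |y| ^ s ≤ 4 * polyWeight s ε x / |y| ^ s := by gcongr
        have h7 : 4 * polyWeight s ε x / |y| ^ s = polyWeight s ε x * (4 * (1 / |y| ^ s)) := by
          ring
        rw [h7] at h6
        refine h6.trans ?_
        gcongr
        have : 0 < 4 * (ε * polyWeight s ε (x - y)) := by positivity
        linarith
      · have h5 : 1 / |y| ^ s ≤ polyWeight s ε x * (4 * ε) := by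
          have hA : 0 < 1 + (ε * x) ^ 2 := by positivity
          have h6 : 1 + (ε * x) ^ 2 ≤ (2 * ε * |y|) ^ 2 := by
            have e : (2 * ε * |y|) ^ 2 = 4 * (ε * y) ^ 2 := by
              rw [mul_pow, sq_abs]; ring
            rw [e]
            nlinarith [sq_nonneg (ε * (x - y) - ε * y)]
          have h7 : (1 + (ε * x) ^ 2) ^ (s / 2) ≤ (2 * ε * |y|) ^ s := by
            calc (1 + (ε * x) ^ 2) ^ (s / 2) ≤ ((2 * ε * |y|) ^ 2) ^ (s / 2) := by gcongr
              _ = (2 * ε * |y|) ^ s := by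
                rw [← Real.rpow_natCast, ← Real.rpow_mul (by positivity)]; congr 1
                push_cast; ring
          have h8 : (2 * ε * |y|) ^ s ≤ 4 * ε * |y| ^ s := by
            rw [Real.mul_rpow (by positivity) hypos.le, Real.mul_rpow (by norm_num) hε.le]
            have h9 : (2 : ℝ) ^ s ≤ 4 := by
              calc (2 : ℝ) ^ s ≤ 2 ^ (2 : ℝ) :=
                    Real.rpow_le_rpow_of_exponent_le (by norm_num) (by linarith)
                _ = 4 := by norm_num
            have h10 : ε ^ s ≤ ε := by
              calc ε ^ s ≤ ε ^ (1 : ℝ) :=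
                    Real.rpow_le_rpow_of_exponent_ge hε hε1 (by linarith)
                _ = ε := Real.rpow_one _
            gcongr
          unfold polyWeight
          rw [Real.rpow_neg hA.le, div_le_iff₀ hys, mul_assoc, inv_mul_eq_div,
            le_div_iff₀ (by positivity), one_mul]
          exact h7.trans h8
        calc polyWeight s ε (x - y) / |y| ^ s = polyWeight s ε (x - y) * (1 / |y| ^ s) := by ring
          _ ≤ polyWeight s ε (x - y) * (polyWeight s ε x * (4 * ε)) := by gcongr
          _ = polyWeight s ε x * (4 * (ε * polyWeight s ε (x - y))) := by ring
          _ ≤ _ := by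
            gcongr
            have : 0 < 1 / |y| ^ s := by positivity
            linarith
    calc |polyWeight s ε x - polyWeight s ε (x - y)| / |y| ^ s
        ≤ (polyWeight s ε x + polyWeight s ε (x - y)) / |y| ^ s := by gcongr
      _ = polyWeight s ε x * (1 / |y| ^ s) + polyWeight s ε (x - y) / |y| ^ s := by ring
      _ ≤ _ := by linarith

/-- The constant in the bound `|L_β φ| ≤ C φ` for the weights `φ = polyWeight (1+2β) ε`. -/
noncomputable def weightConst (β : ℝ) : ℝ :=
  5 * (∫ y, truncKer β y) + 4 * ∫ x, polyWeight (1 + 2 * β) 1 x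

lemma weightConst_nonneg (β : ℝ) : 0 ≤ weightConst β := by
  unfold weightConst
  have h1 : 0 ≤ ∫ y, truncKer β y := integral_nonneg (truncKer_nonneg β)
  have h2 : 0 ≤ ∫ x, polyWeight (1 + 2 * β) 1 x :=
    integral_nonneg fun x => (polyWeight_pos _ _ x).le
  positivity

lemma integral_mul_fracDiss_ge {β ε M : ℝ} {u : ℝ → ℝ} (h0 : 0 < β) (h1 : β < 1 / 2) (hε : 0 < ε)
    (hε1 : ε ≤ 1) (hc : Continuous u) (hu : ∀ x, 0 ≤ u x) (huM : ∀ x, u x ≤ M)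
    (hf : ∀ x y, |u x - u (x + y)| ≤ 2 * M * min 1 |y|) :
    -(weightConst β * ∫ x, u x * polyWeight (1 + 2 * β) ε x)
      ≤ ∫ x, polyWeight (1 + 2 * β) ε x * fracDiss β u x := by
  set φ := polyWeight (1 + 2 * β) ε with hφ
  have hM0 : 0 ≤ M := (hu 0).trans (huM 0)
  have hφc : Continuous φ := continuous_polyWeight _ _
  have hφi : Integrable φ := integrable_polyWeight hε hε1 (by linarith)
  have hφpos : ∀ x, 0 < φ x := polyWeight_pos _ _
  have hKi := integrable_truncKer h0 h1
  have huφ : Integrable fun x => u x * φ x :=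
    (hφi.const_mul M).mono' (hc.mul hφc).aestronglyMeasurable (Eventually.of_forall fun x => by
      rw [Real.norm_eq_abs, abs_of_nonneg (mul_nonneg (hu x) (hφpos x).le)]
      exact mul_le_mul_of_nonneg_right (huM x) (hφpos x).le)
  have hbK : Measurable fun y : ℝ => |y| ^ (1 + 2 * β) := by fun_prop
  -- the two forms of the double integral
  let F : ℝ → ℝ → ℝ := fun x y => φ x * ((u x - u (x + y)) / |y| ^ (1 + 2 * β))
  let G : ℝ → ℝ → ℝ := fun x y => u x * ((φ x - φ (x - y)) / |y| ^ (1 + 2 * β))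
  have hFm : Measurable (Function.uncurry F) := by
    have hcu : Continuous fun p : ℝ × ℝ => u p.1 - u (p.1 + p.2) := by fun_prop
    have hcφ : Continuous fun p : ℝ × ℝ => φ p.1 := by fun_prop
    exact hcφ.measurable.mul (hcu.measurable.div (hbK.comp measurable_snd))
  have hGm : Measurable (Function.uncurry G) := by
    have hcu : Continuous fun p : ℝ × ℝ => φ p.1 - φ (p.1 - p.2) := by fun_prop
    have hcφ : Continuous fun p : ℝ × ℝ => u p.1 := by fun_prop
    exact hcφ.measurable.mul (hcu.measurable.div (hbK.comp measurable_snd))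
  have hFi : Integrable (Function.uncurry F) (volume.prod volume) := by
    refine (hφi.mul_prod (hKi.const_mul (2 * M))).mono' hFm.aestronglyMeasurable
      (Eventually.of_forall fun p => ?_)
    simp only [Function.uncurry, F, Real.norm_eq_abs, abs_mul, abs_of_pos (hφpos p.1)]
    gcongr
    · exact (hφpos p.1).le
    · exact abs_fracDiss_integrand_le hf p.1 p.2
  have hGb : ∀ x y, |G x y| ≤ u x * (φ x * (5 * truncKer β y + 4 * (ε * φ (x - y)))) := by
    intro x y
    simp only [G]
    rw [abs_mul, abs_of_nonneg (hu x), abs_div, abs_of_nonneg (Real.rpow_nonneg (abs_nonneg y) _)]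
    exact mul_le_mul_of_nonneg_left (abs_polyWeight_sub_div_le h0 h1 hε hε1 x y) (hu x)
  have hbi : ∀ x, Integrable fun y => 5 * truncKer β y + 4 * (ε * φ (x - y)) := fun x =>
    (hKi.const_mul 5).add (((hφi.comp_sub_left x).const_mul ε).const_mul 4)
  have hbint : ∀ x, ∫ y, (5 * truncKer β y + 4 * (ε * φ (x - y))) = weightConst β := by
    intro x
    rw [integral_add (hKi.const_mul 5) (((hφi.comp_sub_left x).const_mul ε).const_mul 4),
      integral_const_mul, integral_const_mul, integral_const_mul,
      integral_sub_left_eq_self φ volume x, hφ, integral_polyWeight hε, weightConst]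
    field_simp
  have hGi : Integrable (Function.uncurry G) (volume.prod volume) := by
    rw [integrable_prod_iff hGm.aestronglyMeasurable]
    have hGx : ∀ x, Integrable (G x) := fun x =>
      (((hbi x).const_mul (φ x)).const_mul (u x)).mono'
        (hGm.comp measurable_prodMk_left).aestronglyMeasurable
        (Eventually.of_forall fun y => hGb x y)
    refine ⟨Eventually.of_forall hGx, ?_⟩
    refine (huφ.mul_const (weightConst β)).mono'
      hGm.norm.aestronglyMeasurable.integral_prod_right' (Eventually.of_forall fun x => ?_)
    rw [Real.norm_eq_abs, abs_of_nonneg (integral_nonneg fun y => norm_nonneg _)]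
    calc ∫ y, ‖G x y‖ ≤ ∫ y, u x * (φ x * (5 * truncKer β y + 4 * (ε * φ (x - y)))) :=
          integral_mono (hGx x).norm (((hbi x).const_mul (φ x)).const_mul (u x)) fun y => hGb x y
      _ = u x * φ x * weightConst β := by
          rw [integral_const_mul, integral_const_mul, hbint]; ring
  have hswap : ∀ y, ∫ x, F x y = ∫ x, G x y := by
    intro y
    have hi1 : Integrable fun x => φ x * u (x + y) :=
      (hφi.const_mul M).mono' (by fun_prop) (Eventually.of_forall fun x => by
        rw [Real.norm_eq_abs, abs_of_nonneg (mul_nonneg (hφpos x).le (hu _)), mul_comm]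
        exact mul_le_mul_of_nonneg_right (huM _) (hφpos x).le)
    have hsh : ∫ x, φ x * u (x + y) = ∫ x, u x * φ (x - y) := by
      rw [← integral_add_right_eq_self (fun x => u x * φ (x - y)) y]
      congr 1; ext x; rw [add_sub_cancel_right, mul_comm]
    have hi2 : Integrable fun x => u x * φ (x - y) := by
      have := hi1.comp_sub_right y
      simpa [mul_comm] using this
    have hi3 : Integrable fun x => φ x * u x := by simpa [mul_comm] using huφ
    have e1 : ∀ x, F x y = (φ x * u x - φ x * u (x + y)) / |y| ^ (1 + 2 * β) := fun x => by
      simp only [F]; ring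
    have e2 : ∀ x, G x y = (φ x * u x - u x * φ (x - y)) / |y| ^ (1 + 2 * β) := fun x => by
      simp only [G]; ring
    simp_rw [e1, e2]
    rw [integral_div, integral_div, integral_sub hi3 hi1, integral_sub hi3 hi2, hsh]
  have hmain : ∫ x, φ x * fracDiss β u x = ∫ x, ∫ y, G x y := by
    have : ∀ x, φ x * fracDiss β u x = ∫ y, F x y := fun x => by
      simp only [F, fracDiss, integral_const_mul]
    simp_rw [this]
    rw [integral_integral_swap hFi, integral_integral_swap hGi]
    simp_rw [hswap]
  rw [hmain, ← integral_const_mul, ← integral_neg]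
  refine integral_mono (huφ.const_mul _).neg hGi.integral_prod_left fun x => ?_
  have h2 : ‖∫ y, G x y‖ ≤ ∫ y, u x * (φ x * (5 * truncKer β y + 4 * (ε * φ (x - y)))) :=
    norm_integral_le_of_norm_le (((hbi x).const_mul (φ x)).const_mul (u x))
      (Eventually.of_forall fun y => hGb x y)
  have h3 : ∫ y, u x * (φ x * (5 * truncKer β y + 4 * (ε * φ (x - y))))
      = u x * (φ x * weightConst β) := by
    rw [integral_const_mul, integral_const_mul, hbint]
  rw [h3, Real.norm_eq_abs] at h2
  have := neg_abs_le (∫ y, G x y)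
  simp only
  linarith

/-! ### Weighted energy estimates -/

/-- A convex function `Ψ` with derivative `Ψ'`, homogeneous of degree two, such as `v²` or
`(max v 0)²`. -/
structure IsEnergyFn (Ψ Ψ' : ℝ → ℝ) : Prop where
  hasDerivAt : ∀ v, HasDerivAt Ψ (Ψ' v) v
  cont : Continuous Ψ'
  nonneg : ∀ v, 0 ≤ Ψ v
  le_sq : ∀ v, Ψ v ≤ v ^ 2
  abs_deriv_le : ∀ v, |Ψ' v| ≤ 2 * |v|
  deriv_mul_self : ∀ v, Ψ' v * v = 2 * Ψ v
  sub_le : ∀ p q, Ψ p - Ψ q ≤ Ψ' p * (p - q)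

lemma isEnergyFn_sq : IsEnergyFn (fun v => v ^ 2) (fun v => 2 * v) where
  hasDerivAt v := by simpa using hasDerivAt_pow 2 v
  cont := by fun_prop
  nonneg v := sq_nonneg v
  le_sq v := le_rfl
  abs_deriv_le v := by rw [abs_mul]; simp
  deriv_mul_self v := by ring
  sub_le p q := by nlinarith [sq_nonneg (p - q)]

lemma isEnergyFn_posPart_sq : IsEnergyFn (fun v => max v 0 ^ 2) (fun v => 2 * max v 0) where
  hasDerivAt v := by
    rcases lt_trichotomy v 0 with h | rfl | h
    · have : (fun v : ℝ => max v 0 ^ 2) =ᶠ[𝓝 v] fun _ => 0 := by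
        filter_upwards [Iio_mem_nhds h] with w hw
        rw [max_eq_right (le_of_lt hw)]; simp
      rw [max_eq_right h.le, mul_zero]
      exact (hasDerivAt_const v 0).congr_of_eventuallyEq this
    · rw [max_self, mul_zero, hasDerivAt_iff_isLittleO]
      have h1 : (fun x : ℝ => max x 0 ^ 2 - max 0 0 ^ 2 - (x - 0) • (0 : ℝ))
          =O[𝓝 0] fun x : ℝ => x ^ 2 := by
        refine Asymptotics.isBigO_of_le _ fun x => ?_
        simp only [Real.norm_eq_abs, max_self, smul_zero, sub_zero]
        rw [abs_of_nonneg (sq_nonneg x), abs_of_nonneg (by simp)]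
        rcases max_cases x 0 with ⟨h, _⟩ | ⟨h, _⟩ <;> rw [h]
        · simp
        · simp; positivity
      refine h1.trans_isLittleO ?_
      have := Asymptotics.isLittleO_pow_id (𝕜 := ℝ) one_lt_two
      simpa using this
    · have : (fun v : ℝ => max v 0 ^ 2) =ᶠ[𝓝 v] fun v => v ^ 2 := by
        filter_upwards [Ioi_mem_nhds h] with w hw
        rw [max_eq_left (le_of_lt hw)]
      rw [max_eq_left h.le]
      exact (isEnergyFn_sq.hasDerivAt v).congr_of_eventuallyEq this
  cont := by fun_prop
  nonneg v := sq_nonneg _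
  le_sq v := by
    rcases max_cases v 0 with ⟨h, _⟩ | ⟨h, _⟩ <;> rw [h]
    nlinarith [sq_nonneg v]
  abs_deriv_le v := by
    rw [abs_mul, abs_two]
    refine mul_le_mul_of_nonneg_left ?_ two_pos.le
    rcases max_cases v 0 with ⟨h, _⟩ | ⟨h, _⟩ <;> rw [h]
    exact (abs_zero.trans_le (abs_nonneg v))
  deriv_mul_self v := by
    rcases max_cases v 0 with ⟨h, _⟩ | ⟨h, _⟩ <;> rw [h] <;> ring
  sub_le p q := by
    rcases max_cases p 0 with ⟨h, _⟩ | ⟨h, _⟩ <;> rcases max_cases q 0 with ⟨h', _⟩ | ⟨h', _⟩ <;>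
      rw [h, h'] <;> nlinarith [sq_nonneg (p - q), sq_nonneg p, sq_nonneg q]

lemma IsEnergyFn.continuous {Ψ Ψ' : ℝ → ℝ} (hΨ : IsEnergyFn Ψ Ψ') : Continuous Ψ :=
  continuous_iff_continuousAt.2 fun x => (hΨ.hasDerivAt x).continuousAt

lemma one_add_abs_rpow_le {β : ℝ} (h0 : 0 < β) (h1 : β < 1 / 2) (x : ℝ) :
    1 ≤ (1 + |x|) ^ β ∧ (1 + |x|) ^ β ≤ 1 + |x| := by
  have h : 1 ≤ 1 + |x| := by linarith [abs_nonneg x]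
  refine ⟨Real.one_le_rpow h h0.le, ?_⟩
  calc (1 + |x|) ^ β ≤ (1 + |x|) ^ (1 : ℝ) := Real.rpow_le_rpow_of_exponent_le h (by linarith)
    _ = _ := Real.rpow_one _

section

variable {β κ ε B M : ℝ} {Ψ Ψ' : ℝ → ℝ}

lemma IsEnergyFn.mul_fracDiss_ge (hΨ : IsEnergyFn Ψ Ψ') (h0 : 0 < β) (h1 : β < 1 / 2)
    {v v' : ℝ → ℝ} (hv : ∀ x, HasDerivAt v (v' x) x) (hvM : ∀ x, |v x| ≤ M)
    (hvM' : ∀ x, |v' x| ≤ M) :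
    (∀ x y, |Ψ (v x) - Ψ (v (x + y))| ≤ 2 * (2 * M ^ 2) * min 1 |y|) ∧
    ∀ x, fracDiss β (fun x => Ψ (v x)) x ≤ Ψ' (v x) * fracDiss β v x := by
  have hM0 : 0 ≤ M := (abs_nonneg _).trans (hvM 0)
  have hc : Continuous v := continuous_iff_continuousAt.2 fun x => (hv x).continuousAt
  have hd : ∀ x, HasDerivAt (fun x => Ψ (v x)) (Ψ' (v x) * v' x) x := fun x =>
    (hΨ.hasDerivAt (v x)).comp x (hv x)
  have hlip := abs_sub_add_le_min (M := 2 * M ^ 2) hd (fun x => by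
    rw [abs_of_nonneg (hΨ.nonneg _)]
    have := hΨ.le_sq (v x)
    have := abs_le.1 (hvM x)
    nlinarith [sq_nonneg M]) (fun x => by
    rw [abs_mul]
    have := hΨ.abs_deriv_le (v x)
    calc |Ψ' (v x)| * |v' x| ≤ (2 * M) * M :=
        mul_le_mul (this.trans (by linarith [hvM x])) (hvM' x) (abs_nonneg _) (by positivity)
      _ = 2 * M ^ 2 := by ring)
  refine ⟨hlip, fun x => ?_⟩
  unfold fracDiss
  rw [← integral_const_mul]
  refine integral_mono (integrable_fracDiss_integrand h0 h1 (hΨ.continuous.comp hc) hlip x)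
    ((integrable_fracDiss_integrand h0 h1 hc (abs_sub_add_le_min hv hvM hvM') x).const_mul _)
    fun y => ?_
  simp only
  rw [← mul_div_assoc]
  gcongr
  exact hΨ.sub_le _ _

lemma IsEnergyFn.integral_le (hΨ : IsEnergyFn Ψ Ψ') (h0 : 0 < β) (h1 : β < 1 / 2) (hκ : 0 ≤ κ)
    (hε : 0 < ε) (hε1 : ε ≤ 1)
    {v v' v'' a b : ℝ → ℝ} (hv : ∀ x, HasDerivAt v (v' x) x) (hv' : ∀ x, HasDerivAt v' (v'' x) x)
    (hvM : ∀ x, |v x| ≤ M) (hvM' : ∀ x, |v' x| ≤ M) (hvM'' : ∀ x, |v'' x| ≤ M)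
    (ha : ∀ x, HasDerivAt a (deriv a x) x) (haB : ∀ x, |a x| ≤ B * (1 + |x|) ^ β)
    (haB' : ∀ x, |deriv a x| ≤ B) (hb : Measurable b) (hbB : ∀ x, |b x| ≤ B) :
    ∫ x, Ψ' (v x) * (a x * v' x + b x * v x - κ * fracDiss β v x) * polyWeight (1 + 2 * β) ε x
      ≤ (6 * B + κ * weightConst β) * ∫ x, Ψ (v x) * polyWeight (1 + 2 * β) ε x := by
  have hM0 : 0 ≤ M := (abs_nonneg _).trans (hvM 0)
  have hB0 : 0 ≤ B := (abs_nonneg _).trans (haB' 0)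
  have hc : Continuous v := continuous_iff_continuousAt.2 fun x => (hv x).continuousAt
  have hc' : Continuous v' := continuous_iff_continuousAt.2 fun x => (hv' x).continuousAt
  have hca : Continuous a := continuous_iff_continuousAt.2 fun x => (ha x).continuousAt
  have hcL : Continuous (fracDiss β v) := continuous_iff_continuousAt.2 fun x =>
    (hasDerivAt_fracDiss h0 h1 hv hv' hvM hvM' hvM'' x).continuousAt
  set φ := polyWeight (1 + 2 * β) ε with hφ
  have hφc : Continuous φ := continuous_polyWeight _ _
  have hφi : Integrable φ := integrable_polyWeight hε hε1 (by linarith)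
  have hφpos : ∀ x, 0 < φ x := polyWeight_pos _ _
  have hφd : ∀ x, HasDerivAt φ (deriv φ x) x := fun x =>
    (hasDerivAt_polyWeight (1 + 2 * β) ε x).differentiableAt.hasDerivAt
  have hφd3 : ∀ x, (1 + |x|) * |deriv φ x| ≤ 3 * φ x := fun x =>
    (deriv_polyWeight_bound (by linarith) (by linarith) hε hε1 x).1
  have hφb : Integrable fun x => (1 + |x|) ^ β * φ x :=
    integrable_one_add_abs_rpow_mul_polyWeight hε hε1 h0.le (by linarith)
  have hΨc := hΨ.continuous
  have hΨ'c := hΨ.cont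
  have hΨM : ∀ x, |Ψ (v x)| ≤ M ^ 2 := fun x => by
    rw [abs_of_nonneg (hΨ.nonneg _)]
    have := hΨ.le_sq (v x)
    have := abs_le.1 (hvM x)
    nlinarith [sq_nonneg M]
  have hΨ'M : ∀ x, |Ψ' (v x)| ≤ 2 * M := fun x =>
    (hΨ.abs_deriv_le _).trans (by linarith [hvM x])
  have hd : ∀ x, HasDerivAt (fun x => Ψ (v x)) (Ψ' (v x) * v' x) x := fun x =>
    (hΨ.hasDerivAt (v x)).comp x (hv x)
  have hu : ∀ x, HasDerivAt (fun x => a x * φ x) (deriv a x * φ x + a x * deriv φ x) x :=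
    fun x => (ha x).mul (hφd x)
  have hu'b : ∀ x, |deriv a x * φ x + a x * deriv φ x| ≤ 4 * B * φ x := fun x => by
    refine (abs_add_le _ _).trans ?_
    rw [abs_mul, abs_mul, abs_of_pos (hφpos x)]
    have e1 : |deriv a x| * φ x ≤ B * φ x :=
      mul_le_mul_of_nonneg_right (haB' x) (hφpos x).le
    have e2 : |a x| * |deriv φ x| ≤ B * (3 * φ x) := by
      calc |a x| * |deriv φ x| ≤ (B * (1 + |x|)) * |deriv φ x| := by
            gcongr
            exact (haB x).trans (by gcongr; exact (one_add_abs_rpow_le h0 h1 x).2)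
        _ = B * ((1 + |x|) * |deriv φ x|) := by ring
        _ ≤ _ := mul_le_mul_of_nonneg_left (hφd3 x) hB0
    linarith
  have hΨφ : Integrable fun x => Ψ (v x) * φ x :=
    (hφi.const_mul (M ^ 2)).mono' (by fun_prop) (Eventually.of_forall fun x => by
      rw [Real.norm_eq_abs, abs_mul, abs_of_pos (hφpos x)]
      exact mul_le_mul_of_nonneg_right (hΨM x) (hφpos x).le)
  have i1 : Integrable fun x => (a x * φ x) * (Ψ' (v x) * v' x) := by
    refine (hφb.const_mul (B * (2 * M * M))).mono' (by fun_prop) (Eventually.of_forall fun x => ?_)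
    rw [Real.norm_eq_abs, abs_mul, abs_mul, abs_mul, abs_of_pos (hφpos x)]
    have hφx := (hφpos x).le
    calc |a x| * φ x * (|Ψ' (v x)| * |v' x|)
        ≤ (B * (1 + |x|) ^ β) * φ x * ((2 * M) * M) := by
          gcongr
          · exact haB x
          · exact hΨ'M x
          · exact hvM' x
      _ = _ := by ring
  have hmu' : Measurable fun x => deriv a x * φ x + a x * deriv φ x :=
    ((measurable_deriv a).mul hφc.measurable).add (hca.measurable.mul (measurable_deriv φ))
  have i2 : Integrable fun x => (deriv a x * φ x + a x * deriv φ x) * Ψ (v x) := by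
    refine (hφi.const_mul (4 * B * M ^ 2)).mono'
      (hmu'.mul (hΨc.comp hc).measurable).aestronglyMeasurable (Eventually.of_forall fun x => ?_)
    rw [Real.norm_eq_abs, abs_mul]
    calc _ ≤ (4 * B * φ x) * M ^ 2 :=
          mul_le_mul (hu'b x) (hΨM x) (abs_nonneg _)
            (by have := (hφpos x).le; positivity)
      _ = _ := by ring
  have i3 : Integrable fun x => (a x * φ x) * Ψ (v x) := by
    refine (hφb.const_mul (B * M ^ 2)).mono' (by fun_prop) (Eventually.of_forall fun x => ?_)
    rw [Real.norm_eq_abs, abs_mul, abs_mul, abs_of_pos (hφpos x)]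
    have hφx := (hφpos x).le
    calc |a x| * φ x * |Ψ (v x)|
        ≤ (B * (1 + |x|) ^ β) * φ x * M ^ 2 := by
          gcongr
          · exact haB x
          · exact hΨM x
      _ = _ := by ring
  have hparts := integral_mul_deriv_eq_deriv_mul_of_integrable
    (fun x _ => hu x) (fun x _ => hd x) i1 i2 i3
  have t1 : ∫ x, (a x * φ x) * (Ψ' (v x) * v' x) ≤ 4 * B * ∫ x, Ψ (v x) * φ x := by
    rw [hparts, ← integral_neg, ← integral_const_mul]
    refine integral_mono i2.neg (hΨφ.const_mul _) fun x => ?_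
    simp only
    have := neg_abs_le (deriv a x * φ x + a x * deriv φ x)
    have := hu'b x
    have := hΨ.nonneg (v x)
    nlinarith
  have i4 : Integrable fun x => b x * (Ψ (v x) * φ x) :=
    hΨφ.bdd_mul (c := B) hb.aestronglyMeasurable (Eventually.of_forall hbB)
  have t2 : ∫ x, b x * (Ψ (v x) * φ x) ≤ B * ∫ x, Ψ (v x) * φ x := by
    rw [← integral_const_mul]
    refine integral_mono i4 (hΨφ.const_mul _) fun x => ?_
    exact mul_le_mul_of_nonneg_right ((le_abs_self _).trans (hbB x))
      (mul_nonneg (hΨ.nonneg _) (hφpos x).le)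
  have hLb := abs_fracDiss_le h0 h1 (abs_sub_add_le_min hv hvM hvM')
  obtain ⟨hlip, hconv⟩ := hΨ.mul_fracDiss_ge h0 h1 hv hvM hvM'
  have hKnn : 0 ≤ ∫ y, truncKer β y := integral_nonneg (truncKer_nonneg β)
  have i5 : Integrable fun x => φ x * (Ψ' (v x) * fracDiss β v x) := by
    refine (hφi.mul_const (2 * M * (2 * M * ∫ y, truncKer β y))).mono' (by fun_prop)
      (Eventually.of_forall fun x => ?_)
    rw [Real.norm_eq_abs, abs_mul, abs_mul, abs_of_pos (hφpos x)]
    gcongr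
    · exact (hφpos x).le
    · exact hΨ'M x
    · exact hLb x
  have i6 : Integrable fun x => φ x * fracDiss β (fun x => Ψ (v x)) x := by
    have hLb2 := abs_fracDiss_le h0 h1 hlip
    refine (hφi.mul_const (2 * (2 * M ^ 2) * ∫ y, truncKer β y)).mono' ?_ (Eventually.of_forall fun x => ?_)
    · have hm : StronglyMeasurable (Function.uncurry
          fun x y => (Ψ (v x) - Ψ (v (x + y))) / |y| ^ (1 + 2 * β)) := by
        have hcu : Continuous fun p : ℝ × ℝ => Ψ (v p.1) - Ψ (v (p.1 + p.2)) := by fun_prop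
        have hbK : Measurable fun y : ℝ => |y| ^ (1 + 2 * β) := by fun_prop
        exact (hcu.measurable.div (hbK.comp measurable_snd)).stronglyMeasurable
      exact hφc.aestronglyMeasurable.mul hm.integral_prod_right.aestronglyMeasurable
    · rw [Real.norm_eq_abs, abs_mul, abs_of_pos (hφpos x)]
      exact mul_le_mul_of_nonneg_left (hLb2 x) (hφpos x).le
  have t3 : -(weightConst β * ∫ x, Ψ (v x) * φ x) ≤ ∫ x, φ x * (Ψ' (v x) * fracDiss β v x) := by
    refine (integral_mul_fracDiss_ge h0 h1 hε hε1 (hΨc.comp hc) (fun x => hΨ.nonneg (v x))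
      (M := 2 * M ^ 2) (fun x => ?_) hlip).trans (integral_mono i6 i5 fun x => ?_)
    · have := (le_abs_self _).trans (hΨM x)
      simp only [Function.comp]
      nlinarith [sq_nonneg M]
    · exact mul_le_mul_of_nonneg_left (hconv x) (hφpos x).le
  have hsplit : ∀ x, Ψ' (v x) * (a x * v' x + b x * v x - κ * fracDiss β v x) * φ x
      = (a x * φ x) * (Ψ' (v x) * v' x) + 2 * (b x * (Ψ (v x) * φ x))
        - κ * (φ x * (Ψ' (v x) * fracDiss β v x)) := fun x => by
    linear_combination b x * φ x * hΨ.deriv_mul_self (v x)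
  simp_rw [hsplit]
  have i7 : Integrable fun x => (a x * φ x) * (Ψ' (v x) * v' x) + 2 * (b x * (Ψ (v x) * φ x)) :=
    i1.add (i4.const_mul 2)
  rw [integral_sub i7 (i5.const_mul κ),
    integral_add i1 (i4.const_mul 2), integral_const_mul, integral_const_mul]
  have t4 : -(κ * ∫ x, φ x * (Ψ' (v x) * fracDiss β v x))
      ≤ κ * (weightConst β * ∫ x, Ψ (v x) * φ x) := by
    rw [← mul_neg]; gcongr; linarith
  linarith

/-- The weighted energy of a solution of a linear transport–dissipation equation with a source
`r` satisfies a differential inequality with constants independent of the weight. -/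
lemma IsEnergyFn.energy_estimate (hΨ : IsEnergyFn Ψ Ψ') (h0 : 0 < β) (h1 : β < 1 / 2) (hκ : 0 ≤ κ)
    (hε : 0 < ε) (hε1 : ε ≤ 1) {T : ℝ}
    {v v' v'' a b r : ℝ → ℝ → ℝ}
    (hv : ∀ t ∈ Icc 0 T, ∀ x, HasDerivAt (fun x => v x t) (v' x t) x)
    (hv' : ∀ t ∈ Icc 0 T, ∀ x, HasDerivAt (fun x => v' x t) (v'' x t) x)
    (hvM : ∀ t ∈ Icc 0 T, ∀ x, |v x t| ≤ M) (hvM' : ∀ t ∈ Icc 0 T, ∀ x, |v' x t| ≤ M)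
    (hvM'' : ∀ t ∈ Icc 0 T, ∀ x, |v'' x t| ≤ M)
    (hvt : ∀ x, ContinuousOn (v x) (Icc 0 T))
    (ha : ∀ t ∈ Icc 0 T, ∀ x, HasDerivAt (fun x => a x t) (deriv (fun x => a x t) x) x)
    (haB : ∀ t ∈ Icc 0 T, ∀ x, |a x t| ≤ B * (1 + |x|) ^ β)
    (haB' : ∀ t ∈ Icc 0 T, ∀ x, |deriv (fun x => a x t) x| ≤ B)
    (hb : ∀ t ∈ Icc 0 T, Measurable fun x => b x t) (hbB : ∀ t ∈ Icc 0 T, ∀ x, |b x t| ≤ B)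
    (hr : ∀ t ∈ Icc 0 T, Measurable fun x => r x t)
    (hrB : ∀ t ∈ Icc 0 T, ∀ x, |r x t| ≤ B * (1 + |x|) ^ β)
    (heq : ∀ t ∈ Ioo 0 T, ∀ x, HasDerivAt (v x)
      (a x t * v' x t + b x t * v x t + r x t - κ * fracDiss β (fun x => v x t) x) t) :
    ContinuousOn (fun t => ∫ x, Ψ (v x t) * polyWeight (1 + 2 * β) ε x) (Icc 0 T) ∧
    ∀ t ∈ Ioo 0 T, ∃ D, HasDerivAt (fun t => ∫ x, Ψ (v x t) * polyWeight (1 + 2 * β) ε x) D t ∧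
      D ≤ (6 * B + κ * weightConst β) * (∫ x, Ψ (v x t) * polyWeight (1 + 2 * β) ε x)
        + ∫ x, Ψ' (v x t) * r x t * polyWeight (1 + 2 * β) ε x := by
  set φ := polyWeight (1 + 2 * β) ε with hφ
  have hφc : Continuous φ := continuous_polyWeight _ _
  have hφi : Integrable φ := integrable_polyWeight hε hε1 (by linarith)
  have hφpos : ∀ x, 0 < φ x := polyWeight_pos _ _
  have hφb : Integrable fun x => (1 + |x|) ^ β * φ x :=
    integrable_one_add_abs_rpow_mul_polyWeight hε hε1 h0.le (by linarith)
  have hΨc := hΨ.continuous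
  have hΨ'c := hΨ.cont
  have hc : ∀ t ∈ Icc 0 T, Continuous fun x => v x t := fun t ht =>
    continuous_iff_continuousAt.2 fun x => (hv t ht x).continuousAt
  have hΨM : ∀ t ∈ Icc 0 T, ∀ x, |Ψ (v x t) * φ x| ≤ M ^ 2 * φ x := fun t ht x => by
    rw [abs_mul, abs_of_pos (hφpos x), abs_of_nonneg (hΨ.nonneg _)]
    have := hΨ.le_sq (v x t)
    have := abs_le.1 (hvM t ht x)
    exact mul_le_mul_of_nonneg_right (by nlinarith [sq_nonneg M]) (hφpos x).le
  have hΨφm : ∀ t ∈ Icc 0 T, AEStronglyMeasurable fun x => Ψ (v x t) * φ x := fun t ht =>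
    ((hΨc.comp (hc t ht)).mul hφc).aestronglyMeasurable
  refine ⟨?_, ?_⟩
  · refine continuousOn_of_dominated (bound := fun x => M ^ 2 * φ x) hΨφm
      (fun t ht => Eventually.of_forall fun x => hΨM t ht x) (hφi.const_mul _)
      (Eventually.of_forall fun x => ?_)
    exact (hΨc.comp_continuousOn (hvt x)).mul continuousOn_const
  · intro t ht
    have hsub : Ioo 0 T ⊆ Icc 0 T := Ioo_subset_Icc_self
    have htI := hsub ht
    have hM0 : 0 ≤ M := (abs_nonneg _).trans (hvM t htI 0)
    have hB0 : 0 ≤ B := (abs_nonneg _).trans (haB' t htI 0)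
    have hKnn : 0 ≤ ∫ y, truncKer β y := integral_nonneg (truncKer_nonneg β)
    set K := ∫ y, truncKer β y with hK
    set vt : ℝ → ℝ → ℝ := fun x t =>
      a x t * v' x t + b x t * v x t + r x t - κ * fracDiss β (fun x => v x t) x with hvt_def
    have hΨ'M : ∀ t ∈ Icc 0 T, ∀ x, |Ψ' (v x t)| ≤ 2 * M := fun t ht x =>
      (hΨ.abs_deriv_le _).trans (by linarith [hvM t ht x])
    have hvtb : ∀ t ∈ Icc 0 T, ∀ x,
        |vt x t| ≤ (2 * B * M + B + κ * (2 * M * K)) * (1 + |x|) ^ β := by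
      intro t ht x
      have hL := abs_fracDiss_le h0 h1 (abs_sub_add_le_min (hv t ht) (hvM t ht) (hvM' t ht)) x
      have hone := (one_add_abs_rpow_le h0 h1 x).1
      set ρ := (1 + |x|) ^ β
      have e1 : |a x t * v' x t| ≤ (B * ρ) * M := by
        rw [abs_mul]; gcongr; exacts [haB t ht x, hvM' t ht x]
      have e2 : |b x t * v x t| ≤ B * M := by
        rw [abs_mul]; gcongr; exacts [hbB t ht x, hvM t ht x]
      have e3 : |κ * fracDiss β (fun x => v x t) x| ≤ κ * (2 * M * K) := by
        rw [abs_mul, abs_of_nonneg hκ]; gcongr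
      have e4 := abs_sub (a x t * v' x t + b x t * v x t + r x t) (κ * fracDiss β (fun x => v x t) x)
      have e5 := abs_add_le (a x t * v' x t + b x t * v x t) (r x t)
      have e6 := abs_add_le (a x t * v' x t) (b x t * v x t)
      have e7 := hrB t ht x
      have e8 : B * M ≤ B * M * ρ := le_mul_of_one_le_right (by positivity) hone
      have e9 : κ * (2 * M * K) ≤ κ * (2 * M * K) * ρ := le_mul_of_one_le_right (by positivity) hone
      simp only [hvt_def]
      nlinarith
    have hvtm : Measurable fun x => vt x t := by
      have m1 : Continuous fun x => a x t :=
        continuous_iff_continuousAt.2 fun x => (ha t htI x).continuousAt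
      have m2 : Continuous fun x => v' x t :=
        continuous_iff_continuousAt.2 fun x => (hv' t htI x).continuousAt
      have m3 : Continuous (fracDiss β fun x => v x t) := continuous_iff_continuousAt.2 fun x =>
        (hasDerivAt_fracDiss h0 h1 (hv t htI) (hv' t htI) (hvM t htI) (hvM' t htI)
          (hvM'' t htI) x).continuousAt
      exact (((m1.measurable.mul m2.measurable).add ((hb t htI).mul (hc t htI).measurable)).add
        (hr t htI)).sub (m3.measurable.const_mul κ)
    have hΨ'm : Measurable fun x => Ψ' (v x t) := (hΨ'c.comp (hc t htI)).measurable
    have hder := hasDerivAt_integral_of_dominated_loc_of_deriv_le (μ := volume)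
      (F := fun t x => Ψ (v x t) * φ x) (F' := fun t x => Ψ' (v x t) * vt x t * φ x)
      (bound := fun x => (2 * M * (2 * B * M + B + κ * (2 * M * K))) * ((1 + |x|) ^ β * φ x))
      (s := Ioo 0 T) (x₀ := t) (Ioo_mem_nhds ht.1 ht.2) ?_ ?_ ?_ ?_ ?_ ?_
    · refine ⟨_, hder.2, ?_⟩
      have hst := hΨ.integral_le (a := fun x => a x t) (b := fun x => b x t) h0 h1 hκ hε hε1
        (hv t htI) (hv' t htI) (hvM t htI) (hvM' t htI) (hvM'' t htI) (ha t htI) (haB t htI)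
        (haB' t htI) (hb t htI) (hbB t htI)
      have hri : Integrable fun x => Ψ' (v x t) * r x t * φ x := by
        refine (hφb.const_mul (2 * M * B)).mono'
          ((hΨ'm.mul (hr t htI)).mul hφc.measurable).aestronglyMeasurable
          (Eventually.of_forall fun x => ?_)
        rw [Real.norm_eq_abs, abs_mul, abs_mul, abs_of_pos (hφpos x)]
        calc |Ψ' (v x t)| * |r x t| * φ x ≤ (2 * M) * (B * (1 + |x|) ^ β) * φ x := by
              gcongr
              · exact (hφpos x).le
              · exact hΨ'M t htI x
              · exact hrB t htI x
          _ = _ := by ring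
      have hsplit : ∀ x, Ψ' (v x t) * vt x t * φ x
          = (Ψ' (v x t) * (a x t * v' x t + b x t * v x t - κ * fracDiss β (fun x => v x t) x) * φ x)
            + Ψ' (v x t) * r x t * φ x := fun x => by simp only [hvt_def]; ring
      have hmi : Integrable fun x => Ψ' (v x t) *
          (a x t * v' x t + b x t * v x t - κ * fracDiss β (fun x => v x t) x) * φ x := by
        refine (hder.1.sub hri).congr (Eventually.of_forall fun x => ?_)
        simp only [Pi.sub_apply, hsplit]; ring
      simp_rw [hsplit]
      rw [integral_add hmi hri]
      linarith
    · filter_upwards [Ioo_mem_nhds ht.1 ht.2] with s hs using hΨφm s (hsub hs)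
    · exact (hφi.const_mul (M ^ 2)).mono' (hΨφm t htI)
        (Eventually.of_forall fun x => hΨM t htI x)
    · exact ((hΨ'm.mul hvtm).mul hφc.measurable).aestronglyMeasurable
    · refine Eventually.of_forall fun x s hs => ?_
      rw [Real.norm_eq_abs, abs_mul, abs_mul, abs_of_pos (hφpos x), ← mul_assoc]
      have := hΨ'M s (hsub hs) x
      have h3 := hvtb s (hsub hs) x
      gcongr ?_ * φ x
      · exact (hφpos x).le
      · calc |Ψ' (v x s)| * |vt x s| ≤ (2 * M) * _ :=
              mul_le_mul this h3 (abs_nonneg _) (by positivity)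
          _ = _ := by ring
    · exact hφb.const_mul _
    · refine Eventually.of_forall fun x s hs => ?_
      exact ((hΨ.hasDerivAt (v x s)).comp s (heq s hs x)).mul_const _

end

/-! ### Gronwall and Fatou -/

lemma le_exp_mul_of_deriv_le {F : ℝ → ℝ} {T K : ℝ} (hc : ContinuousOn F (Icc 0 T))
    (hd : ∀ t ∈ Ioo 0 T, ∃ D, HasDerivAt F D t ∧ D ≤ K * F t) :
    ∀ t ∈ Icc 0 T, F t ≤ Real.exp (K * t) * F 0 := by
  intro t ht
  have hcE : Continuous fun t : ℝ => Real.exp (-K * t) := by fun_prop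
  have hanti : AntitoneOn (fun t => Real.exp (-K * t) * F t) (Icc 0 T) := by
    have hder : ∀ t ∈ Ioo 0 T, ∃ D, HasDerivAt (fun t => Real.exp (-K * t) * F t) D t ∧ D ≤ 0 := by
      intro t ht
      obtain ⟨D, hD, hle⟩ := hd t ht
      have h1 : HasDerivAt (fun t : ℝ => Real.exp (-K * t)) (Real.exp (-K * t) * -K) t := by
        have := ((hasDerivAt_id t).const_mul (-K)).exp
        simpa using this
      refine ⟨_, h1.mul hD, ?_⟩
      have := Real.exp_pos (-K * t)
      nlinarith
    refine antitoneOn_of_deriv_nonpos (convex_Icc 0 T) (hcE.continuousOn.mul hc) ?_ ?_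
    · rw [interior_Icc]
      intro t ht
      obtain ⟨D, hD, _⟩ := hder t ht
      exact hD.differentiableAt.differentiableWithinAt
    · rw [interior_Icc]
      intro t ht
      obtain ⟨D, hD, hle⟩ := hder t ht
      rw [hD.deriv]; exact hle
  have h := hanti (left_mem_Icc.2 (ht.1.trans ht.2)) ht ht.1
  simp only [mul_zero, Real.exp_zero, one_mul] at h
  have he := Real.exp_pos (K * t)
  calc F t = Real.exp (K * t) * (Real.exp (-K * t) * F t) := by
        rw [← mul_assoc, ← Real.exp_add]; simp
    _ ≤ _ := by gcongr

lemma integrable_of_weighted_bound {s C M : ℝ} {u : ℝ → ℝ} (hs : 1 < s) (hc : Continuous u)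
    (hu : ∀ x, 0 ≤ u x) (huM : ∀ x, u x ≤ M)
    (h : ∀ ε, 0 < ε → ε ≤ 1 → ∫ x, u x * polyWeight s ε x ≤ C) :
    Integrable u ∧ ∫ x, u x ≤ C := by
  have hwpos := polyWeight_pos s
  have hi : ∀ ε, 0 < ε → ε ≤ 1 → Integrable fun x => u x * polyWeight s ε x := by
    intro ε hε hε1
    refine ((integrable_polyWeight hε hε1 hs).const_mul M).mono'
      (hc.mul (continuous_polyWeight s ε)).aestronglyMeasurable (Eventually.of_forall fun x => ?_)
    rw [Real.norm_eq_abs, abs_of_nonneg (mul_nonneg (hu x) (hwpos ε x).le)]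
    exact mul_le_mul_of_nonneg_right (huM x) (hwpos ε x).le
  have hC : 0 ≤ C := (integral_nonneg fun x => mul_nonneg (hu x) (hwpos 1 x).le).trans
    (h 1 one_pos le_rfl)
  have hfat : ∫⁻ x, ENNReal.ofReal (u x) ≤ ENNReal.ofReal C := by
    have hεpos : ∀ n : ℕ, 0 < (1 / ((n : ℝ) + 1)) := fun n => by positivity
    have hεle : ∀ n : ℕ, (1 / ((n : ℝ) + 1)) ≤ 1 := fun n => by
      rw [div_le_one (by positivity)]; linarith [Nat.cast_nonneg (α := ℝ) n]
    have hlim : ∀ x, Tendsto (fun n : ℕ => ENNReal.ofReal (u x * polyWeight s (1 / ((n : ℝ) + 1)) x))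
        atTop (𝓝 (ENNReal.ofReal (u x))) := by
      intro x
      refine (ENNReal.continuous_ofReal.tendsto _).comp ?_
      have h1 : Tendsto (fun n : ℕ => 1 + ((1 / ((n : ℝ) + 1)) * x) ^ 2) atTop (𝓝 1) := by
        have := ((tendsto_one_div_add_atTop_nhds_zero_nat (𝕜 := ℝ)).mul_const x).pow 2
        simpa using this.const_add 1
      have h2 := h1.rpow_const (p := -(s / 2)) (Or.inl one_ne_zero)
      rw [Real.one_rpow] at h2
      simpa [polyWeight] using h2.const_mul (u x)
    calc ∫⁻ x, ENNReal.ofReal (u x)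
        = ∫⁻ x, liminf (fun n : ℕ => ENNReal.ofReal (u x * polyWeight s (1 / ((n : ℝ) + 1)) x))
            atTop := by
          congr 1; ext x; rw [(hlim x).liminf_eq]
      _ ≤ liminf (fun n : ℕ => ∫⁻ x, ENNReal.ofReal (u x * polyWeight s (1 / ((n : ℝ) + 1)) x))
            atTop := lintegral_liminf_le fun n =>
              ((hc.mul (continuous_polyWeight s _)).measurable).ennreal_ofReal
      _ ≤ liminf (fun _ : ℕ => ENNReal.ofReal C) atTop := by
          refine liminf_le_liminf (Eventually.of_forall fun n => ?_)
          rw [← ofReal_integral_eq_lintegral_ofReal (hi _ (hεpos n) (hεle n))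
            (Eventually.of_forall fun x => mul_nonneg (hu x) (hwpos _ x).le)]
          exact ENNReal.ofReal_le_ofReal (h _ (hεpos n) (hεle n))
      _ = ENNReal.ofReal C := liminf_const _
  have hint : Integrable u := ⟨hc.aestronglyMeasurable, by
    rw [hasFiniteIntegral_iff_ofReal (Eventually.of_forall hu)]
    exact hfat.trans_lt ENNReal.ofReal_lt_top⟩
  refine ⟨hint, ?_⟩
  rw [← ofReal_integral_eq_lintegral_ofReal hint (Eventually.of_forall hu)] at hfat
  exact (ENNReal.ofReal_le_ofReal_iff hC).1 hfat

/-! ### Solutions -/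

/-- The `j`-th spatial derivative. -/
noncomputable def dx (θ : ℝ → ℝ → ℝ) (j : ℕ) (x t : ℝ) : ℝ := iteratedDeriv j (fun z => θ z t) x

/-- A smooth solution of `∂_t θ = a ∂_x θ - κ L_β θ` where `a` is the Hilbert transform of `θ`. -/
structure IsSolution (β κ : ℝ) (θ a : ℝ → ℝ → ℝ) : Prop where
  smooth : ContDiffOn ℝ (⊤ : ℕ∞) (fun p : ℝ × ℝ => θ p.1 p.2) (univ ×ˢ Ici 0)
  bdd : ∀ T > (0 : ℝ), ∀ j : ℕ, ∃ M, ∀ x, ∀ t ∈ Icc (0 : ℝ) T, |dx θ j x t| ≤ M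
  hilbert : ∀ t ∈ Ici (0 : ℝ), ∀ x,
    Tendsto (fun R => ∫ y in (0 : ℝ)..R, symmQuot (fun x' => θ x' t) x y) atTop
      (𝓝 (Real.pi * a x t))
  eqn : ∀ x, ∀ t ∈ Ici (0 : ℝ), HasDerivWithinAt (fun s => θ x s)
    (a x t * dx θ 1 x t - κ * fracDiss β (fun x' => θ x' t) x) (Ici 0) t

namespace IsSolution

variable {β κ : ℝ} {θ a : ℝ → ℝ → ℝ}

lemma contDiff_slice (h : IsSolution β κ θ a) {t : ℝ} (ht : 0 ≤ t) :
    ContDiff ℝ (⊤ : ℕ∞) fun x => θ x t := by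
  rw [← contDiffOn_univ]
  have : ContDiffOn ℝ (⊤ : ℕ∞) (fun x : ℝ => (x, t)) univ := by fun_prop
  exact h.smooth.comp this fun x _ => ⟨mem_univ _, ht⟩

lemma hasDerivAt_dx (h : IsSolution β κ θ a) {t : ℝ} (ht : 0 ≤ t) (j : ℕ) (x : ℝ) :
    HasDerivAt (fun x => dx θ j x t) (dx θ (j + 1) x t) x := by
  unfold dx
  rw [iteratedDeriv_succ]
  refine DifferentiableAt.hasDerivAt ?_
  exact ((h.contDiff_slice ht).differentiable_iteratedDeriv j
    (by exact_mod_cast WithTop.coe_lt_top _)).differentiableAt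

lemma hasDerivAt_space (h : IsSolution β κ θ a) {t : ℝ} (ht : 0 ≤ t) (x : ℝ) :
    HasDerivAt (fun x => θ x t) (dx θ 1 x t) x := by
  simpa [dx] using h.hasDerivAt_dx ht 0 x

lemma continuous_dx (h : IsSolution β κ θ a) {t : ℝ} (ht : 0 ≤ t) (j : ℕ) :
    Continuous fun x => dx θ j x t :=
  continuous_iff_continuousAt.2 fun x => (h.hasDerivAt_dx ht j x).continuousAt

lemma continuous_space (h : IsSolution β κ θ a) {t : ℝ} (ht : 0 ≤ t) :
    Continuous fun x => θ x t := (h.contDiff_slice ht).continuous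

lemma continuousOn_time (h : IsSolution β κ θ a) (x T : ℝ) :
    ContinuousOn (θ x) (Icc 0 T) := fun t ht =>
  ((h.eqn x t ht.1).continuousWithinAt).mono Icc_subset_Ici_self

lemma hasDerivAt_time (h : IsSolution β κ θ a) (x : ℝ) {t : ℝ} (ht : 0 < t) :
    HasDerivAt (θ x) (a x t * dx θ 1 x t - κ * fracDiss β (fun x' => θ x' t) x) t :=
  (h.eqn x t ht.le).hasDerivAt (Ici_mem_nhds ht)

lemma exists_bound (h : IsSolution β κ θ a) {T : ℝ} (hT : 0 < T) :
    ∃ M, 0 ≤ M ∧ (∀ t ∈ Icc 0 T, ∀ x, |θ x t| ≤ M) ∧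
      ∀ j ≤ 3, ∀ t ∈ Icc 0 T, ∀ x, |dx θ j x t| ≤ M := by
  choose M hM using h.bdd T hT
  have hb : ∀ j ≤ 3, ∀ t ∈ Icc 0 T, ∀ x, |dx θ j x t| ≤ ∑ i ∈ Finset.range 4, |M i| := by
    intro j hj t ht x
    refine (hM j x t ht).trans ((le_abs_self _).trans ?_)
    exact Finset.single_le_sum (f := fun i => |M i|) (fun i _ => abs_nonneg _)
      (Finset.mem_range.2 (by omega))
  refine ⟨∑ i ∈ Finset.range 4, |M i|, Finset.sum_nonneg fun i _ => abs_nonneg _, ?_, hb⟩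
  intro t ht x
  simpa [dx] using hb 0 (by norm_num) t ht x

lemma hasDerivAt_a (h : IsSolution β κ θ a) {t : ℝ} (ht : 0 ≤ t) (x : ℝ) :
    HasDerivAt (fun x => a x t) (deriv (fun x => a x t) x) x := by
  obtain ⟨M, hM0, hM, hMj⟩ := h.exists_bound (T := t + 1) (by linarith)
  have htI : t ∈ Icc 0 (t + 1) := ⟨ht, by linarith⟩
  exact (exists_hasDerivAt_hilbert (h.hasDerivAt_space ht) (h.hasDerivAt_dx ht 1) (hM t htI)
    (hMj 1 (by norm_num) t htI) (hMj 2 (by norm_num) t htI) (h.hilbert t ht) x).1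

lemma exists_bound_a (h : IsSolution β κ θ a) (h0 : 0 < β) {T A : ℝ} (hT : 0 < T)
    (hA : ∀ t ∈ Icc 0 T, |a 0 t| ≤ A) :
    ∃ B, 0 ≤ B ∧ (∀ t ∈ Icc 0 T, ∀ x, |θ x t| ≤ B) ∧
      (∀ j ≤ 3, ∀ t ∈ Icc 0 T, ∀ x, |dx θ j x t| ≤ B) ∧
      (∀ t ∈ Icc 0 T, ∀ x, |a x t| ≤ B * (1 + |x|) ^ β) ∧
      (∀ t ∈ Icc 0 T, ∀ x, |deriv (fun x => a x t) x| ≤ B) := by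
  obtain ⟨M, hM0, hM, hMj⟩ := h.exists_bound hT
  have hA0 : 0 ≤ A := (abs_nonneg _).trans (hA 0 ⟨le_rfl, hT.le⟩)
  have hq : 0 ≤ 4 * M / β := by positivity
  refine ⟨A + 8 * M + 4 * M / β, by positivity, fun t ht x => (hM t ht x).trans (by linarith),
    fun j hj t ht x => (hMj j hj t ht x).trans (by linarith), fun t ht x => ?_, fun t ht x => ?_⟩
  · have h1 := abs_hilbert_sub_le_log (h.hasDerivAt_space ht.1) (h.hasDerivAt_dx ht.1 1)
      (hM t ht) (hMj 1 (by norm_num) t ht) (hMj 2 (by norm_num) t ht) (h.hilbert t ht.1) x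
    have hx : 1 ≤ 1 + |x| := by linarith [abs_nonneg x]
    have h2 := Real.log_le_rpow_div (by linarith : 0 ≤ 1 + |x|) h0
    have h3 : 1 ≤ (1 + |x|) ^ β := Real.one_le_rpow hx h0.le
    have h4 := abs_sub_abs_le_abs_sub (a x t) (a 0 t)
    have h5 : 4 * M * Real.log (1 + |x|) ≤ 4 * M / β * (1 + |x|) ^ β := by
      calc 4 * M * Real.log (1 + |x|) ≤ 4 * M * ((1 + |x|) ^ β / β) := by gcongr
        _ = _ := by ring
    have h6 : A + 8 * M ≤ (A + 8 * M) * (1 + |x|) ^ β :=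
      le_mul_of_one_le_right (by positivity) h3
    have := hA t ht
    rw [add_mul]; linarith
  · have := (exists_hasDerivAt_hilbert (h.hasDerivAt_space ht.1) (h.hasDerivAt_dx ht.1 1) (hM t ht)
      (hMj 1 (by norm_num) t ht) (hMj 2 (by norm_num) t ht) (h.hilbert t ht.1) x).2
    linarith

lemma exists_hasDerivAt_mixed {F : ℝ × ℝ → ℝ} {x t : ℝ} (hF : ContDiffAt ℝ 2 F (x, t)) :
    ∃ m, HasDerivAt (fun s => fderiv ℝ F (x, s) (1, 0)) m t ∧
      HasDerivAt (fun y => fderiv ℝ F (y, t) (0, 1)) m x := by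
  have hdd : HasFDerivAt (fderiv ℝ F) (fderiv ℝ (fderiv ℝ F) (x, t)) (x, t) :=
    ((hF.fderiv_right (m := 1) (by norm_num)).differentiableAt (by simp)).hasFDerivAt
  have hsymm : fderiv ℝ (fderiv ℝ F) (x, t) (0, 1) (1, 0)
      = fderiv ℝ (fderiv ℝ F) (x, t) (1, 0) (0, 1) :=
    (hF.isSymmSndFDerivAt (by simp)) _ _
  have happ : ∀ w : ℝ × ℝ, HasFDerivAt (fun p => fderiv ℝ F p w)
      ((fderiv ℝ (fderiv ℝ F) (x, t)).flip w) (x, t) := fun w => by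
    have := hdd.clm_apply (hasFDerivAt_const w (x, t))
    simpa using this
  refine ⟨fderiv ℝ (fderiv ℝ F) (x, t) (0, 1) (1, 0), ?_, ?_⟩
  · have hY : HasDerivAt (fun s : ℝ => (x, s)) ((0 : ℝ), (1 : ℝ)) t :=
      (hasDerivAt_const t x).prodMk (hasDerivAt_id t)
    exact (happ (1, 0)).comp_hasDerivAt t hY
  · have hX : HasDerivAt (fun y : ℝ => (y, t)) ((1 : ℝ), (0 : ℝ)) x :=
      (hasDerivAt_id x).prodMk (hasDerivAt_const x t)
    rw [hsymm]
    exact (happ (0, 1)).comp_hasDerivAt x hX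

/-- The equation satisfied by the spatial derivative. -/
lemma hasDerivAt_time_dx (h : IsSolution β κ θ a) (h0 : 0 < β) (h1 : β < 1 / 2) (x : ℝ) {t : ℝ}
    (ht : 0 < t) :
    HasDerivAt (dx θ 1 x) (a x t * dx θ 2 x t + deriv (fun x => a x t) x * dx θ 1 x t
      - κ * fracDiss β (fun x => dx θ 1 x t) x) t := by
  set F : ℝ × ℝ → ℝ := fun p => θ p.1 p.2 with hF
  have hopen : IsOpen ((univ : Set ℝ) ×ˢ Ioi (0 : ℝ)) := isOpen_univ.prod isOpen_Ioi
  have hFs : ∀ p ∈ (univ : Set ℝ) ×ˢ Ioi (0 : ℝ), ContDiffAt ℝ (⊤ : ℕ∞) F p := fun p hp =>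
    ((h.smooth.mono (prod_mono le_rfl Ioi_subset_Ici_self)).contDiffAt (hopen.mem_nhds hp))
  have hd : ∀ p ∈ (univ : Set ℝ) ×ˢ Ioi (0 : ℝ), HasFDerivAt F (fderiv ℝ F p) p := fun p hp =>
    ((hFs p hp).differentiableAt (by simp)).hasFDerivAt
  have hX : ∀ y s, HasDerivAt (fun y : ℝ => (y, s)) ((1 : ℝ), (0 : ℝ)) y := fun y s =>
    (hasDerivAt_id y).prodMk (hasDerivAt_const y s)
  have hY : ∀ y s, HasDerivAt (fun s : ℝ => (y, s)) ((0 : ℝ), (1 : ℝ)) s := fun y s =>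
    (hasDerivAt_const s y).prodMk (hasDerivAt_id s)
  have hx : ∀ y, ∀ s > 0, dx θ 1 y s = fderiv ℝ F (y, s) (1, 0) := by
    intro y s hs
    have := (hd (y, s) ⟨mem_univ _, hs⟩).comp_hasDerivAt y (hX y s)
    exact (h.hasDerivAt_space (le_of_lt hs) y).unique this
  have hy : ∀ y, ∀ s > 0, a y s * dx θ 1 y s - κ * fracDiss β (fun x' => θ x' s) y
      = fderiv ℝ F (y, s) (0, 1) := by
    intro y s hs
    have := (hd (y, s) ⟨mem_univ _, hs⟩).comp_hasDerivAt s (hY y s)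
    exact (h.hasDerivAt_time y hs).unique this
  have hp : (x, t) ∈ (univ : Set ℝ) ×ˢ Ioi (0 : ℝ) := ⟨mem_univ _, ht⟩
  obtain ⟨m, e1, e2⟩ := exists_hasDerivAt_mixed ((hFs _ hp).of_le
    (WithTop.coe_le_coe.2 (le_top : (2 : ℕ∞) ≤ ⊤)))
  obtain ⟨M, hM0, hM, hMj⟩ := h.exists_bound (T := t + 1) (by linarith)
  have htI : t ∈ Icc 0 (t + 1) := ⟨ht.le, by linarith⟩
  have e3 : HasDerivAt (fun y => a y t * dx θ 1 y t - κ * fracDiss β (fun x' => θ x' t) y)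
      (a x t * dx θ 2 x t + deriv (fun x => a x t) x * dx θ 1 x t
      - κ * fracDiss β (fun x => dx θ 1 x t) x) x := by
    have := ((h.hasDerivAt_a ht.le x).mul (h.hasDerivAt_dx ht.le 1 x)).sub
      ((hasDerivAt_fracDiss h0 h1 (h.hasDerivAt_space ht.le) (h.hasDerivAt_dx ht.le 1) (hM t htI)
        (hMj 1 (by norm_num) t htI) (hMj 2 (by norm_num) t htI) x).const_mul κ)
    exact this.congr_deriv (by ring)
  have e4 : (fun y => a y t * dx θ 1 y t - κ * fracDiss β (fun x' => θ x' t) y)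
      = fun y => fderiv ℝ F (y, t) (0, 1) := funext fun y => hy y t ht
  rw [e4] at e3
  rw [e3.unique e2]
  refine e1.congr_of_eventuallyEq ?_
  filter_upwards [Ioi_mem_nhds ht] with s hs using hx x s hs

lemma fracDiss_const_mul_sub (β σ m : ℝ) (f : ℝ → ℝ) (x : ℝ) :
    fracDiss β (fun x => σ * f x - m) x = σ * fracDiss β f x := by
  unfold fracDiss
  rw [← integral_const_mul]
  congr 1; ext y; ring

/-- Maximum principle. -/
lemma abs_le_of_initial (h : IsSolution β κ θ a) (h0 : 0 < β) (h1 : β < 1 / 2) (hκ : 0 ≤ κ)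
    {T A m : ℝ} (hT : 0 < T) (hA : ∀ t ∈ Icc 0 T, |a 0 t| ≤ A) (hm : ∀ x, |θ x 0| ≤ m) :
    ∀ t ∈ Icc 0 T, ∀ x, |θ x t| ≤ m := by
  obtain ⟨B, hB0, hB, hBj, haB, haB'⟩ := h.exists_bound_a h0 hT hA
  have hm0 : 0 ≤ m := (abs_nonneg _).trans (hm 0)
  suffices key : ∀ σ : ℝ, |σ| = 1 → ∀ t ∈ Icc 0 T, ∀ x, σ * θ x t ≤ m by
    intro t ht x
    have e1 := key 1 (by simp) t ht x
    have e2 := key (-1) (by simp) t ht x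
    rw [abs_le]; constructor <;> linarith
  intro σ hσ t ht x
  have hd : ∀ t ∈ Icc 0 T, ∀ x, HasDerivAt (fun x => σ * θ x t - m) (σ * dx θ 1 x t) x :=
    fun t ht x => ((h.hasDerivAt_space ht.1 x).const_mul σ).sub_const m
  obtain ⟨hcE, hdE⟩ := isEnergyFn_posPart_sq.energy_estimate (M := B + m) (ε := 1) h0 h1 hκ
    one_pos le_rfl (T := T)
    (v := fun x t => σ * θ x t - m) (v' := fun x t => σ * dx θ 1 x t)
    (v'' := fun x t => σ * dx θ 2 x t) (a := a) (b := fun _ _ => 0) (r := fun _ _ => 0) (B := B)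
    hd (fun t ht x => (h.hasDerivAt_dx ht.1 1 x).const_mul σ)
    (fun t ht x => by
      refine (abs_sub _ _).trans ?_
      rw [abs_mul, hσ, one_mul, abs_of_nonneg hm0]; linarith [hB t ht x])
    (fun t ht x => by rw [abs_mul, hσ, one_mul]; linarith [hBj 1 (by norm_num) t ht x])
    (fun t ht x => by rw [abs_mul, hσ, one_mul]; linarith [hBj 2 (by norm_num) t ht x])
    (fun x => ((h.continuousOn_time x T).const_smul σ).sub continuousOn_const)
    (fun t ht x => h.hasDerivAt_a ht.1 x) haB haB' (fun _ _ => measurable_const)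
    (fun _ _ _ => by simpa using hB0) (fun _ _ => measurable_const)
    (fun _ _ x => by rw [abs_zero]; positivity)
    (fun t ht x => by
      refine (((h.hasDerivAt_time x ht.1).const_mul σ).sub_const m).congr_deriv ?_
      rw [fracDiss_const_mul_sub]; ring)
  have hE := le_exp_mul_of_deriv_le (K := 6 * B + κ * weightConst β) hcE (fun t ht => by
    obtain ⟨D, hD, hle⟩ := hdE t ht
    exact ⟨D, hD, by simpa using hle⟩) t ht
  have hE0 : ∀ x, max (σ * θ x 0 - m) 0 = 0 := fun x => max_eq_right (by
    have := (le_abs_self (σ * θ x 0)).trans_eq (abs_mul _ _)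
    rw [hσ, one_mul] at this
    linarith [hm x])
  simp only [hE0, ne_eq, OfNat.ofNat_ne_zero, not_false_eq_true, zero_pow, zero_mul,
    integral_zero, mul_zero] at hE
  by_contra hx
  push Not at hx
  have hcont : Continuous fun x => max (σ * θ x t - m) 0 ^ 2 * polyWeight (1 + 2 * β) 1 x :=
    (((((h.continuous_space ht.1).const_smul σ).sub continuous_const).max continuous_const).pow 2).mul
      (continuous_polyWeight _ _)
  have hnn : ∀ x, 0 ≤ max (σ * θ x t - m) 0 ^ 2 * polyWeight (1 + 2 * β) 1 x := fun x =>
    mul_nonneg (sq_nonneg _) (polyWeight_pos _ _ _).le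
  have hint : Integrable fun x => max (σ * θ x t - m) 0 ^ 2 * polyWeight (1 + 2 * β) 1 x := by
    refine ((integrable_polyWeight (s := 1 + 2 * β) one_pos le_rfl (by linarith)).const_mul
      ((B + m) ^ 2)).mono' hcont.aestronglyMeasurable (Eventually.of_forall fun x => ?_)
    rw [Real.norm_eq_abs, abs_of_nonneg (hnn x)]
    have hp := polyWeight_pos (1 + 2 * β) 1 x
    have h2 : |max (σ * θ x t - m) 0| ≤ B + m := by
      rw [abs_of_nonneg (le_max_right _ _)]
      refine max_le ?_ (by linarith)
      have := (le_abs_self (σ * θ x t)).trans_eq (abs_mul _ _)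
      rw [hσ, one_mul] at this
      linarith [hB t ht x]
    have h3 := sq_le_sq' (by linarith [(abs_le.1 h2).1]) (abs_le.1 h2).2
    exact mul_le_mul_of_nonneg_right h3 hp.le
  have hzero := (integral_eq_zero_iff_of_nonneg hnn hint).1
    (le_antisymm hE (integral_nonneg hnn))
  have hz := (Continuous.ae_eq_iff_eq volume hcont continuous_const).1 hzero
  have := congrFun hz x
  have hp := polyWeight_pos (1 + 2 * β) 1 x
  rw [max_eq_left (by linarith)] at this
  have h4 : 0 < (σ * θ x t - m) ^ 2 := by
    have : 0 < σ * θ x t - m := by linarith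
    positivity
  exact (mul_pos h4 hp).ne' this

end IsSolution

/-- Propagation of square integrability. -/
lemma integrable_sq_of_initial {β κ B M T : ℝ} (h0 : 0 < β) (h1 : β < 1 / 2) (hκ : 0 ≤ κ)
    {v v' v'' a b : ℝ → ℝ → ℝ}
    (hv : ∀ t ∈ Icc 0 T, ∀ x, HasDerivAt (fun x => v x t) (v' x t) x)
    (hv' : ∀ t ∈ Icc 0 T, ∀ x, HasDerivAt (fun x => v' x t) (v'' x t) x)
    (hvM : ∀ t ∈ Icc 0 T, ∀ x, |v x t| ≤ M) (hvM' : ∀ t ∈ Icc 0 T, ∀ x, |v' x t| ≤ M)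
    (hvM'' : ∀ t ∈ Icc 0 T, ∀ x, |v'' x t| ≤ M)
    (hvt : ∀ x, ContinuousOn (v x) (Icc 0 T))
    (ha : ∀ t ∈ Icc 0 T, ∀ x, HasDerivAt (fun x => a x t) (deriv (fun x => a x t) x) x)
    (haB : ∀ t ∈ Icc 0 T, ∀ x, |a x t| ≤ B * (1 + |x|) ^ β)
    (haB' : ∀ t ∈ Icc 0 T, ∀ x, |deriv (fun x => a x t) x| ≤ B)
    (hb : ∀ t ∈ Icc 0 T, Measurable fun x => b x t) (hbB : ∀ t ∈ Icc 0 T, ∀ x, |b x t| ≤ B)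
    (heq : ∀ t ∈ Ioo 0 T, ∀ x, HasDerivAt (v x)
      (a x t * v' x t + b x t * v x t - κ * fracDiss β (fun x => v x t) x) t)
    (hi : Integrable fun x => v x 0 ^ 2) :
    ∃ C, ∀ t ∈ Icc 0 T, Integrable (fun x => v x t ^ 2) ∧ ∫ x, v x t ^ 2 ≤ C := by
  set K := 6 * B + κ * weightConst β with hK
  refine ⟨Real.exp (|K| * T) * ∫ x, v x 0 ^ 2, fun t ht => ?_⟩
  have hM0 : 0 ≤ M := (abs_nonneg _).trans (hvM t ht 0)
  have hB0 : 0 ≤ B := (abs_nonneg _).trans (haB' t ht 0)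
  have hvc : Continuous fun x => v x t :=
    continuous_iff_continuousAt.2 fun x => (hv t ht x).continuousAt
  refine integrable_of_weighted_bound (s := 1 + 2 * β) (M := M ^ 2) (by linarith) (hvc.pow 2)
    (fun x => sq_nonneg _) (fun x => by
      have := abs_le.1 (hvM t ht x); nlinarith) fun ε hε hε1 => ?_
  obtain ⟨hcE, hdE⟩ := isEnergyFn_sq.energy_estimate (r := fun _ _ => 0) h0 h1 hκ hε hε1 hv hv'
    hvM hvM' hvM'' hvt ha haB haB' hb hbB (fun _ _ => measurable_const)
    (fun _ _ x => by rw [abs_zero]; positivity) (by simpa using heq)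
  have hE := le_exp_mul_of_deriv_le (K := K) hcE (fun t ht => by
    obtain ⟨D, hD, hle⟩ := hdE t ht
    exact ⟨D, hD, by simpa using hle⟩) t ht
  refine hE.trans ?_
  have hle : ∫ x, v x 0 ^ 2 * polyWeight (1 + 2 * β) ε x ≤ ∫ x, v x 0 ^ 2 := by
    refine integral_mono_of_nonneg (Eventually.of_forall fun x =>
      mul_nonneg (sq_nonneg _) (polyWeight_pos _ _ _).le) hi (Eventually.of_forall fun x => ?_)
    exact mul_le_of_le_one_right (sq_nonneg _) (polyWeight_le_one (by linarith) _ _)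
  refine mul_le_mul (Real.exp_le_exp.2 ?_) hle
    (integral_nonneg fun x => mul_nonneg (sq_nonneg _) (polyWeight_pos _ _ _).le)
    (Real.exp_pos _).le
  exact mul_le_mul (le_abs_self K) ht.2 ht.1 (abs_nonneg _)

namespace IsSolution

variable {β κ : ℝ} {θ a : ℝ → ℝ → ℝ}

lemma continuousOn_time_dx (h : IsSolution β κ θ a) (x T : ℝ) :
    ContinuousOn (dx θ 1 x) (Icc 0 T) := by
  have hu : UniqueDiffOn ℝ ((univ : Set ℝ) ×ˢ Ici (0 : ℝ)) :=
    uniqueDiffOn_univ.prod (uniqueDiffOn_Ici 0)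
  have hc := h.smooth.continuousOn_fderivWithin hu (by simp)
  have hmap : ContinuousOn (fun t : ℝ => (x, t)) (Icc 0 T) := by fun_prop
  have h2 := (hc.comp hmap fun t ht => ⟨mem_univ _, ht.1⟩).clm_apply
    (continuousOn_const (c := ((1 : ℝ), (0 : ℝ))))
  refine h2.congr fun t ht => ?_
  have hp : (x, t) ∈ (univ : Set ℝ) ×ˢ Ici (0 : ℝ) := ⟨mem_univ _, ht.1⟩
  have hd := (h.smooth.differentiableOn (by simp) (x, t) hp).hasFDerivWithinAt
  have hX : HasDerivWithinAt (fun y : ℝ => (y, t)) ((1 : ℝ), (0 : ℝ)) univ x :=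
    ((hasDerivAt_id x).prodMk (hasDerivAt_const x t)).hasDerivWithinAt
  have hmaps : MapsTo (fun y : ℝ => (y, t)) univ ((univ : Set ℝ) ×ˢ Ici (0 : ℝ)) :=
    fun y _ => ⟨mem_univ _, ht.1⟩
  have := hd.comp_hasDerivWithinAt x hX hmaps
  exact (h.hasDerivAt_space ht.1 x).unique (hasDerivWithinAt_univ.1 this)

lemma exists_bound_sq (h : IsSolution β κ θ a) (h0 : 0 < β) (h1 : β < 1 / 2) (hκ : 0 ≤ κ)
    {T A : ℝ} (hT : 0 < T) (hA : ∀ t ∈ Icc 0 T, |a 0 t| ≤ A)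
    (hi : Integrable fun x => θ x 0 ^ 2) (hi' : Integrable fun x => dx θ 1 x 0 ^ 2) :
    ∃ C, ∀ t ∈ Icc 0 T, (Integrable (fun x => θ x t ^ 2) ∧ ∫ x, θ x t ^ 2 ≤ C) ∧
      (Integrable (fun x => dx θ 1 x t ^ 2) ∧ ∫ x, dx θ 1 x t ^ 2 ≤ C) := by
  obtain ⟨B, hB0, hB, hBj, haB, haB'⟩ := h.exists_bound_a h0 hT hA
  obtain ⟨C₁, hC₁⟩ := integrable_sq_of_initial (b := fun _ _ => 0) h0 h1 hκ
    (fun t ht => h.hasDerivAt_space ht.1) (fun t ht => h.hasDerivAt_dx ht.1 1) hB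
    (hBj 1 (by norm_num)) (hBj 2 (by norm_num)) (fun x => h.continuousOn_time x T)
    (fun t ht x => h.hasDerivAt_a ht.1 x) haB haB' (fun _ _ => measurable_const)
    (fun _ _ _ => by simpa using hB0)
    (fun t ht x => (h.hasDerivAt_time x ht.1).congr_deriv (by ring)) hi
  obtain ⟨C₂, hC₂⟩ := integrable_sq_of_initial (b := fun x t => deriv (fun x => a x t) x) h0 h1 hκ
    (fun t ht => h.hasDerivAt_dx ht.1 1) (fun t ht => h.hasDerivAt_dx ht.1 2)
    (hBj 1 (by norm_num)) (hBj 2 (by norm_num)) (hBj 3 (by norm_num))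
    (fun x => h.continuousOn_time_dx x T)
    (fun t ht x => h.hasDerivAt_a ht.1 x) haB haB' (fun _ _ => measurable_deriv _)
    haB' (fun t ht x => h.hasDerivAt_time_dx h0 h1 x ht.1) hi'
  exact ⟨max C₁ C₂, fun t ht => ⟨⟨(hC₁ t ht).1, (hC₁ t ht).2.trans (le_max_left _ _)⟩,
    ⟨(hC₂ t ht).1, (hC₂ t ht).2.trans (le_max_right _ _)⟩⟩⟩

end IsSolution

/-! ### Evenness is preserved -/

lemma abs_integral_symmQuot_far_le {f : ℝ → ℝ} {S R : ℝ}
    (hi : Integrable fun x => f x ^ 2) (hS : ∫ x, f x ^ 2 ≤ S) (hS0 : 0 < S) (hR : 1 ≤ R) (x : ℝ) :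
    |∫ y in (1 : ℝ)..R, symmQuot f x y| ≤ 2 * √S := by
  set q := √S with hq
  have hq0 : 0 < q := Real.sqrt_pos.2 hS0
  have hqS : q ^ 2 = S := Real.sq_sqrt hS0.le
  have i1 : Integrable fun y => f (x - y) ^ 2 := hi.comp_sub_left x
  have i2 : Integrable fun y => f (x + y) ^ 2 := hi.comp_add_left x
  have i3 : IntegrableOn (fun y : ℝ => y ^ (-2 : ℝ)) (Ioi 1) :=
    integrableOn_Ioi_rpow_of_lt (by norm_num) one_pos
  have i3' := i3.mono_set (Ioc_subset_Ioi_self : Ioc (1 : ℝ) R ⊆ Ioi 1)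
  have e1 : ∫ y in Ioc 1 R, f (x - y) ^ 2 ≤ S :=
    (setIntegral_le_integral i1 (Eventually.of_forall fun y => sq_nonneg _)).trans
      ((integral_sub_left_eq_self (fun y => f y ^ 2) volume x).trans_le hS)
  have e2 : ∫ y in Ioc 1 R, f (x + y) ^ 2 ≤ S :=
    (setIntegral_le_integral i2 (Eventually.of_forall fun y => sq_nonneg _)).trans
      ((integral_add_left_eq_self (fun y => f y ^ 2) x).trans_le hS)
  have e3 : ∫ y in Ioc (1 : ℝ) R, y ^ (-2 : ℝ) ≤ 1 := by
    refine (setIntegral_mono_set i3 ?_ (Ioc_subset_Ioi_self.eventuallyLE)).trans ?_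
    · filter_upwards [ae_restrict_mem measurableSet_Ioi] with y hy
      exact Real.rpow_nonneg (zero_le_one.trans (le_of_lt hy)) _
    · rw [integral_Ioi_rpow_of_lt (by norm_num) one_pos]; norm_num
  rw [intervalIntegral.integral_of_le hR, ← Real.norm_eq_abs]
  have ib : Integrable (fun y => (2 * q)⁻¹ * f (x - y) ^ 2 + (2 * q)⁻¹ * f (x + y) ^ 2
      + q * y ^ (-2 : ℝ)) (volume.restrict (Ioc 1 R)) :=
    ((i1.integrableOn.const_mul _).add (i2.integrableOn.const_mul _)).add (i3'.const_mul q)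
  refine (norm_integral_le_of_norm_le ib ?_).trans ?_
  · filter_upwards [ae_restrict_mem measurableSet_Ioc] with y hy
    have hy0 : 0 < y := zero_lt_one.trans hy.1
    rw [Real.rpow_neg hy0.le, Real.norm_eq_abs]
    norm_num only [Real.rpow_ofNat]
    unfold symmQuot
    have key : ∀ u : ℝ, |u| / y ≤ (2 * q)⁻¹ * u ^ 2 + q / 2 * (y ^ 2)⁻¹ := by
      intro u
      have : (2 * q)⁻¹ * u ^ 2 + q / 2 * (y ^ 2)⁻¹ - |u| / y = (2 * q)⁻¹ * (|u| - q / y) ^ 2 := by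
        rw [← sq_abs u]; field_simp; ring
      have h2 : 0 ≤ (2 * q)⁻¹ * (|u| - q / y) ^ 2 := by positivity
      linarith
    rw [abs_div, abs_of_pos hy0]
    calc |f (x - y) - f (x + y)| / y ≤ (|f (x - y)| + |f (x + y)|) / y := by
          gcongr; exact abs_sub _ _
      _ = |f (x - y)| / y + |f (x + y)| / y := by ring
      _ ≤ _ := by linarith [key (f (x - y)), key (f (x + y))]
  · have i12 : Integrable (fun y => (2 * q)⁻¹ * f (x - y) ^ 2 + (2 * q)⁻¹ * f (x + y) ^ 2)
        (volume.restrict (Ioc 1 R)) :=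
      (i1.integrableOn.const_mul _).add (i2.integrableOn.const_mul _)
    rw [integral_add i12 (i3'.const_mul q), integral_add (i1.integrableOn.const_mul _) (i2.integrableOn.const_mul _),
      integral_const_mul, integral_const_mul, integral_const_mul]
    calc _ ≤ (2 * q)⁻¹ * S + (2 * q)⁻¹ * S + q * 1 := by gcongr
      _ = 2 * q := by rw [← hqS]; field_simp; ring

lemma abs_hilbert_le_of_sq {f f' h : ℝ → ℝ} {M S : ℝ} (hf : ∀ x, HasDerivAt f (f' x) x)
    (hb : ∀ x, |f' x| ≤ M) (hi : Integrable fun x => f x ^ 2) (hS : ∫ x, f x ^ 2 ≤ S) (hS0 : 0 < S)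
    (hh : ∀ x, Tendsto (fun R => ∫ y in (0 : ℝ)..R, symmQuot f x y) atTop (𝓝 (h x))) (x : ℝ) :
    |h x - ∫ y in (0 : ℝ)..1, symmQuot f x y| ≤ 2 * √S ∧ |h x| ≤ 2 * M + 2 * √S := by
  have h1 : |h x - ∫ y in (0 : ℝ)..1, symmQuot f x y| ≤ 2 * √S := by
    have ht := ((hh x).sub_const (∫ y in (0 : ℝ)..1, symmQuot f x y)).abs
    refine le_of_tendsto ht ?_
    filter_upwards [eventually_ge_atTop 1] with R hR
    rw [intervalIntegral.integral_interval_sub_left (intervalIntegrable_symmQuot hf hb _ _ _)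
      (intervalIntegrable_symmQuot hf hb _ _ _)]
    exact abs_integral_symmQuot_far_le hi hS hS0 hR x
  refine ⟨h1, ?_⟩
  have h2 : |∫ y in (0 : ℝ)..1, symmQuot f x y| ≤ 2 * M := by
    have := intervalIntegral.norm_integral_le_of_norm_le_const (a := 0) (b := 1) (C := 2 * M)
      (f := symmQuot f x) fun y _ => abs_symmQuot_le hf hb x y
    simpa using this
  have h3 := abs_sub_abs_le_abs_sub (h x) (∫ y in (0 : ℝ)..1, symmQuot f x y)
  linarith

lemma abs_integral_mul_mul_le {f g : ℝ → ℝ} {S N : ℝ} (hf : Continuous f) (hg : Continuous g)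
    (hi : Integrable fun x => f x ^ 2) (hj : Integrable fun x => g x ^ 2) (hS : ∫ x, f x ^ 2 ≤ S)
    (hN : ∫ x, g x ^ 2 ≤ N) (hS0 : 0 < S) :
    Integrable (fun x => f x * g x) ∧ ∫ x, |f x * g x| ≤ √S * ((1 + N) / 2) := by
  set q := √S with hq
  have hq0 : 0 < q := Real.sqrt_pos.2 hS0
  have hqS : q ^ 2 = S := Real.sq_sqrt hS0.le
  have hle : ∀ x, |f x * g x| ≤ (2 * q)⁻¹ * f x ^ 2 + q / 2 * g x ^ 2 := by
    intro x
    have : (2 * q)⁻¹ * f x ^ 2 + q / 2 * g x ^ 2 - |f x * g x|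
        = (2 * q)⁻¹ * (|f x| - q * |g x|) ^ 2 := by
      rw [abs_mul, ← sq_abs (f x), ← sq_abs (g x)]; field_simp; ring
    have h2 : 0 ≤ (2 * q)⁻¹ * (|f x| - q * |g x|) ^ 2 := by positivity
    linarith
  have ib : Integrable fun x => (2 * q)⁻¹ * f x ^ 2 + q / 2 * g x ^ 2 :=
    (hi.const_mul _).add (hj.const_mul _)
  have ii : Integrable fun x => f x * g x :=
    ib.mono' (hf.mul hg).aestronglyMeasurable (Eventually.of_forall hle)
  refine ⟨ii, (integral_mono ii.abs ib hle).trans ?_⟩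
  rw [integral_add (hi.const_mul _) (hj.const_mul _), integral_const_mul, integral_const_mul]
  calc _ ≤ (2 * q)⁻¹ * S + q / 2 * N := by gcongr
    _ = _ := by rw [← hqS]; field_simp

/-- The commutator bound for the quadratic form `∫ w (Hw) m`. -/
lemma abs_integral_mul_hilbert_mul_le {w w' m h : ℝ → ℝ} {M L N S : ℝ}
    (hw : ∀ x, HasDerivAt w (w' x) x) (hM : ∀ x, |w x| ≤ M) (hb : ∀ x, |w' x| ≤ M)
    (hi : Integrable fun x => w x ^ 2) (hS : ∫ x, w x ^ 2 ≤ S) (hS0 : 0 < S)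
    (hm : Continuous m) (hmL : ∀ x y, |m x - m y| ≤ L * |x - y|)
    (hmi : Integrable fun x => m x ^ 2) (hN : ∫ x, m x ^ 2 ≤ N) (hhm : Measurable h)
    (hh : ∀ x, Tendsto (fun R => ∫ y in (0 : ℝ)..R, symmQuot w x y) atTop (𝓝 (h x))) :
    |∫ x, w x * h x * m x| ≤ (1 + N + L) * S := by
  have hc : Continuous w := continuous_iff_continuousAt.2 fun x => (hw x).continuousAt
  have hL0 : 0 ≤ L := by
    have := (abs_nonneg _).trans (hmL 1 0); simpa using this
  have hN0 : 0 ≤ N := (integral_nonneg fun x => sq_nonneg _).trans hN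
  obtain ⟨iwm, hwm⟩ := abs_integral_mul_mul_le hc hm hi hmi hS hN hS0
  set near : ℝ → ℝ := fun x => ∫ y in (0 : ℝ)..1, symmQuot w x y with hnear
  set μ : Measure ℝ := volume.restrict (Ioc (0 : ℝ) 1) with hμ
  have hnb : ∀ x, |near x| ≤ 2 * M := fun x => by
    have := intervalIntegral.norm_integral_le_of_norm_le_const (a := 0) (b := 1) (C := 2 * M)
      (f := symmQuot w x) fun y _ => abs_symmQuot_le hw hb x y
    simpa using this
  have hsm : Measurable fun p : ℝ × ℝ => symmQuot w p.1 p.2 := by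
    unfold symmQuot
    have h1 : Continuous fun p : ℝ × ℝ => w (p.1 - p.2) - w (p.1 + p.2) := by fun_prop
    exact h1.measurable.div measurable_snd
  have hnm : StronglyMeasurable near := by
    have : near = fun x => ∫ y, symmQuot w x y ∂μ := by
      ext x; simp only [hnear, hμ, intervalIntegral.integral_of_le zero_le_one]
    rw [this]
    exact hsm.stronglyMeasurable.integral_prod_right
  have inear : Integrable fun x => w x * m x * near x :=
    iwm.mul_bdd (c := 2 * M) hnm.aestronglyMeasurable (Eventually.of_forall hnb)
  have ifar : Integrable fun x => w x * m x * (h x - near x) :=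
    iwm.mul_bdd (c := 2 * √S) (hhm.sub hnm.measurable).aestronglyMeasurable
      (Eventually.of_forall fun x => (abs_hilbert_le_of_sq hw hb hi hS hS0 hh x).1)
  have hsplit : ∫ x, w x * h x * m x
      = (∫ x, w x * m x * near x) + ∫ x, w x * m x * (h x - near x) := by
    rw [← integral_add inear ifar]; congr 1; ext x; ring
  have hfar : |∫ x, w x * m x * (h x - near x)| ≤ (1 + N) * S := by
    rw [← Real.norm_eq_abs]
    refine (norm_integral_le_of_norm_le (iwm.abs.mul_const (2 * √S))
      (Eventually.of_forall fun x => ?_)).trans ?_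
    · rw [Real.norm_eq_abs, abs_mul]
      exact mul_le_mul_of_nonneg_left (abs_hilbert_le_of_sq hw hb hi hS hS0 hh x).1 (abs_nonneg _)
    · rw [integral_mul_const]
      calc _ ≤ √S * ((1 + N) / 2) * (2 * √S) := by gcongr
        _ = (1 + N) * (√S ^ 2) := by ring
        _ = _ := by rw [Real.sq_sqrt hS0.le]
  have hiprod : Integrable (fun p : ℝ × ℝ => w p.1 * m p.1 * symmQuot w p.1 p.2)
      (volume.prod μ) := by
    have hb1 : Integrable (fun p : ℝ × ℝ => (w p.1 * m p.1) * (2 * M)) (volume.prod μ) :=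
      Integrable.mul_prod (f := fun x => w x * m x) (g := fun _ => 2 * M) iwm
        (integrable_const _)
    refine hb1.norm.mono' ?_ (Eventually.of_forall fun p => ?_)
    · exact ((hc.mul hm).measurable.comp measurable_fst |>.mul hsm).aestronglyMeasurable
    · rw [norm_mul, norm_mul (w p.1 * m p.1)]
      refine mul_le_mul_of_nonneg_left ?_ (norm_nonneg _)
      rw [Real.norm_eq_abs, Real.norm_eq_abs]
      exact (abs_symmQuot_le hw hb _ _).trans (le_abs_self _)
  have hnear_eq : ∫ x, w x * m x * near x = ∫ y, (∫ x, w x * m x * symmQuot w x y) ∂μ := by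
    rw [← integral_integral_swap (f := fun x y => w x * m x * symmQuot w x y) hiprod]
    congr 1; ext x
    rw [integral_const_mul, hnear]
    simp only [intervalIntegral.integral_of_le zero_le_one, hμ]
  have hnearb : |∫ x, w x * m x * near x| ≤ L * S := by
    rw [hnear_eq, ← Real.norm_eq_abs]
    have hLS : ∫ _ : ℝ, L * S ∂μ = L * S := by simp [hμ]
    rw [← hLS]
    refine norm_integral_le_of_norm_le (integrable_const (L * S)) ?_
    filter_upwards [ae_restrict_mem measurableSet_Ioc] with y hy
    have hy0 : 0 < y := hy.1
    have hsh : Integrable fun x => w (x + y) ^ 2 := hi.comp_add_right y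
    have hshS : ∫ x, w (x + y) ^ 2 ≤ S :=
      (integral_add_right_eq_self (fun x => w x ^ 2) y).trans_le hS
    have j1 : Integrable fun x => w x * m x * w (x - y) :=
      iwm.mul_bdd (c := M) (by fun_prop) (Eventually.of_forall fun x => hM _)
    have j2 : Integrable fun x => w x * m x * w (x + y) :=
      iwm.mul_bdd (c := M) (by fun_prop) (Eventually.of_forall fun x => hM _)
    have j3 : Integrable fun x => w (x + y) * m (x + y) * w x := by
      simpa using j1.comp_add_right y
    have j4 : ∫ x, w x * m x * w (x - y) = ∫ x, w (x + y) * m (x + y) * w x := by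
      rw [← integral_add_right_eq_self _ y]; simp
    have j5 : ∫ x, w x * m x * symmQuot w x y
        = y⁻¹ * ∫ x, w x * w (x + y) * (m (x + y) - m x) := by
      calc ∫ x, w x * m x * symmQuot w x y
          = ∫ x, y⁻¹ * (w x * m x * w (x - y) - w x * m x * w (x + y)) := by
            congr 1; ext x; unfold symmQuot; ring
        _ = y⁻¹ * ∫ x, w x * w (x + y) * (m (x + y) - m x) := by
            rw [integral_const_mul, integral_sub j1 j2, j4, ← integral_sub j3 j2]
            congr 2; ext x; ring
    rw [j5, norm_mul, norm_inv, Real.norm_eq_abs y, abs_of_pos hy0, inv_mul_le_iff₀ hy0]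
    have ib : Integrable fun x => L * y / 2 * w x ^ 2 + L * y / 2 * w (x + y) ^ 2 :=
      (hi.const_mul _).add (hsh.const_mul _)
    refine (norm_integral_le_of_norm_le ib (Eventually.of_forall fun x => ?_)).trans ?_
    · rw [norm_mul, norm_mul, Real.norm_eq_abs, Real.norm_eq_abs, Real.norm_eq_abs]
      have h1 := hmL (x + y) x
      rw [add_sub_cancel_left, abs_of_pos hy0] at h1
      have h2 : |w x| * |w (x + y)| ≤ (w x ^ 2 + w (x + y) ^ 2) / 2 := by
        rw [← sq_abs (w x), ← sq_abs (w (x + y))]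
        nlinarith [sq_nonneg (|w x| - |w (x + y)|)]
      calc _ ≤ (w x ^ 2 + w (x + y) ^ 2) / 2 * (L * y) := by gcongr
        _ = _ := by ring
    · rw [integral_add (hi.const_mul _) (hsh.const_mul _), integral_const_mul, integral_const_mul]
      calc _ ≤ L * y / 2 * S + L * y / 2 * S := by gcongr
        _ = _ := by ring
  rw [hsplit]
  refine (abs_add_le _ _).trans ?_
  linarith

lemma fracDiss_comp_neg (β : ℝ) (f : ℝ → ℝ) (x : ℝ) :
    fracDiss β (fun x => f (-x)) x = fracDiss β f (-x) := by
  unfold fracDiss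
  rw [← integral_neg_eq_self]
  congr 1; ext y
  rw [abs_neg]; congr 3; ring_nf

lemma fracDiss_sub_comp_neg {β M : ℝ} {f f' : ℝ → ℝ} (h0 : 0 < β) (h1 : β < 1 / 2)
    (hf : ∀ x, HasDerivAt f (f' x) x) (hM : ∀ x, |f x| ≤ M) (hb : ∀ x, |f' x| ≤ M) (x : ℝ) :
    fracDiss β (fun x => f x - f (-x)) x = fracDiss β f x - fracDiss β f (-x) := by
  have hc : Continuous f := continuous_iff_continuousAt.2 fun x => (hf x).continuousAt
  have hf2 : ∀ x, HasDerivAt (fun x => f (-x)) (-f' (-x)) x := fun x => by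
    exact ((hf (-x)).comp x (hasDerivAt_neg x)).congr_deriv (by ring)
  rw [← fracDiss_comp_neg]
  have i1 := integrable_fracDiss_integrand h0 h1 hc (abs_sub_add_le_min hf hM hb) x
  have i2 := integrable_fracDiss_integrand (f := fun x => f (-x)) h0 h1 (hc.comp continuous_neg)
    (abs_sub_add_le_min hf2 (fun x => hM _) (fun x => by rw [abs_neg]; exact hb _)) x
  unfold fracDiss
  rw [← integral_sub i1 i2]
  congr 1; ext y
  ring

namespace IsSolution

variable {β κ : ℝ} {θ a : ℝ → ℝ → ℝ}

/-- One step of the uniqueness iteration: any exponential bound on `‖θ - θ(-·)‖²` can be halved. -/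
lemma exists_halving (h : IsSolution β κ θ a) (h0 : 0 < β) (h1 : β < 1 / 2) (hκ : 0 ≤ κ)
    {T A : ℝ} (hT : 0 < T) (hA : ∀ t ∈ Icc 0 T, |a 0 t| ≤ A)
    (hi : Integrable fun x => θ x 0 ^ 2) (hi' : Integrable fun x => dx θ 1 x 0 ^ 2)
    (heven : ∀ x, θ (-x) 0 = θ x 0) :
    ∃ K, 0 ≤ K ∧ ∀ S > 0, (∀ t ∈ Icc 0 T, Integrable (fun x => (θ x t - θ (-x) t) ^ 2) ∧
        ∫ x, (θ x t - θ (-x) t) ^ 2 ≤ S * Real.exp (K * t)) →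
      ∀ t ∈ Icc 0 T, Integrable (fun x => (θ x t - θ (-x) t) ^ 2) ∧
        ∫ x, (θ x t - θ (-x) t) ^ 2 ≤ S / 2 * Real.exp (K * t) := by
  obtain ⟨B, hB0, hB, hBj, haB, haB'⟩ := h.exists_bound_a h0 hT hA
  obtain ⟨C, hC⟩ := h.exists_bound_sq h0 h1 hκ hT hA hi hi'
  have hC0 : 0 ≤ C := (integral_nonneg fun x => sq_nonneg _).trans (hC 0 ⟨le_rfl, hT.le⟩).1.2
  set w : ℝ → ℝ → ℝ := fun x t => θ x t - θ (-x) t with hw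
  set r : ℝ → ℝ → ℝ := fun x t => -(a x t + a (-x) t) * dx θ 1 (-x) t with hr
  set B₂ := B + 2 * B ^ 2 with hB₂
  have hBB₂ : B ≤ B₂ := by rw [hB₂]; nlinarith
  have hB₂0 : 0 ≤ B₂ := hB0.trans hBB₂
  set K₁ := 6 * B₂ + κ * weightConst β with hK₁
  have hK₁0 : 0 ≤ K₁ := by have := weightConst_nonneg β; positivity
  set C₁ := 1 + 4 * C + 4 * B with hC₁
  have hC₁0 : 0 < C₁ := by positivity
  have hneg : ∀ t ∈ Icc 0 T, ∀ j x, HasDerivAt (fun x => dx θ j (-x) t) (-dx θ (j + 1) (-x) t) x :=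
    fun t ht j x => ((h.hasDerivAt_dx ht.1 j (-x)).comp x (hasDerivAt_neg x)).congr_deriv (by ring)
  have hneg0 : ∀ t ∈ Icc 0 T, ∀ x, HasDerivAt (fun x => θ (-x) t) (-dx θ 1 (-x) t) x :=
    fun t ht x => ((h.hasDerivAt_space ht.1 (-x)).comp x (hasDerivAt_neg x)).congr_deriv (by ring)
  have hw1 : ∀ t ∈ Icc 0 T, ∀ x,
      HasDerivAt (fun x => w x t) (dx θ 1 x t + dx θ 1 (-x) t) x := fun t ht x =>
    ((h.hasDerivAt_space ht.1 x).sub (hneg0 t ht x)).congr_deriv (by ring)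
  have hw2 : ∀ t ∈ Icc 0 T, ∀ x, HasDerivAt (fun x => dx θ 1 x t + dx θ 1 (-x) t)
      (dx θ 2 x t - dx θ 2 (-x) t) x := fun t ht x =>
    ((h.hasDerivAt_dx ht.1 1 x).add (hneg t ht 1 x)).congr_deriv (by ring)
  have hwM : ∀ t ∈ Icc 0 T, ∀ x, |w x t| ≤ 2 * B := fun t ht x =>
    (abs_sub _ _).trans (by linarith [hB t ht x, hB t ht (-x)])
  have hwM1 : ∀ t ∈ Icc 0 T, ∀ x, |dx θ 1 x t + dx θ 1 (-x) t| ≤ 2 * B := fun t ht x =>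
    (abs_add_le _ _).trans
      (by linarith [hBj 1 (by norm_num) t ht x, hBj 1 (by norm_num) t ht (-x)])
  have hwM2 : ∀ t ∈ Icc 0 T, ∀ x, |dx θ 2 x t - dx θ 2 (-x) t| ≤ 2 * B := fun t ht x =>
    (abs_sub _ _).trans
      (by linarith [hBj 2 (by norm_num) t ht x, hBj 2 (by norm_num) t ht (-x)])
  have hac : ∀ t ∈ Icc 0 T, Continuous fun x => a x t := fun t ht =>
    continuous_iff_continuousAt.2 fun x => (h.hasDerivAt_a ht.1 x).continuousAt
  have hrm : ∀ t ∈ Icc 0 T, Measurable fun x => r x t := fun t ht =>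
    (((hac t ht).add ((hac t ht).comp continuous_neg)).neg.mul
      ((h.continuous_dx ht.1 1).comp continuous_neg)).measurable
  have hrB : ∀ t ∈ Icc 0 T, ∀ x, |r x t| ≤ B₂ * (1 + |x|) ^ β := fun t ht x => by
    have e1 := haB t ht x
    have e2 := haB t ht (-x)
    rw [abs_neg] at e2
    have e3 := hBj 1 (by norm_num) t ht (-x)
    have hp : 0 ≤ (1 + |x|) ^ β := by positivity
    rw [hr, abs_mul, abs_neg]
    calc |a x t + a (-x) t| * |dx θ 1 (-x) t| ≤ (2 * (B * (1 + |x|) ^ β)) * B := by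
          refine mul_le_mul ((abs_add_le _ _).trans (by linarith)) e3 (abs_nonneg _) (by positivity)
      _ = (2 * B ^ 2) * (1 + |x|) ^ β := by ring
      _ ≤ _ := by gcongr; linarith
  have heq : ∀ t ∈ Ioo 0 T, ∀ x, HasDerivAt (w x) (a x t * (dx θ 1 x t + dx θ 1 (-x) t)
      + 0 * w x t + r x t - κ * fracDiss β (fun x => w x t) x) t := fun t ht x => by
    have htI : t ∈ Icc 0 T := ⟨ht.1.le, ht.2.le⟩
    refine ((h.hasDerivAt_time x ht.1).sub (h.hasDerivAt_time (-x) ht.1)).congr_deriv ?_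
    rw [hw, fracDiss_sub_comp_neg h0 h1 (h.hasDerivAt_space ht.1.le) (hB t htI)
      (hBj 1 (by norm_num) t htI)]
    simp only [hr]; ring
  have hh : ∀ t ∈ Icc 0 T, ∀ x, Tendsto (fun R => ∫ y in (0 : ℝ)..R, symmQuot (fun x => w x t) x y)
      atTop (𝓝 (Real.pi * (a x t + a (-x) t))) := fun t ht x => by
    have e := (h.hilbert t ht.1 x).add (h.hilbert t ht.1 (-x))
    rw [mul_add]
    refine e.congr fun R => ?_
    rw [← intervalIntegral.integral_add
      (intervalIntegrable_symmQuot (h.hasDerivAt_space ht.1) (hBj 1 (by norm_num) t ht) _ _ _)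
      (intervalIntegrable_symmQuot (h.hasDerivAt_space ht.1) (hBj 1 (by norm_num) t ht) _ _ _)]
    congr 1; ext y
    simp only [symmQuot, hw]
    rw [show -(x - y) = -x + y by ring, show -(x + y) = -x - y by ring]; ring
  refine ⟨K₁ + 2 * C₁, by positivity, fun S hS hwS t ht => ?_⟩
  have hwc : ∀ t ∈ Icc 0 T, Continuous fun x => w x t := fun t ht =>
    continuous_iff_continuousAt.2 fun x => (hw1 t ht x).continuousAt
  refine integrable_of_weighted_bound (s := 1 + 2 * β) (M := (2 * B) ^ 2) (by linarith)
    ((hwc t ht).pow 2) (fun x => sq_nonneg _) (fun x => by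
      have := abs_le.1 (hwM t ht x); nlinarith) fun ε hε hε1 => ?_
  obtain ⟨hcE, hdE⟩ := isEnergyFn_sq.energy_estimate (b := fun _ _ => 0) (B := B₂)
    h0 h1 hκ hε hε1 hw1 hw2 hwM hwM1 hwM2
    (fun x => (h.continuousOn_time x T).sub (h.continuousOn_time (-x) T))
    (fun t ht x => h.hasDerivAt_a ht.1 x)
    (fun t ht x => (haB t ht x).trans (by gcongr)) (fun t ht x => (haB' t ht x).trans hBB₂)
    (fun _ _ => measurable_const) (fun _ _ _ => by simpa using hB₂0) hrm hrB heq
  have hsrc : ∀ t ∈ Icc 0 T, ∫ x, 2 * w x t * r x t * polyWeight (1 + 2 * β) ε x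
      ≤ C₁ * (S * Real.exp ((K₁ + 2 * C₁) * t)) := by
    intro t ht
    set m : ℝ → ℝ := fun x => -2 * dx θ 1 (-x) t * polyWeight (1 + 2 * β) ε x with hm
    have hmd : ∀ x, HasDerivAt m (2 * dx θ 2 (-x) t * polyWeight (1 + 2 * β) ε x
        + -2 * dx θ 1 (-x) t * deriv (polyWeight (1 + 2 * β) ε) x) x := fun x =>
      (((hneg t ht 1 x).const_mul (-2)).mul
        (hasDerivAt_polyWeight _ _ _).differentiableAt.hasDerivAt).congr_deriv (by ring)
    have hmc : Continuous m := continuous_iff_continuousAt.2 fun x => (hmd x).continuousAt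
    have hple : ∀ x, polyWeight (1 + 2 * β) ε x ≤ 1 := polyWeight_le_one (by linarith) ε
    have hppos : ∀ x, 0 < polyWeight (1 + 2 * β) ε x := polyWeight_pos _ ε
    have hmd' : ∀ x, |2 * dx θ 2 (-x) t * polyWeight (1 + 2 * β) ε x
        + -2 * dx θ 1 (-x) t * deriv (polyWeight (1 + 2 * β) ε) x| ≤ 4 * B := fun x => by
      have e1 := hBj 2 (by norm_num) t ht (-x)
      have e2 := hBj 1 (by norm_num) t ht (-x)
      have e3 := (deriv_polyWeight_bound (s := 1 + 2 * β) (by linarith) (by linarith)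
        hε hε1 x).2.trans (hple x)
      have e4 := hple x
      refine (abs_add_le _ _).trans ?_
      simp only [abs_mul, abs_neg, abs_two, abs_of_pos (hppos x)]
      have hppx := (hppos x).le
      calc _ ≤ 2 * B * 1 + 2 * B * 1 := by gcongr
        _ = _ := by ring
    have hmi0 : Integrable fun x => 4 * dx θ 1 (-x) t ^ 2 :=
      ((hC t ht).2.1.comp_neg).const_mul 4
    have hmle : ∀ x, m x ^ 2 ≤ 4 * dx θ 1 (-x) t ^ 2 := fun x => by
      have e1 : polyWeight (1 + 2 * β) ε x ^ 2 ≤ 1 := pow_le_one₀ (hppos x).le (hple x)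
      calc m x ^ 2 = (4 * dx θ 1 (-x) t ^ 2) * polyWeight (1 + 2 * β) ε x ^ 2 := by
            simp only [hm]; ring
        _ ≤ _ := mul_le_of_le_one_right (by positivity) e1
    have hmi : Integrable fun x => m x ^ 2 :=
      hmi0.mono' (hmc.pow 2).aestronglyMeasurable (Eventually.of_forall fun x => by
        rw [Real.norm_eq_abs, abs_of_nonneg (sq_nonneg _)]; exact hmle x)
    have hmN : ∫ x, m x ^ 2 ≤ 4 * C := by
      refine (integral_mono hmi hmi0 hmle).trans ?_
      rw [integral_const_mul, integral_neg_eq_self (fun x => dx θ 1 x t ^ 2)]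
      linarith [(hC t ht).2.2]
    have hmeas : Measurable fun x => Real.pi * (a x t + a (-x) t) :=
      (((hac t ht).add ((hac t ht).comp continuous_neg)).measurable).const_mul _
    have hSe : 0 < S * Real.exp ((K₁ + 2 * C₁) * t) := by positivity
    have key := abs_integral_mul_hilbert_mul_le (hw1 t ht) (hwM t ht) (hwM1 t ht) (hwS t ht).1
      (hwS t ht).2 hSe hmc (abs_sub_le_of_hasDerivAt hmd hmd') hmi hmN hmeas (hh t ht)
    have e : ∫ x, w x t * (Real.pi * (a x t + a (-x) t)) * m x
        = Real.pi * ∫ x, 2 * w x t * r x t * polyWeight (1 + 2 * β) ε x := by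
      rw [← integral_const_mul]; congr 1; ext x; simp only [hm, hr]; ring
    rw [e, abs_mul, abs_of_pos Real.pi_pos] at key
    have hpi : 1 ≤ Real.pi := by linarith [Real.pi_gt_three]
    calc _ ≤ |∫ x, 2 * w x t * r x t * polyWeight (1 + 2 * β) ε x| := le_abs_self _
      _ ≤ Real.pi * |∫ x, 2 * w x t * r x t * polyWeight (1 + 2 * β) ε x| :=
          le_mul_of_one_le_left (abs_nonneg _) hpi
      _ ≤ _ := key
  set E : ℝ → ℝ := fun t => ∫ x, w x t ^ 2 * polyWeight (1 + 2 * β) ε x with hE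
  have hexp : ∀ t, HasDerivAt (fun t => S / 2 * Real.exp ((K₁ + 2 * C₁) * t))
      (S / 2 * (Real.exp ((K₁ + 2 * C₁) * t) * (K₁ + 2 * C₁))) t := fun t => by
    have := (((hasDerivAt_id t).const_mul (K₁ + 2 * C₁)).exp).const_mul (S / 2)
    simpa using this
  have hfin := le_exp_mul_of_deriv_le (K := K₁)
    (F := fun t => E t - S / 2 * Real.exp ((K₁ + 2 * C₁) * t))
    (hcE.sub (fun t _ => (hexp t).continuousAt.continuousWithinAt)) (fun t ht => by
      obtain ⟨D, hD, hle⟩ := hdE t ht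
      refine ⟨_, hD.sub (hexp t), ?_⟩
      have := hsrc t ⟨ht.1.le, ht.2.le⟩
      have h3 : D ≤ K₁ * E t + C₁ * (S * Real.exp ((K₁ + 2 * C₁) * t)) := by
        refine hle.trans ?_
        simp only [hE]
        linarith
      linarith) t ht
  have hE0 : E 0 = 0 := by simp [hE, hw, heven]
  rw [hE0] at hfin
  have : Real.exp (K₁ * t) * (0 - S / 2 * Real.exp ((K₁ + 2 * C₁) * 0)) ≤ 0 := by
    have : 0 ≤ Real.exp (K₁ * t) * (S / 2 * Real.exp ((K₁ + 2 * C₁) * 0)) := by positivity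
    linarith
  linarith

/-- Evenness propagates. -/
lemma even_of_initial (h : IsSolution β κ θ a) (h0 : 0 < β) (h1 : β < 1 / 2) (hκ : 0 ≤ κ)
    {T A : ℝ} (hT : 0 < T) (hA : ∀ t ∈ Icc 0 T, |a 0 t| ≤ A)
    (hi : Integrable fun x => θ x 0 ^ 2) (hi' : Integrable fun x => dx θ 1 x 0 ^ 2)
    (heven : ∀ x, θ (-x) 0 = θ x 0) : ∀ t ∈ Icc 0 T, ∀ x, θ (-x) t = θ x t := by
  obtain ⟨K, hK0, hK⟩ := h.exists_halving h0 h1 hκ hT hA hi hi' heven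
  obtain ⟨C, hC⟩ := h.exists_bound_sq h0 h1 hκ hT hA hi hi'
  have hC0 : 0 ≤ C := (integral_nonneg fun x => sq_nonneg _).trans (hC 0 ⟨le_rfl, hT.le⟩).1.2
  have hiter : ∀ n : ℕ, ∀ t ∈ Icc 0 T, Integrable (fun x => (θ x t - θ (-x) t) ^ 2) ∧
        ∫ x, (θ x t - θ (-x) t) ^ 2 ≤ (4 * C + 1) * (1 / 2) ^ n * Real.exp (K * t) := by
    intro n
    induction n with
    | zero =>
      intro t ht
      have hcs := h.continuous_space ht.1
      have ib : Integrable fun x => 2 * θ x t ^ 2 + 2 * θ (-x) t ^ 2 :=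
        ((hC t ht).1.1.const_mul 2).add ((hC t ht).1.1.comp_neg.const_mul 2)
      have hle : ∀ x, (θ x t - θ (-x) t) ^ 2 ≤ 2 * θ x t ^ 2 + 2 * θ (-x) t ^ 2 := fun x => by
        nlinarith [sq_nonneg (θ x t + θ (-x) t)]
      have ii : Integrable fun x => (θ x t - θ (-x) t) ^ 2 :=
        ib.mono' ((hcs.sub (hcs.comp continuous_neg)).pow 2).aestronglyMeasurable
          (Eventually.of_forall fun x => by
            rw [Real.norm_eq_abs, abs_of_nonneg (sq_nonneg _)]; exact hle x)
      refine ⟨ii, (integral_mono ii ib hle).trans ?_⟩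
      rw [integral_add ((hC t ht).1.1.const_mul 2) ((hC t ht).1.1.comp_neg.const_mul 2),
        integral_const_mul, integral_const_mul, integral_neg_eq_self (fun x => θ x t ^ 2)]
      have he : 1 ≤ Real.exp (K * t) := Real.one_le_exp (mul_nonneg hK0 ht.1)
      have := (hC t ht).1.2
      rw [pow_zero, mul_one]
      nlinarith
    | succ n ih =>
      intro t ht
      have := hK ((4 * C + 1) * (1 / 2) ^ n) (by positivity) ih t ht
      refine ⟨this.1, this.2.trans_eq (by ring)⟩
  intro t ht x
  have hlim : Tendsto (fun n : ℕ => (4 * C + 1) * (1 / 2) ^ n * Real.exp (K * t)) atTop (𝓝 0) := by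
    have := ((tendsto_pow_atTop_nhds_zero_of_lt_one (r := (1 / 2 : ℝ)) (by norm_num)
      (by norm_num)).const_mul (4 * C + 1)).mul_const (Real.exp (K * t))
    simpa using this
  have hle : ∫ x, (θ x t - θ (-x) t) ^ 2 ≤ 0 := ge_of_tendsto' hlim fun n => (hiter n t ht).2
  have hnn : ∀ x, 0 ≤ (θ x t - θ (-x) t) ^ 2 := fun x => sq_nonneg _
  have hz := (integral_eq_zero_iff_of_nonneg hnn (hiter 0 t ht).1).1
    (le_antisymm hle (integral_nonneg hnn))
  have hcs := h.continuous_space ht.1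
  have hz' := congrFun ((Continuous.ae_eq_iff_eq volume
    ((hcs.sub (hcs.comp continuous_neg)).pow 2) continuous_const).1 hz) x
  have : θ x t - θ (-x) t = 0 := pow_eq_zero_iff two_ne_zero |>.1 hz'
  linarith

lemma a_zero_of_even (h : IsSolution β κ θ a) {t : ℝ} (ht : 0 ≤ t)
    (heven : ∀ x, θ (-x) t = θ x t) : a 0 t = 0 := by
  have hl := h.hilbert t ht 0
  have : (fun R => ∫ y in (0 : ℝ)..R, symmQuot (fun x' => θ x' t) 0 y) = fun _ => (0 : ℝ) := by
    ext R; simp [symmQuot, heven]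
  rw [this] at hl
  have := tendsto_nhds_unique hl tendsto_const_nhds
  simpa [Real.pi_ne_zero] using this

end IsSolution

/-! ### The logarithmic kernel of the Hilbert transform of an even function -/

/-- The kernel `log ((x + y) / |x - y|)`. -/
noncomputable def logKer (x y : ℝ) : ℝ := Real.log ((x + y) / |x - y|)

lemma logKer_comm (x y : ℝ) : logKer x y = logKer y x := by
  unfold logKer; rw [add_comm, abs_sub_comm]

lemma logKer_nonneg {x y : ℝ} (hx : 0 < x) (hy : 0 < y) : 0 ≤ logKer x y := by
  unfold logKer
  rcases eq_or_ne x y with rfl | h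
  · simp
  · have h1 : 0 < |x - y| := abs_pos.2 (sub_ne_zero.2 h)
    refine Real.log_nonneg ((one_le_div h1).2 ?_)
    rw [abs_le]; constructor <;> linarith

lemma logKer_mul_left {c : ℝ} (hc : 0 < c) (x y : ℝ) : logKer (c * x) (c * y) = logKer x y := by
  unfold logKer
  rw [← mul_add, ← mul_sub, abs_mul, abs_of_pos hc, mul_div_mul_left _ _ hc.ne']

lemma measurable_logKer : Measurable fun p : ℝ × ℝ => logKer p.1 p.2 := by
  unfold logKer
  have h1 : Continuous fun p : ℝ × ℝ => p.1 + p.2 := by fun_prop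
  have h2 : Continuous fun p : ℝ × ℝ => |p.1 - p.2| := by fun_prop
  exact Real.measurable_log.comp (h1.measurable.div h2.measurable)

lemma logKer_one_le {r : ℝ} (hr : 0 < r) (h1 : r ≠ 1) : logKer 1 r ≤ 2 * min 1 r / |1 - r| := by
  unfold logKer
  have h : 0 < |1 - r| := abs_pos.2 (sub_ne_zero.2 h1.symm)
  refine (Real.log_le_sub_one_of_pos (by positivity)).trans ?_
  rw [div_sub_one h.ne']
  gcongr
  rcases le_total r 1 with h2 | h2
  · rw [min_eq_right h2, abs_of_nonneg (by linarith)]; linarith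
  · rw [min_eq_left h2, abs_of_nonpos (by linarith)]; linarith

lemma integrableOn_rpow_mul_logKer {c : ℝ} (hc : -2 < c) (hc' : c < 0) :
    IntegrableOn (fun r => r ^ c * logKer 1 r) (Ioi 0) := by
  have hm : Measurable fun r : ℝ => r ^ c * logKer 1 r :=
    (measurable_id.pow_const c).mul (measurable_logKer.comp measurable_prodMk_left)
  have h1 : IntegrableOn (fun r => r ^ c * logKer 1 r) (Ioo 0 (1 / 2)) := by
    have hi : IntegrableOn (fun r : ℝ => 4 * r ^ (c + 1)) (Ioo 0 (1 / 2)) :=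
      ((intervalIntegral.integrableOn_Ioo_rpow_iff (by norm_num)).2 (by linarith)).const_mul 4
    refine hi.mono' hm.aestronglyMeasurable ?_
    filter_upwards [ae_restrict_mem measurableSet_Ioo] with r hr
    have hr0 : 0 < r := hr.1
    have hr1 : r < 1 / 2 := hr.2
    have hk := logKer_one_le hr0 (by linarith)
    rw [min_eq_right (by linarith), abs_of_pos (by linarith)] at hk
    have hk2 : 2 * r / (1 - r) ≤ 4 * r := by
      rw [div_le_iff₀ (by linarith)]; nlinarith
    rw [Real.norm_eq_abs, abs_of_nonneg (mul_nonneg (Real.rpow_nonneg hr0.le _)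
      (logKer_nonneg one_pos hr0)), Real.rpow_add_one hr0.ne']
    have := mul_le_mul_of_nonneg_left (hk.trans hk2) (Real.rpow_nonneg hr0.le c)
    linarith
  have h3 : IntegrableOn (fun r => r ^ c * logKer 1 r) (Ioi 2) := by
    have hi : IntegrableOn (fun r : ℝ => 4 * r ^ (c - 1)) (Ioi 2) :=
      (integrableOn_Ioi_rpow_of_lt (by linarith) two_pos).const_mul 4
    refine hi.mono' hm.aestronglyMeasurable ?_
    filter_upwards [ae_restrict_mem measurableSet_Ioi] with r hr
    have hr2 : 2 < r := hr
    have hr0 : 0 < r := by linarith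
    have hk := logKer_one_le hr0 (by linarith)
    rw [min_eq_left (by linarith), abs_of_neg (by linarith)] at hk
    have hk2 : 2 * 1 / (-(1 - r)) ≤ 4 * r⁻¹ := by
      rw [div_le_iff₀ (by linarith), mul_assoc, ← div_eq_inv_mul, mul_div_assoc']
      rw [le_div_iff₀ hr0]; linarith
    rw [Real.norm_eq_abs, abs_of_nonneg (mul_nonneg (Real.rpow_nonneg hr0.le _)
      (logKer_nonneg one_pos hr0)), Real.rpow_sub_one hr0.ne', div_eq_mul_inv]
    have := mul_le_mul_of_nonneg_left (hk.trans hk2) (Real.rpow_nonneg hr0.le c)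
    linarith
  have h2 : IntegrableOn (fun r => r ^ c * logKer 1 r) (Icc (1 / 2) 2) := by
    have hlog : IntegrableOn (fun r : ℝ => logKer 1 r) (Icc (1 / 2) 2) := by
      rw [integrableOn_Icc_iff_integrableOn_Ioc,
        ← intervalIntegrable_iff_integrableOn_Ioc_of_le (by norm_num)]
      have l0 : IntervalIntegrable Real.log volume (1 / 2 - 1) (2 - 1) :=
        intervalIntegral.intervalIntegrable_log'
      have l1 : IntervalIntegrable (fun r : ℝ => Real.log (r - 1)) volume (1 / 2) 2 := by
        simpa using l0.comp_sub_right 1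
      have l2 : IntervalIntegrable (fun r : ℝ => Real.log (1 + r)) volume (1 / 2) 2 := by
        refine ContinuousOn.intervalIntegrable ?_
        refine ContinuousOn.log (by fun_prop) fun r hr => ?_
        rw [uIcc_of_le (by norm_num)] at hr
        linarith [hr.1]
      refine (l2.sub l1).congr_ae ?_
      have hne : ∀ᵐ r : ℝ, r ≠ 1 := by simp [ae_iff, measure_singleton]
      filter_upwards [ae_restrict_mem measurableSet_uIoc, ae_restrict_of_ae hne] with r hr hr1
      rw [uIoc_of_le (by norm_num)] at hr
      unfold logKer
      rw [Real.log_div (by linarith [hr.1]) (abs_ne_zero.2 (sub_ne_zero.2 hr1.symm)), Real.log_abs,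
        ← Real.log_neg_eq_log (1 - r), neg_sub]
    refine hlog.continuousOn_mul ?_ isCompact_Icc
    exact fun r hr => (Real.continuousAt_rpow_const r c (Or.inl (by linarith [hr.1]))).continuousWithinAt
  refine ((h1.union h2).union h3).mono_set fun r hr => ?_
  rcases lt_or_ge r (1 / 2) with h | h
  · exact Or.inl (Or.inl ⟨hr, h⟩)
  · rcases le_or_gt r 2 with hr2 | hr2
    · exact Or.inl (Or.inr ⟨h, hr2⟩)
    · exact Or.inr hr2

/-- Lebesgue measure on the half line. -/
noncomputable abbrev volPos : Measure ℝ := volume.restrict (Ioi 0)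

lemma integrable_mul_rpow_div_mul_logKer {c : ℝ} (hc : -2 < c) (hc' : c < 0) {q : ℝ → ℝ}
    (hq : Measurable q) (hq0 : ∀ x, 0 < x → 0 ≤ q x) (hi : IntegrableOn (fun x => q x * x) (Ioi 0)) :
    Integrable (fun z : ℝ × ℝ => q z.1 * ((z.2 / z.1) ^ c * logKer z.1 z.2))
      (volPos.prod volPos) := by
  have hI := integrableOn_rpow_mul_logKer hc hc'
  have hscale : ∀ x : ℝ, 0 < x → (fun y => (y / x) ^ c * logKer x y)
      = fun y => (fun r => r ^ c * logKer 1 r) (x⁻¹ * y) := fun x hx => by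
    ext y
    simp only
    rw [← logKer_mul_left (inv_pos.2 hx) x y, inv_mul_cancel₀ hx.ne', div_eq_inv_mul]
  have hint : ∀ x : ℝ, 0 < x → IntegrableOn (fun y => (y / x) ^ c * logKer x y) (Ioi 0) := by
    intro x hx
    rw [hscale x hx]
    refine (integrableOn_Ioi_comp_mul_left_iff (fun r => r ^ c * logKer 1 r) 0 (inv_pos.2 hx)).2 ?_
    rwa [mul_zero]
  have hm : Measurable (fun z : ℝ × ℝ => q z.1 * ((z.2 / z.1) ^ c * logKer z.1 z.2)) :=
    (hq.comp measurable_fst).mul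
      (((measurable_snd.div measurable_fst).pow_const c).mul measurable_logKer)
  rw [integrable_prod_iff hm.aestronglyMeasurable]
  constructor
  · filter_upwards [ae_restrict_mem measurableSet_Ioi] with x hx
    exact (hint x hx).const_mul (q x)
  · refine (hi.mul_const (∫ r in Ioi 0, r ^ c * logKer 1 r)).congr ?_
    filter_upwards [ae_restrict_mem measurableSet_Ioi] with x hx
    have hx0 : 0 < x := hx
    have e1 : ∫ y in Ioi 0, ‖q x * ((y / x) ^ c * logKer x y)‖
        = ∫ y in Ioi 0, q x * ((y / x) ^ c * logKer x y) := by
      refine setIntegral_congr_fun measurableSet_Ioi fun y hy => ?_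
      have hy0 : 0 < y := hy
      exact abs_of_nonneg (mul_nonneg (hq0 x hx0) (mul_nonneg (by positivity)
        (logKer_nonneg hx0 hy0)))
    rw [e1, integral_const_mul, hscale x hx0,
      integral_comp_mul_left_Ioi (fun r => r ^ c * logKer 1 r) 0 (inv_pos.2 hx0), mul_zero, inv_inv,
      smul_eq_mul, mul_assoc]

/-- Schur's test for the weighted logarithmic form. -/
lemma integrable_mul_mul_rpow_mul_logKer {δ : ℝ} (hδ : 0 < δ) (hδ1 : δ < 1) {p : ℝ → ℝ}
    (hp : Measurable p) (hi : IntegrableOn (fun x => p x ^ 2 * x ^ (-δ)) (Ioi 0)) :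
    Integrable (fun z : ℝ × ℝ => p z.1 * p z.2 * z.1 ^ (-1 - δ) * logKer z.1 z.2)
      (volPos.prod volPos) := by
  set σ := (1 - δ) / 2 with hσ
  set q : ℝ → ℝ := fun x => p x ^ 2 * x ^ (-1 - δ) with hq
  have hqm : Measurable q := (hp.pow_const 2).mul (measurable_id.pow_const _)
  have hq0 : ∀ x, 0 < x → 0 ≤ q x := fun x hx => by positivity
  have hqi : IntegrableOn (fun x => q x * x) (Ioi 0) := by
    refine hi.congr_fun (fun x hx => ?_) measurableSet_Ioi
    have hx0 : 0 < x := hx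
    simp only [hq]
    rw [mul_assoc, ← Real.rpow_add_one hx0.ne']; congr 2; ring
  have i1 := integrable_mul_rpow_div_mul_logKer (c := -σ) (by linarith) (by linarith) hqm hq0 hqi
  have i2 := (integrable_mul_rpow_div_mul_logKer (c := -1 - δ - σ) (by linarith) (by linarith)
    hqm hq0 hqi).swap
  refine (i1.add i2).mono' ?_ ?_
  · exact ((((hp.comp measurable_fst).mul (hp.comp measurable_snd)).mul
      (measurable_fst.pow_const _)).mul measurable_logKer).aestronglyMeasurable
  · rw [Measure.prod_restrict]
    filter_upwards [ae_restrict_mem (measurableSet_Ioi.prod measurableSet_Ioi)] with z hz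
    obtain ⟨x, y⟩ := z
    have hx : 0 < x := hz.1
    have hy : 0 < y := hz.2
    have hG := logKer_nonneg hx hy
    simp only [Pi.add_apply, Function.comp, Prod.swap_prod_mk, hq]
    rw [logKer_comm y x, Real.norm_eq_abs, abs_mul, abs_of_nonneg hG, abs_mul,
      abs_of_nonneg (by positivity : 0 ≤ x ^ (-1 - δ)), ← mul_assoc, ← mul_assoc, ← add_mul]
    refine mul_le_mul_of_nonneg_right ?_ hG
    have e1 : (y / x) ^ (-σ) = ((x / y) ^ (σ / 2)) ^ 2 := by
      rw [← Real.rpow_natCast, ← Real.rpow_mul (by positivity), ← inv_div, Real.inv_rpow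
        (by positivity), Real.rpow_neg (by positivity), inv_inv]; congr 1; push_cast; ring
    have e2 : y ^ (-1 - δ) * (x / y) ^ (-1 - δ - σ) = x ^ (-1 - δ) * (((x / y) ^ (σ / 2))⁻¹) ^ 2 := by
      rw [inv_pow, ← Real.rpow_natCast, ← Real.rpow_mul (by positivity),
        sub_eq_add_neg (-1 - δ) σ, Real.rpow_add (by positivity), Real.rpow_neg (by positivity) σ,
        Real.div_rpow hx.le hy.le (-1 - δ), show σ / 2 * ((2 : ℕ) : ℝ) = σ by push_cast; ring]
      have : y ^ (-1 - δ) ≠ 0 := by positivity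
      field_simp
    rw [e1, mul_assoc (p y ^ 2), e2]
    set w := (x / y) ^ (σ / 2) with hw
    have hw0 : 0 < w := by positivity
    have hX : 0 ≤ x ^ (-1 - δ) := by positivity
    have key : |p x * p y| ≤ p x ^ 2 * w ^ 2 + p y ^ 2 * w⁻¹ ^ 2 := by
      rw [abs_mul, ← sq_abs (p x), ← sq_abs (p y)]
      have h2 : |p x| * |p y| = (|p x| * w) * (|p y| * w⁻¹) := by field_simp
      nlinarith [sq_nonneg (|p x| * w - |p y| * w⁻¹), sq_nonneg (|p x| * w),
        sq_nonneg (|p y| * w⁻¹)]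
    calc _ ≤ (p x ^ 2 * w ^ 2 + p y ^ 2 * w⁻¹ ^ 2) * x ^ (-1 - δ) := by gcongr
      _ = _ := by ring

/-- The Hilbert transform of an even function in terms of its derivative on the half line. -/
lemma hilbert_eq_integral_logKer {f f' : ℝ → ℝ} {x v : ℝ} (hf : ∀ x, HasDerivAt f (f' x) x)
    (hc' : Continuous f') (heven : ∀ x, f (-x) = f x) (hx : 0 < x)
    (hi : IntegrableOn (fun s => f' s * logKer x s) (Ioi 0))
    (hv : Tendsto (fun R => ∫ y in (0 : ℝ)..R, symmQuot f x y) atTop (𝓝 v)) :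
    v = -∫ s in Ioi 0, f' s * logKer x s := by
  set A : Set (ℝ × ℝ) := {z | |x - z.1| < z.2 ∧ z.2 < x + z.1} with hA
  have hAm : MeasurableSet A := by
    refine MeasurableSet.inter ?_ ?_
    · exact measurableSet_lt (f := fun z : ℝ × ℝ => |x - z.1|) (g := fun z => z.2)
        (by fun_prop) (by fun_prop)
    · exact measurableSet_lt (f := fun z : ℝ × ℝ => z.2) (g := fun z => x + z.1)
        (by fun_prop) (by fun_prop)
  set q : ℝ × ℝ → ℝ := A.indicator fun z => f' z.1 * z.2⁻¹ with hq
  have hqm : Measurable q :=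
    ((hc'.measurable.comp measurable_fst).mul measurable_snd.inv).indicator hAm
  -- integration in the second variable
  have hsec : ∀ s : ℝ, 0 < s → s ≠ x → ∀ g : ℝ → ℝ, (∀ y, 0 < y → g y = A.indicator
      (fun z => z.2⁻¹) (s, y)) → IntegrableOn g (Ioi 0) ∧ ∫ y in Ioi 0, g y = logKer x s := by
    intro s hs hsx g hg
    have hpos : 0 < |x - s| := abs_pos.2 (sub_ne_zero.2 hsx.symm)
    have hlt : |x - s| < x + s := by rw [abs_lt]; constructor <;> linarith
    have hfun : EqOn g ((Ioo |x - s| (x + s)).indicator fun y => y⁻¹) (Ioi 0) := fun y hy => by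
      rw [hg y hy]
      by_cases h : y ∈ Ioo |x - s| (x + s)
      · rw [indicator_of_mem h, indicator_of_mem (show (s, y) ∈ A from h)]
      · rw [indicator_of_notMem h, indicator_of_notMem (show (s, y) ∉ A from h)]
    have hsub : Ioo |x - s| (x + s) ⊆ Ioi 0 := fun y hy => hpos.trans hy.1
    have hinv : IntervalIntegrable (fun y : ℝ => y⁻¹) volume |x - s| (x + s) :=
      (ContinuousOn.inv₀ continuousOn_id fun y hy => by
        rw [uIcc_of_le hlt.le] at hy; exact (hpos.trans_le hy.1).ne').intervalIntegrable
    have hinv' : IntegrableOn (fun y : ℝ => y⁻¹) (Ioo |x - s| (x + s)) :=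
      ((intervalIntegrable_iff_integrableOn_Ioc_of_le hlt.le).1 hinv).mono_set Ioo_subset_Ioc_self
    constructor
    · refine IntegrableOn.congr_fun ?_ hfun.symm measurableSet_Ioi
      exact (hinv'.integrable_indicator measurableSet_Ioo).integrableOn
    · rw [setIntegral_congr_fun measurableSet_Ioi hfun, setIntegral_indicator measurableSet_Ioo,
        inter_eq_right.2 hsub, ← integral_Ioc_eq_integral_Ioo,
        ← intervalIntegral.integral_of_le hlt.le, integral_inv_of_pos hpos (by linarith)]
      rfl
  have hne : ∀ᵐ s ∂volPos, s ≠ x := by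
    refine ae_restrict_of_ae ?_
    simp [ae_iff, measure_singleton]
  have hq_eq : ∀ s y, q (s, y) = f' s * A.indicator (fun z => z.2⁻¹) (s, y) := fun s y => by
    simp only [hq, indicator]; split_ifs <;> simp
  have hqi : Integrable q (volPos.prod volPos) := by
    rw [integrable_prod_iff hqm.aestronglyMeasurable]
    constructor
    · filter_upwards [ae_restrict_mem measurableSet_Ioi, hne] with s hs hsx
      simp only [hq_eq]
      exact ((hsec s hs hsx _ fun y _ => rfl).1).const_mul _
    · refine hi.norm.congr ?_
      filter_upwards [ae_restrict_mem measurableSet_Ioi, hne] with s hs hsx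
      have hs0 : 0 < s := hs
      simp only [hq_eq, norm_mul]
      rw [integral_const_mul, (hsec s hs hsx _ fun y hy => ?_).2, Real.norm_eq_abs (logKer x s),
        abs_of_nonneg (logKer_nonneg hx hs0)]
      rw [Real.norm_eq_abs, abs_of_nonneg]
      have hy0 : 0 < y := hy
      simp only [indicator]
      split_ifs <;> positivity
  -- integration in the first variable
  have hfirst : ∀ y : ℝ, 0 < y → ∫ s in Ioi 0, q (s, y) = -symmQuot f x y := by
    intro y hy
    have hle : |x - y| ≤ x + y := by rw [abs_le]; constructor <;> linarith
    have hfun : EqOn (fun s => q (s, y)) ((Ioo |x - y| (x + y)).indicator fun s => f' s * y⁻¹)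
        (Ioi 0) := fun s hs => by
      have hs0 : 0 < s := hs
      have hiff : (s, y) ∈ A ↔ s ∈ Ioo |x - y| (x + y) := by
        simp only [hA, Set.mem_ofPred_eq, mem_Ioo, abs_lt]
        constructor <;> rintro ⟨⟨_, _⟩, _⟩ <;> refine ⟨⟨?_, ?_⟩, ?_⟩ <;> linarith
      by_cases h : (s, y) ∈ A
      · simp only [hq]; rw [indicator_of_mem h, indicator_of_mem (hiff.1 h)]
      · simp only [hq]; rw [indicator_of_notMem h, indicator_of_notMem (mt hiff.2 h)]
    have hsub : Ioo |x - y| (x + y) ⊆ Ioi 0 := fun s hs => (abs_nonneg _).trans_lt hs.1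
    rw [setIntegral_congr_fun measurableSet_Ioi hfun, setIntegral_indicator measurableSet_Ioo,
      inter_eq_right.2 hsub, ← integral_Ioc_eq_integral_Ioo,
      ← intervalIntegral.integral_of_le hle, intervalIntegral.integral_mul_const,
      intervalIntegral.integral_eq_sub_of_hasDerivAt (fun s _ => hf s)
        (hc'.intervalIntegrable _ _)]
    have : f |x - y| = f (x - y) := by
      rcases abs_cases (x - y) with ⟨h, _⟩ | ⟨h, _⟩ <;> rw [h]
      exact heven _
    rw [this]; unfold symmQuot; ring
  have hsymm : IntegrableOn (fun y => symmQuot f x y) (Ioi 0) := by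
    refine (hqi.integral_prod_right.neg).congr ?_
    filter_upwards [ae_restrict_mem measurableSet_Ioi] with y hy
    simp only [Pi.neg_apply]
    rw [hfirst y hy, neg_neg]
  have hlim := intervalIntegral_tendsto_integral_Ioi 0 hsymm tendsto_id
  rw [tendsto_nhds_unique hv hlim]
  have e1 : ∫ y in Ioi 0, symmQuot f x y = -∫ y in Ioi 0, ∫ s in Ioi 0, q (s, y) := by
    rw [← integral_neg]
    refine setIntegral_congr_fun measurableSet_Ioi fun y hy => ?_
    simp only [hfirst y hy, neg_neg]
  rw [e1, ← integral_integral_swap (f := fun s y => q (s, y)) hqi]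
  congr 1
  refine integral_congr_ae ?_
  filter_upwards [ae_restrict_mem measurableSet_Ioi, hne] with s hs hsx
  simp only [hq_eq]
  rw [integral_const_mul, (hsec s hs hsx _ fun y _ => rfl).2]

/-! ### Positivity of the quadratic form of the logarithmic kernel -/

lemma ae_volPos_prod_pos : ∀ᵐ z ∂(volPos.prod volPos), 0 < z.1 ∧ 0 < z.2 := by
  rw [volPos, Measure.prod_restrict]
  filter_upwards [ae_restrict_mem (measurableSet_Ioi.prod measurableSet_Ioi)] with z hz
  exact ⟨hz.1, hz.2⟩

lemma quadForm_min_max {p : ℝ → ℝ} {b c : ℝ} (hp : Measurable p) (hbc : 0 < b + c)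
    (hi : Integrable (fun z : ℝ × ℝ => p z.1 * p z.2 * (min z.1 z.2 ^ b * max z.1 z.2 ^ (-c)))
      (volPos.prod volPos)) :
    IntegrableOn (fun w : ℝ => w ^ (-(b + c) - 1) * (∫ x in Ioo 0 w, p x * x ^ b) ^ 2) (Ioi 0) ∧
    ∫ z, p z.1 * p z.2 * (min z.1 z.2 ^ b * max z.1 z.2 ^ (-c)) ∂(volPos.prod volPos) =
      (b + c) * ∫ w in Ioi 0, w ^ (-(b + c) - 1) * (∫ x in Ioo 0 w, p x * x ^ b) ^ 2 := by
  set U : Set ((ℝ × ℝ) × ℝ) := {v | v.1.1 < v.2 ∧ v.1.2 < v.2} with hU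
  have hUm : MeasurableSet U := by
    refine MeasurableSet.inter ?_ ?_
    · exact measurableSet_lt (f := fun v : (ℝ × ℝ) × ℝ => v.1.1) (g := fun v => v.2)
        (by fun_prop) (by fun_prop)
    · exact measurableSet_lt (f := fun v : (ℝ × ℝ) × ℝ => v.1.2) (g := fun v => v.2)
        (by fun_prop) (by fun_prop)
  set G : (ℝ × ℝ) × ℝ → ℝ := U.indicator fun v =>
    (p v.1.1 * v.1.1 ^ b) * (p v.1.2 * v.1.2 ^ b) * v.2 ^ (-(b + c) - 1) with hG
  have hGm : Measurable G := by
    refine Measurable.indicator ?_ hUm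
    fun_prop
  have hsec : ∀ x y : ℝ, 0 < x → 0 < y → ∀ w, G ((x, y), w) =
      (Ioi (max x y)).indicator (fun w => (p x * x ^ b) * (p y * y ^ b) * w ^ (-(b + c) - 1)) w := by
    intro x y hx hy w
    by_cases h : w ∈ Ioi (max x y)
    · have h' : ((x, y), w) ∈ U := max_lt_iff.1 h
      simp only [hG]; rw [indicator_of_mem h, indicator_of_mem h']
    · have h' : ((x, y), w) ∉ U := fun h' => h (max_lt_iff.2 h')
      simp only [hG]; rw [indicator_of_notMem h, indicator_of_notMem h']
  have hker : ∀ x y : ℝ, 0 < x → 0 < y → x ^ b * y ^ b * (max x y ^ (-(b + c)) / (b + c)) =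
      (b + c)⁻¹ * (min x y ^ b * max x y ^ (-c)) := by
    intro x y hx hy
    have hM : 0 < max x y := lt_max_of_lt_left hx
    have e1 : x ^ b * y ^ b = min x y ^ b * max x y ^ b := by
      rcases le_total x y with h | h
      · rw [min_eq_left h, max_eq_right h]
      · rw [min_eq_right h, max_eq_left h, mul_comm]
    have e2 : max x y ^ (-c) = max x y ^ b * max x y ^ (-(b + c)) := by
      rw [← Real.rpow_add hM]; congr 1; ring
    rw [e1, e2]; ring
  have hint : ∀ x y : ℝ, 0 < x → 0 < y → ∀ A : ℝ,
      ∫ w in Ioi 0, (Ioi (max x y)).indicator (fun w => A * w ^ (-(b + c) - 1)) w =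
        A * (max x y ^ (-(b + c)) / (b + c)) := by
    intro x y hx hy A
    have hM : 0 < max x y := lt_max_of_lt_left hx
    rw [setIntegral_indicator measurableSet_Ioi, Ioi_inter_Ioi, max_eq_right hM.le,
      integral_const_mul, integral_Ioi_rpow_of_lt (by linarith) hM]
    rw [show -(b + c) - 1 + 1 = -(b + c) by ring, neg_div_neg_eq]
  have hGi : Integrable G ((volPos.prod volPos).prod volPos) := by
    rw [integrable_prod_iff hGm.aestronglyMeasurable]
    constructor
    · filter_upwards [ae_volPos_prod_pos] with z hz
      have hM : 0 < max z.1 z.2 := lt_max_of_lt_left hz.1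
      simp only [hsec z.1 z.2 hz.1 hz.2]
      refine Integrable.mono_measure ?_ Measure.restrict_le_self
      rw [integrable_indicator_iff measurableSet_Ioi]
      exact (integrableOn_Ioi_rpow_of_lt (by linarith) hM).const_mul _
    · refine (hi.norm.const_mul (b + c)⁻¹).congr ?_
      filter_upwards [ae_volPos_prod_pos] with z hz
      have hM : 0 < max z.1 z.2 := lt_max_of_lt_left hz.1
      have hm : 0 < min z.1 z.2 := lt_min hz.1 hz.2
      have e : ∀ w, ‖G (z, w)‖ = (Ioi (max z.1 z.2)).indicator (fun w =>
          |(p z.1 * z.1 ^ b) * (p z.2 * z.2 ^ b)| * w ^ (-(b + c) - 1)) w := fun w => by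
        rw [hsec z.1 z.2 hz.1 hz.2, norm_indicator_eq_indicator_norm]
        simp only [indicator]
        split_ifs with h
        · have hw : 0 < w := hM.trans h
          rw [norm_mul, Real.norm_eq_abs, Real.norm_eq_abs, abs_of_nonneg (Real.rpow_nonneg hw.le _)]
        · rfl
      simp only [e]
      rw [hint z.1 z.2 hz.1 hz.2]
      have h3 := hker z.1 z.2 hz.1 hz.2
      simp only [Real.norm_eq_abs, abs_mul]
      rw [abs_of_nonneg (Real.rpow_nonneg hz.1.le b), abs_of_nonneg (Real.rpow_nonneg hz.2.le b),
        abs_of_nonneg (Real.rpow_nonneg hm.le b), abs_of_nonneg (Real.rpow_nonneg hM.le (-c))]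
      linear_combination -(|p z.1| * |p z.2|) * h3
  have hval : ∀ w : ℝ, ∫ z, G (z, w) ∂(volPos.prod volPos) =
      w ^ (-(b + c) - 1) * (∫ x in Ioo 0 w, p x * x ^ b) ^ 2 := by
    intro w
    have e : ∀ z : ℝ × ℝ, G (z, w) = w ^ (-(b + c) - 1) *
        ((Iio w).indicator (fun x => p x * x ^ b) z.1 *
          (Iio w).indicator (fun x => p x * x ^ b) z.2) := fun z => by
      by_cases h1 : z.1 ∈ Iio w
      · by_cases h2 : z.2 ∈ Iio w
        · have : (z, w) ∈ U := ⟨h1, h2⟩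
          simp only [hG]; rw [indicator_of_mem this, indicator_of_mem h1, indicator_of_mem h2]; ring
        · have : (z, w) ∉ U := fun h => h2 h.2
          simp only [hG]; rw [indicator_of_notMem this, indicator_of_notMem h2]; ring
      · have : (z, w) ∉ U := fun h => h1 h.1
        simp only [hG]; rw [indicator_of_notMem this, indicator_of_notMem h1]; ring
    simp only [e]
    rw [integral_const_mul, integral_prod_mul (μ := volPos) (ν := volPos)
      ((Iio w).indicator fun x => p x * x ^ b) ((Iio w).indicator fun x => p x * x ^ b),
      setIntegral_indicator measurableSet_Iio, Ioi_inter_Iio, sq]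
  have h1 := hGi.integral_prod_right
  simp only [hval] at h1
  refine ⟨h1, ?_⟩
  have h2 := integral_integral_swap (f := fun z w => G (z, w)) hGi
  simp only [hval] at h2
  rw [← h2, ← integral_const_mul]
  refine integral_congr_ae ?_
  filter_upwards [ae_volPos_prod_pos] with z hz
  simp only [hsec z.1 z.2 hz.1 hz.2]
  rw [hint z.1 z.2 hz.1 hz.2]
  have h3 := hker z.1 z.2 hz.1 hz.2
  have h4 : (b + c) * (b + c)⁻¹ = 1 := mul_inv_cancel₀ hbc.ne'
  linear_combination (-(b + c) * (p z.1 * p z.2)) * h3 -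
    (p z.1 * p z.2) * (min z.1 z.2 ^ b * max z.1 z.2 ^ (-c)) * h4

/-- Symmetrization of the terms of the logarithmic series. -/
lemma two_mul_integral_rpow_mul_ratio_pow {p : ℝ → ℝ} {δ : ℝ} {n : ℕ} (hp : Measurable p)
    (hn : 1 ≤ n) (hδ : 0 < δ) (hδ1 : δ < 1)
    (hi : Integrable (fun z : ℝ × ℝ => p z.1 * p z.2 * z.1 ^ (-1 - δ) *
      (min z.1 z.2 / max z.1 z.2) ^ n) (volPos.prod volPos)) :
    IntegrableOn (fun w : ℝ => w ^ (-(n + (n + 1 + δ)) - 1) *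
      (∫ x in Ioo 0 w, p x * x ^ (n : ℝ)) ^ 2) (Ioi 0) ∧
    (n + (n + 1 + δ)) * (∫ w in Ioi 0, w ^ (-(n + (n + 1 + δ)) - 1) *
      (∫ x in Ioo 0 w, p x * x ^ (n : ℝ)) ^ 2) ≤
    2 * ∫ z, p z.1 * p z.2 * z.1 ^ (-1 - δ) * (min z.1 z.2 / max z.1 z.2) ^ n
      ∂(volPos.prod volPos) := by
  have hn' : (1 : ℝ) ≤ n := by exact_mod_cast hn
  set T : ℝ × ℝ → ℝ := fun z => p z.1 * p z.2 * z.1 ^ (-1 - δ) *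
    (min z.1 z.2 / max z.1 z.2) ^ n with hT
  set K₁ : ℝ × ℝ → ℝ := fun z => p z.1 * p z.2 *
    (min z.1 z.2 ^ (n : ℝ) * max z.1 z.2 ^ (-(n + 1 + δ))) with hK₁
  set K₂ : ℝ × ℝ → ℝ := fun z => p z.1 * p z.2 *
    (min z.1 z.2 ^ (n - 1 - δ) * max z.1 z.2 ^ (-(n : ℝ))) with hK₂
  have hsum : ∀ x y : ℝ, 0 < x → 0 < y → T (x, y) + T (y, x) = K₁ (x, y) + K₂ (x, y) ∧
      |K₁ (x, y)| ≤ |T (x, y)| + |T (y, x)| ∧ |K₂ (x, y)| ≤ |T (x, y)| + |T (y, x)| := by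
    have aux : ∀ x y : ℝ, 0 < x → x ≤ y → T (x, y) = K₂ (x, y) ∧ T (y, x) = K₁ (x, y) := by
      intro x y hx hxy
      have hy : 0 < y := hx.trans_le hxy
      simp only [hT, hK₁, hK₂, min_eq_left hxy, max_eq_right hxy, min_eq_right hxy,
        max_eq_left hxy]
      have e1 : (x / y) ^ n = x ^ (n : ℝ) * y ^ (-(n : ℝ)) := by
        rw [Real.rpow_neg hy.le, Real.rpow_natCast, Real.rpow_natCast, div_pow, div_eq_mul_inv]
      have e2 : x ^ ((n : ℝ) - 1 - δ) = x ^ (-1 - δ) * x ^ (n : ℝ) := by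
        rw [← Real.rpow_add hx]; congr 1; ring
      have e3 : y ^ (-((n : ℝ) + 1 + δ)) = y ^ (-1 - δ) * y ^ (-(n : ℝ)) := by
        rw [← Real.rpow_add hy]; congr 1; ring
      rw [e1, e2, e3]
      constructor <;> ring
    have hs₁ : ∀ x y : ℝ, K₁ (y, x) = K₁ (x, y) := fun x y => by
      simp only [hK₁, min_comm y x, max_comm y x]; ring
    have hs₂ : ∀ x y : ℝ, K₂ (y, x) = K₂ (x, y) := fun x y => by
      simp only [hK₂, min_comm y x, max_comm y x]; ring
    intro x y hx hy
    rcases le_total x y with h | h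
    · obtain ⟨h1, h2⟩ := aux x y hx h
      rw [h1, h2]
      refine ⟨by ring, ?_, ?_⟩ <;> linarith [abs_nonneg (K₁ (x, y)), abs_nonneg (K₂ (x, y))]
    · obtain ⟨h1, h2⟩ := aux y x hy h
      rw [h1, h2, hs₁, hs₂]
      refine ⟨by ring, ?_, ?_⟩ <;> linarith [abs_nonneg (K₁ (x, y)), abs_nonneg (K₂ (x, y))]
  have hsw : Integrable (fun z : ℝ × ℝ => T z.swap) (volPos.prod volPos) := hi.swap
  have hB : Integrable (fun z : ℝ × ℝ => |T z| + |T z.swap|) (volPos.prod volPos) :=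
    hi.abs.add hsw.abs
  have hm₁ : Measurable K₁ := by fun_prop
  have hm₂ : Measurable K₂ := by fun_prop
  have i₁ : Integrable K₁ (volPos.prod volPos) := by
    refine hB.mono' hm₁.aestronglyMeasurable ?_
    filter_upwards [ae_volPos_prod_pos] with z hz using (hsum z.1 z.2 hz.1 hz.2).2.1
  have i₂ : Integrable K₂ (volPos.prod volPos) := by
    refine hB.mono' hm₂.aestronglyMeasurable ?_
    filter_upwards [ae_volPos_prod_pos] with z hz using (hsum z.1 z.2 hz.1 hz.2).2.2
  have hsumI : 2 * ∫ z, T z ∂(volPos.prod volPos) =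
      ∫ z, K₁ z ∂(volPos.prod volPos) + ∫ z, K₂ z ∂(volPos.prod volPos) := by
    rw [two_mul]
    nth_rewrite 2 [← integral_prod_swap]
    rw [← integral_add hi hsw, ← integral_add i₁ i₂]
    refine integral_congr_ae ?_
    filter_upwards [ae_volPos_prod_pos] with z hz using (hsum z.1 z.2 hz.1 hz.2).1
  obtain ⟨q1, q2⟩ := quadForm_min_max hp (by linarith) i₁
  obtain ⟨-, q3⟩ := quadForm_min_max hp (by linarith) i₂
  refine ⟨q1, ?_⟩
  rw [hsumI, ← q2]
  have : 0 ≤ ∫ z, K₂ z ∂(volPos.prod volPos) := by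
    rw [q3]
    refine mul_nonneg (by linarith) (setIntegral_nonneg measurableSet_Ioi fun w hw => ?_)
    have hw0 : 0 < w := hw
    positivity
  linarith

lemma hasSum_logKer {x y : ℝ} (hx : 0 < x) (hy : 0 < y) (hxy : x ≠ y) :
    HasSum (fun k : ℕ => 2 * (1 / (2 * (k : ℝ) + 1)) * (min x y / max x y) ^ (2 * k + 1))
      (logKer x y) := by
  wlog h : x < y generalizing x y
  · have := this hy hx hxy.symm (lt_of_le_of_ne (not_lt.1 h) hxy.symm)
    rwa [min_comm, max_comm, logKer_comm] at this
  rw [min_eq_left h.le, max_eq_right h.le]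
  have hu : x / y < 1 := (div_lt_one hy).2 h
  have hu0 : 0 < x / y := by positivity
  have := Real.hasSum_log_sub_log_of_abs_lt_one (x := x / y) (by rw [abs_of_pos hu0]; exact hu)
  convert this using 1
  unfold logKer
  rw [← Real.log_div (by linarith) (by linarith), abs_of_neg (by linarith)]
  congr 1
  have : y - x ≠ 0 := by linarith
  have : -(x - y) ≠ 0 := by linarith
  field_simp
  ring

/-- Lower bound for the quadratic form of the logarithmic kernel. -/
lemma le_integral_mul_mul_rpow_mul_logKer {p : ℝ → ℝ} {δ : ℝ} (hδ : 0 < δ) (hδ1 : δ < 1)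
    (hp : Measurable p) (hi : IntegrableOn (fun x => p x ^ 2 * x ^ (-δ)) (Ioi 0)) :
    IntegrableOn (fun w : ℝ => w ^ (-4 - δ) * (∫ x in Ioo 0 w, p x * x) ^ 2) (Ioi 0) ∧
    (3 + δ) * (∫ w in Ioi 0, w ^ (-4 - δ) * (∫ x in Ioo 0 w, p x * x) ^ 2) ≤
      ∫ z, p z.1 * p z.2 * z.1 ^ (-1 - δ) * logKer z.1 z.2 ∂(volPos.prod volPos) := by
  have hI := integrable_mul_mul_rpow_mul_logKer hδ hδ1 hp hi
  set c : ℕ → ℝ := fun k => 2 * (1 / (2 * (k : ℝ) + 1)) with hc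
  have hc0 : ∀ k, 0 < c k := fun k => by positivity
  set R : ℝ × ℝ → ℝ := fun z => p z.1 * p z.2 * z.1 ^ (-1 - δ) with hR
  set u : ℝ × ℝ → ℝ := fun z => min z.1 z.2 / max z.1 z.2 with hu
  have hRm : Measurable R := by fun_prop
  have hum : Measurable u := by fun_prop
  have hne : ∀ᵐ z ∂(volPos.prod volPos), z.1 ≠ z.2 := by
    have hms : MeasurableSet {z : ℝ × ℝ | z.1 ≠ z.2} :=
      (measurableSet_eq_fun measurable_fst measurable_snd).compl
    rw [Measure.ae_prod_iff_ae_ae hms]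
    refine Eventually.of_forall fun x => ae_restrict_of_ae ?_
    simp [ae_iff, measure_singleton]
  have hser : ∀ᵐ z ∂(volPos.prod volPos), HasSum (fun k => R z * (c k * u z ^ (2 * k + 1)))
      (R z * logKer z.1 z.2) := by
    filter_upwards [ae_volPos_prod_pos, hne] with z hz hz'
    exact (hasSum_logKer hz.1 hz.2 hz').mul_left _
  have hserabs : ∀ᵐ z ∂(volPos.prod volPos), HasSum (fun k => |R z * (c k * u z ^ (2 * k + 1))|)
      |R z * logKer z.1 z.2| := by
    filter_upwards [ae_volPos_prod_pos, hne] with z hz hz'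
    have h0 : 0 ≤ u z := div_nonneg (lt_min hz.1 hz.2).le (lt_max_of_lt_left hz.1).le
    have := (hasSum_logKer hz.1 hz.2 hz').mul_left |R z|
    rw [abs_mul, abs_of_nonneg (logKer_nonneg hz.1 hz.2)]
    refine this.congr_fun fun k => ?_
    rw [abs_mul, abs_of_nonneg (mul_nonneg (hc0 k).le (pow_nonneg h0 _))]
  have hmeas : ∀ k, Measurable fun z => R z * (c k * u z ^ (2 * k + 1)) := fun k => by fun_prop
  have hterm : ∀ k, Integrable (fun z => R z * (c k * u z ^ (2 * k + 1))) (volPos.prod volPos) := by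
    intro k
    refine hI.norm.mono' (hmeas k).aestronglyMeasurable ?_
    filter_upwards [hserabs] with z hz
    exact le_hasSum hz k fun j _ => abs_nonneg _
  have hHS := hasSum_integral_of_dominated_convergence
    (F := fun k z => R z * (c k * u z ^ (2 * k + 1)))
    (fun k z => |R z * (c k * u z ^ (2 * k + 1))|) (fun k => (hmeas k).aestronglyMeasurable)
    (fun k => Eventually.of_forall fun z => le_rfl) (hserabs.mono fun z hz => hz.summable)
    (hI.abs.congr (hserabs.mono fun z hz => hz.tsum_eq.symm)) hser
  have hterm' : ∀ k, Integrable (fun z : ℝ × ℝ => p z.1 * p z.2 * z.1 ^ (-1 - δ) *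
      (min z.1 z.2 / max z.1 z.2) ^ (2 * k + 1)) (volPos.prod volPos) := fun k => by
    refine ((hterm k).const_mul (c k)⁻¹).congr (Eventually.of_forall fun z => ?_)
    have := (hc0 k).ne'
    simp only [hR, hu]
    field_simp
  have hval : ∀ k, ∫ z, R z * (c k * u z ^ (2 * k + 1)) ∂(volPos.prod volPos) =
      c k * ∫ z, p z.1 * p z.2 * z.1 ^ (-1 - δ) *
      (min z.1 z.2 / max z.1 z.2) ^ (2 * k + 1) ∂(volPos.prod volPos) := fun k => by
    rw [← integral_const_mul]
    congr 1; ext z; simp only [hR, hu]; ring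
  have h0 := le_hasSum hHS 0 fun k _ => by
    rw [hval]
    have h1 := (two_mul_integral_rpow_mul_ratio_pow hp (by omega) hδ hδ1 (hterm' k)).2
    refine mul_nonneg (hc0 k).le ?_
    have h2 : 0 ≤ (((2 * k + 1 : ℕ) : ℝ) + ((2 * k + 1 : ℕ) + 1 + δ)) * ∫ w in Ioi 0,
        w ^ (-(((2 * k + 1 : ℕ) : ℝ) + ((2 * k + 1 : ℕ) + 1 + δ)) - 1) *
        (∫ x in Ioo 0 w, p x * x ^ ((2 * k + 1 : ℕ) : ℝ)) ^ 2 := by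
      refine mul_nonneg (by positivity) (setIntegral_nonneg measurableSet_Ioi fun w hw => ?_)
      have hw0 : 0 < w := hw
      positivity
    linarith
  rw [hval] at h0
  obtain ⟨g1, g2⟩ := two_mul_integral_rpow_mul_ratio_pow hp (by omega) hδ hδ1 (hterm' 0)
  have e1 : -(((2 * 0 + 1 : ℕ) : ℝ) + ((2 * 0 + 1 : ℕ) + 1 + δ)) - 1 = -4 - δ := by
    push_cast; ring
  have e2 : (((2 * 0 + 1 : ℕ) : ℝ) + ((2 * 0 + 1 : ℕ) + 1 + δ)) = 3 + δ := by
    push_cast; ring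
  have e3 : (((2 * 0 + 1 : ℕ) : ℝ)) = 1 := by norm_num
  rw [e1] at g1 g2
  rw [e2] at g2
  simp only [e3, Real.rpow_one] at g1 g2
  refine ⟨g1, g2.trans (le_trans (le_of_eq ?_) h0)⟩
  simp [hc]

/-- The nonlinear term of the weighted integral of an even function dominates a weighted
square. -/
lemma le_integral_hilbert_mul_deriv {f f' h : ℝ → ℝ} {δ : ℝ} (hδ : 0 < δ) (hδ1 : δ < 1)
    (hf : ∀ x, HasDerivAt f (f' x) x) (hc' : Continuous f') (heven : ∀ x, f (-x) = f x)
    (hi : IntegrableOn (fun x => f' x ^ 2 * x ^ (-δ)) (Ioi 0))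
    (hh : ∀ x, Tendsto (fun R => ∫ y in (0 : ℝ)..R, symmQuot f x y) atTop (𝓝 (h x))) :
    IntegrableOn (fun w : ℝ => w ^ (-4 - δ) * (∫ x in Ioo 0 w, -f' x * x) ^ 2) (Ioi 0) ∧
    (3 + δ) * (∫ w in Ioi 0, w ^ (-4 - δ) * (∫ x in Ioo 0 w, -f' x * x) ^ 2) ≤
      ∫ x in Ioi 0, h x * -f' x * x ^ (-1 - δ) := by
  have hp : Measurable fun x => -f' x := hc'.neg.measurable
  have hi' : IntegrableOn (fun x => (-f' x) ^ 2 * x ^ (-δ)) (Ioi 0) := by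
    simpa only [neg_sq] using hi
  have hI := integrable_mul_mul_rpow_mul_logKer hδ hδ1 hp hi'
  obtain ⟨h1, h2⟩ := le_integral_mul_mul_rpow_mul_logKer hδ hδ1 hp hi'
  refine ⟨h1, h2.trans (le_of_eq ?_)⟩
  rw [integral_prod _ hI]
  refine integral_congr_ae ?_
  filter_upwards [hI.prod_right_ae, ae_restrict_mem measurableSet_Ioi] with x hx hx0
  have hx0 : 0 < x := hx0
  rcases eq_or_ne (f' x) 0 with h0 | h0
  · simp [h0]
  have hX : x ^ (-1 - δ) ≠ 0 := (Real.rpow_pos_of_pos hx0 _).ne'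
  have hsec : IntegrableOn (fun s => f' s * logKer x s) (Ioi 0) := by
    refine (hx.const_mul (f' x * x ^ (-1 - δ))⁻¹).congr (Eventually.of_forall fun s => ?_)
    simp only
    field_simp
  rw [hilbert_eq_integral_logKer hf hc' heven hx0 hsec (hh x)]
  rw [neg_mul_neg, mul_assoc, ← integral_mul_const]
  congr 1; ext s; ring

/-! ### The dissipative term of the weighted integral -/

/-- The indicator of `s < z`. -/
noncomputable def stepFn (s z : ℝ) : ℝ := if s < z then 1 else 0

/-- The second difference of the step function at `s`. -/
noncomputable def stepDiff (s : ℝ) (z : ℝ × ℝ) : ℝ :=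
  stepFn s (z.1 + z.2) + stepFn s |z.1 - z.2| - 2 * stepFn s z.1 - 2 * stepFn s z.2

lemma measurable_stepFn : Measurable fun v : ℝ × ℝ => stepFn v.1 v.2 :=
  Measurable.ite (measurableSet_lt measurable_fst measurable_snd) measurable_const measurable_const

lemma measurable_stepDiff : Measurable fun v : ℝ × (ℝ × ℝ) => stepDiff v.1 v.2 := by
  have h (k : ℝ × ℝ → ℝ) (hk : Measurable k) :
      Measurable fun v : ℝ × (ℝ × ℝ) => stepFn v.1 (k v.2) :=
    measurable_stepFn.comp (measurable_fst.prodMk (hk.comp measurable_snd))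
  unfold stepDiff
  exact (((h (fun z => z.1 + z.2) (by fun_prop)).add
    (h (fun z => |z.1 - z.2|) (by fun_prop))).sub
    ((h (fun z => z.1) (by fun_prop)).const_mul 2)).sub
    ((h (fun z => z.2) (by fun_prop)).const_mul 2)

lemma stepFn_mul {s : ℝ} (hs : 0 < s) (z : ℝ) : stepFn s (s * z) = stepFn 1 z := by
  unfold stepFn
  have : s < s * z ↔ 1 < z := by
    constructor
    · intro h; by_contra h'; push Not at h'; nlinarith
    · intro h; nlinarith
  simp only [this]

lemma stepDiff_smul {s : ℝ} (hs : 0 < s) (z : ℝ × ℝ) : stepDiff s (s • z) = stepDiff 1 z := by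
  unfold stepDiff
  simp only [Prod.smul_fst, Prod.smul_snd, smul_eq_mul]
  rw [← mul_add, ← mul_sub, abs_mul, abs_of_pos hs]
  simp only [stepFn_mul hs]

lemma abs_stepDiff_le (s : ℝ) (z : ℝ × ℝ) : |stepDiff s z| ≤ 6 := by
  unfold stepDiff stepFn
  split_ifs <;> norm_num

lemma stepDiff_comm (s x y : ℝ) : stepDiff s (x, y) = stepDiff s (y, x) := by
  simp only [stepDiff, add_comm x y, abs_sub_comm x y]; ring

lemma stepDiff_one_eq_zero {x y : ℝ} (hx : 0 < x) (hy : 0 < y) (hx2 : x < 1 / 2)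
    (h : x < |y - 1|) : stepDiff 1 (x, y) = 0 := by
  unfold stepDiff stepFn
  simp only
  rcases abs_cases (y - 1) with ⟨h1, h2⟩ | ⟨h1, h2⟩ <;> rw [h1] at h
  · have h3 : |x - y| = y - x := by rw [abs_of_neg] <;> linarith
    rw [h3, if_pos (by linarith), if_pos (by linarith), if_neg (by linarith), if_pos (by linarith)]
    norm_num
  · have h3 : |x - y| < 1 := by rw [abs_lt]; constructor <;> linarith
    rw [if_neg (by linarith), if_neg (by linarith), if_neg (by linarith), if_neg (by linarith)]
    norm_num

lemma integrable_stepDiff_one {a b : ℝ} (ha : 0 < a) (ha1 : a < 1) (hb : 0 < b) (hb1 : b < 1) :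
    Integrable (fun z : ℝ × ℝ => stepDiff 1 z * (z.1 ^ (-1 - a) * z.2 ^ (-1 - b)))
      (volPos.prod volPos) := by
  obtain ⟨σ, hσ, hσ1⟩ := exists_between (max_lt ha1 hb1)
  have hσa : a < σ := (le_max_left _ _).trans_lt hσ
  have hσb : b < σ := (le_max_right _ _).trans_lt hσ
  -- one-dimensional building blocks
  have far : ∀ c : ℝ, 0 < c →
      IntegrableOn ((Ici (1 / 2 : ℝ)).indicator fun x => x ^ (-1 - c)) (Ioi 0) := fun c hc => by
    refine IntegrableOn.mono_set ?_ (subset_univ _)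
    rw [integrableOn_univ, integrable_indicator_iff measurableSet_Ici,
      integrableOn_Ici_iff_integrableOn_Ioi]
    exact integrableOn_Ioi_rpow_of_lt (by linarith) (by norm_num)
  have near : ∀ c : ℝ, c < σ →
      IntegrableOn ((Ioo (0 : ℝ) (1 / 2)).indicator fun x => x ^ (σ - 1 - c)) (Ioi 0) :=
    fun c hc => by
    refine IntegrableOn.mono_set ?_ (subset_univ _)
    rw [integrableOn_univ, integrable_indicator_iff measurableSet_Ioo]
    exact (intervalIntegral.integrableOn_Ioo_rpow_iff (by norm_num)).2 (by linarith)
  have one : IntegrableOn ((Icc (1 / 2 : ℝ) (3 / 2)).indicator fun x => |x - 1| ^ (-σ)) (Ioi 0) := by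
    refine IntegrableOn.mono_set ?_ (subset_univ _)
    rw [integrableOn_univ, integrable_indicator_iff measurableSet_Icc]
    have h0 : IntegrableOn (fun x : ℝ => x ^ (-σ)) (Ioo 0 (1 / 2)) :=
      (intervalIntegral.integrableOn_Ioo_rpow_iff (by norm_num)).2 (by linarith)
    have h1 : Integrable ((Ioo (0 : ℝ) (1 / 2)).indicator fun x => x ^ (-σ)) := by
      rwa [integrable_indicator_iff measurableSet_Ioo]
    have h2 : Integrable fun x : ℝ => (Ioo (0 : ℝ) (1 / 2)).indicator (fun x => x ^ (-σ)) (x - 1) +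
        (Ioo (0 : ℝ) (1 / 2)).indicator (fun x => x ^ (-σ)) (1 - x) :=
      (h1.comp_sub_right 1).add (h1.comp_sub_left 1)
    refine (h2.integrableOn (s := Icc (1 / 2) (3 / 2))).congr ?_
    have hne : ∀ᵐ x : ℝ ∂volume, x ≠ 1 ∧ x ≠ 1 / 2 ∧ x ≠ 3 / 2 := by
      have (c : ℝ) : ∀ᵐ x : ℝ ∂volume, x ≠ c := by simp [ae_iff, measure_singleton]
      filter_upwards [this 1, this (1 / 2), this (3 / 2)] with x h1 h2 h3 using ⟨h1, h2, h3⟩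
    filter_upwards [ae_restrict_of_ae hne, ae_restrict_mem measurableSet_Icc] with x ⟨n1, n2, n3⟩ hx
    rcases lt_or_gt_of_ne n1 with h | h
    · have hh : 1 / 2 < x := lt_of_le_of_ne hx.1 n2.symm
      rw [indicator_of_notMem (show x - 1 ∉ Ioo 0 (1 / 2) from fun h' => by linarith [h'.1]),
        indicator_of_mem (show 1 - x ∈ Ioo 0 (1 / 2) from ⟨by linarith, by linarith⟩), abs_of_neg (by linarith), zero_add, neg_sub]
    · have hh : x < 3 / 2 := lt_of_le_of_ne hx.2 n3
      rw [indicator_of_mem (show x - 1 ∈ Ioo 0 (1 / 2) from ⟨by linarith, by linarith⟩),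
        indicator_of_notMem (show 1 - x ∉ Ioo 0 (1 / 2) from fun h' => by linarith [h'.1]),
        abs_of_pos (by linarith), add_zero]
  have d1 := (far a ha).mul_prod (far b hb)
  have d2 := (near a hσa).mul_prod one
  have d3 := (one).mul_prod (near b hσb)
  have hdom := (d1.add (d2.add d3)).const_mul 24
  have hm : Measurable fun z : ℝ × ℝ => stepDiff 1 z * (z.1 ^ (-1 - a) * z.2 ^ (-1 - b)) :=
    (measurable_stepDiff.comp measurable_prodMk_left).mul (by fun_prop)
  have hne : ∀ᵐ z ∂(volPos.prod volPos), z.1 ≠ 1 ∧ z.2 ≠ 1 := by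
    have hone : ∀ᵐ x ∂volPos, x ≠ 1 := ae_restrict_of_ae (by simp [ae_iff, measure_singleton])
    have h1 : ∀ᵐ z ∂(volPos.prod volPos), z.1 ≠ 1 := Measure.quasiMeasurePreserving_fst.ae hone
    have h2 : ∀ᵐ z ∂(volPos.prod volPos), z.2 ≠ 1 := Measure.quasiMeasurePreserving_snd.ae hone
    filter_upwards [h1, h2] with z h1 h2 using ⟨h1, h2⟩
  -- the pointwise bound in the strip near the axes
  have strip : ∀ x y c d : ℝ, 0 < x → x < 1 / 2 → y ≠ 1 → |y - 1| ≤ x → 0 < d → d < 1 →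
      x ^ (-1 - c) * y ^ (-1 - d) ≤ 4 * (x ^ (σ - 1 - c) * |y - 1| ^ (-σ)) := by
    intro x y c d hx hx2 hy1 hyx hd hd1
    have hpos : 0 < |y - 1| := abs_pos.2 (sub_ne_zero.2 hy1)
    have hy : 1 / 2 < y := by rw [abs_le] at hyx; linarith
    have e1 : y ^ (-1 - d) ≤ 4 := by
      calc y ^ (-1 - d) ≤ (1 / 2 : ℝ) ^ (-1 - d) :=
            Real.rpow_le_rpow_of_nonpos (by norm_num) hy.le (by linarith)
        _ ≤ (1 / 2 : ℝ) ^ (-2 : ℝ) :=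
            Real.rpow_le_rpow_of_exponent_ge (by norm_num) (by norm_num) (by linarith)
        _ = 4 := by rw [Real.rpow_neg (by norm_num)]; norm_num
    have e2 : 1 ≤ x ^ σ * |y - 1| ^ (-σ) := by
      rw [Real.rpow_neg hpos.le, ← div_eq_mul_inv, one_le_div (by positivity)]
      exact Real.rpow_le_rpow hpos.le hyx (by linarith)
    have e3 : x ^ (σ - 1 - c) = x ^ (-1 - c) * x ^ σ := by
      rw [← Real.rpow_add hx]; congr 1; ring
    have e4 : 0 < x ^ (-1 - c) := by positivity
    rw [e3]
    calc x ^ (-1 - c) * y ^ (-1 - d) ≤ x ^ (-1 - c) * 4 := by gcongr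
      _ ≤ x ^ (-1 - c) * (4 * (x ^ σ * |y - 1| ^ (-σ))) := by gcongr; linarith
      _ = _ := by ring
  refine hdom.mono' hm.aestronglyMeasurable ?_
  filter_upwards [ae_volPos_prod_pos, hne] with z hz hz1
  obtain ⟨x, y⟩ := z
  obtain ⟨hx, hy⟩ : 0 < x ∧ 0 < y := hz
  obtain ⟨hx1, hy1⟩ : x ≠ 1 ∧ y ≠ 1 := hz1
  simp only [Pi.add_apply]
  have n1 : ∀ u v : ℝ, 0 ≤ (Ici (1 / 2 : ℝ)).indicator (fun x => x ^ (-1 - a)) u *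
      (Ici (1 / 2 : ℝ)).indicator (fun x => x ^ (-1 - b)) v := fun u v => by
    refine mul_nonneg (indicator_nonneg (fun w hw => ?_) _) (indicator_nonneg (fun w hw => ?_) _) <;>
    · have : (0 : ℝ) ≤ w := le_trans (by norm_num) hw
      positivity
  have n2 : ∀ c u v : ℝ, 0 ≤ (Ioo (0 : ℝ) (1 / 2)).indicator (fun x => x ^ (σ - 1 - c)) u *
      (Icc (1 / 2 : ℝ) (3 / 2)).indicator (fun x => |x - 1| ^ (-σ)) v := fun c u v => by
    refine mul_nonneg (indicator_nonneg (fun w hw => ?_) _) (indicator_nonneg (fun w hw => ?_) _)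
    · have : 0 < w := hw.1
      positivity
    · positivity
  have m1 := n1 x y
  have m2 := n2 a x y
  have m3 := n2 b y x
  rw [mul_comm] at m3
  have hX : 0 < x ^ (-1 - a) := by positivity
  have hY : 0 < y ^ (-1 - b) := by positivity
  have h6 : |stepDiff 1 (x, y) * (x ^ (-1 - a) * y ^ (-1 - b))| ≤
      6 * (x ^ (-1 - a) * y ^ (-1 - b)) := by
    rw [abs_mul, abs_of_pos (mul_pos hX hY)]
    exact mul_le_mul_of_nonneg_right (abs_stepDiff_le _ _) (by positivity)
  rw [Real.norm_eq_abs]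
  rcases lt_or_ge x (1 / 2) with hx2 | hx2
  · rcases lt_or_ge x |y - 1| with h | h
    · rw [stepDiff_one_eq_zero hx hy hx2 h, zero_mul, abs_zero]
      linarith
    · have hst := strip x y a b hx hx2 hy1 h hb hb1
      have h' := h
      rw [abs_le] at h'
      rw [indicator_of_mem (show x ∈ Ioo 0 (1 / 2) from ⟨hx, hx2⟩),
        indicator_of_mem (show y ∈ Icc (1 / 2) (3 / 2) from ⟨by linarith, by linarith⟩)]
      linarith
  · rcases lt_or_ge y (1 / 2) with hy2 | hy2
    · rcases lt_or_ge y |x - 1| with h | h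
      · rw [stepDiff_comm, stepDiff_one_eq_zero hy hx hy2 h, zero_mul, abs_zero]
        linarith
      · have hst := strip y x b a hy hy2 hx1 h ha ha1
        have h' := h
        rw [abs_le] at h'
        rw [indicator_of_mem (show y ∈ Ioo 0 (1 / 2) from ⟨hy, hy2⟩),
          indicator_of_mem (show x ∈ Icc (1 / 2) (3 / 2) from ⟨by linarith, by linarith⟩)]
        linarith
    · rw [indicator_of_mem (show x ∈ Ici (1 / 2) from hx2),
        indicator_of_mem (show y ∈ Ici (1 / 2) from hy2)] at *
      have : 0 < x ^ (-1 - a) * y ^ (-1 - b) := by positivity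
      linarith

lemma indicator_quadrant_comp_smul {s : ℝ} (hs : 0 < s) (h : ℝ × ℝ → ℝ) (z : ℝ × ℝ) :
    (Ioi (0 : ℝ) ×ˢ Ioi (0 : ℝ)).indicator (fun z => h (s • z)) z =
      (Ioi (0 : ℝ) ×ˢ Ioi (0 : ℝ)).indicator h (s • z) := by
  have : s • z ∈ Ioi (0 : ℝ) ×ˢ Ioi (0 : ℝ) ↔ z ∈ Ioi (0 : ℝ) ×ˢ Ioi (0 : ℝ) := by
    simp [mem_prod, hs]
  simp only [indicator, this]

lemma integrable_quadrant_comp_smul {s : ℝ} (hs : 0 < s) {h : ℝ × ℝ → ℝ} :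
    Integrable (fun z => h (s • z)) (volPos.prod volPos) ↔ Integrable h (volPos.prod volPos) := by
  rw [Measure.prod_restrict, ← IntegrableOn, ← IntegrableOn,
    ← integrable_indicator_iff (measurableSet_Ioi.prod measurableSet_Ioi),
    ← integrable_indicator_iff (measurableSet_Ioi.prod measurableSet_Ioi),
    ← integrable_comp_smul_iff (volume.prod volume) ((Ioi (0 : ℝ) ×ˢ Ioi (0 : ℝ)).indicator h)
      hs.ne']
  simp only [← indicator_quadrant_comp_smul hs h]

lemma integral_quadrant_comp_smul {s : ℝ} (hs : 0 < s) (h : ℝ × ℝ → ℝ) :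
    ∫ z, h z ∂(volPos.prod volPos) = s ^ 2 * ∫ z, h (s • z) ∂(volPos.prod volPos) := by
  rw [Measure.prod_restrict, ← integral_indicator (measurableSet_Ioi.prod measurableSet_Ioi),
    ← integral_indicator (measurableSet_Ioi.prod measurableSet_Ioi)]
  simp only [indicator_quadrant_comp_smul hs h]
  rw [Measure.integral_comp_smul]
  have : Module.finrank ℝ (ℝ × ℝ) = 2 := by simp
  rw [this, abs_of_pos (by positivity), smul_eq_mul, ← mul_assoc, mul_inv_cancel₀ (by positivity),
    one_mul]

/-- The weighted second difference of the step function. -/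
noncomputable def stepKer (a b s : ℝ) (z : ℝ × ℝ) : ℝ :=
  stepDiff s z * (z.1 ^ (-1 - a) * z.2 ^ (-1 - b))

lemma measurable_stepKer (a b : ℝ) : Measurable fun v : ℝ × (ℝ × ℝ) => stepKer a b v.1 v.2 :=
  measurable_stepDiff.mul (by fun_prop)

lemma stepKer_smul {a b s : ℝ} (hs : 0 < s) {z : ℝ × ℝ} (hz : 0 < z.1 ∧ 0 < z.2) :
    stepKer a b s (s • z) = s ^ (-2 - (a + b)) * stepKer a b 1 z := by
  have e : s ^ (-2 - (a + b)) = s ^ (-1 - a) * s ^ (-1 - b) := by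
    rw [← Real.rpow_add hs]; congr 1; ring
  unfold stepKer
  rw [stepDiff_smul hs, e, Prod.smul_fst, Prod.smul_snd, smul_eq_mul, smul_eq_mul,
    Real.mul_rpow hs.le hz.1.le, Real.mul_rpow hs.le hz.2.le]
  ring

lemma integrable_stepKer {a b s : ℝ} (ha : 0 < a) (ha1 : a < 1) (hb : 0 < b) (hb1 : b < 1)
    (hs : 0 < s) : Integrable (stepKer a b s) (volPos.prod volPos) := by
  rw [← integrable_quadrant_comp_smul hs]
  refine ((integrable_stepDiff_one ha ha1 hb hb1).const_mul (s ^ (-2 - (a + b)))).congr ?_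
  filter_upwards [ae_volPos_prod_pos] with z hz
  rw [stepKer_smul hs hz]; rfl

lemma integral_comp_stepKer {a b s : ℝ} (hs : 0 < s) (φ : ℝ → ℝ)
    (hφ : ∀ c x, 0 < c → φ (c * x) = c * φ x) :
    ∫ z, φ (stepKer a b s z) ∂(volPos.prod volPos) =
      s ^ (-(a + b)) * ∫ z, φ (stepKer a b 1 z) ∂(volPos.prod volPos) := by
  rw [integral_quadrant_comp_smul hs]
  have : ∫ z, φ (stepKer a b s (s • z)) ∂(volPos.prod volPos) =
      s ^ (-2 - (a + b)) * ∫ z, φ (stepKer a b 1 z) ∂(volPos.prod volPos) := by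
    rw [← integral_const_mul]
    refine integral_congr_ae ?_
    filter_upwards [ae_volPos_prod_pos] with z hz
    rw [stepKer_smul hs hz, hφ _ _ (by positivity)]
  rw [this, ← mul_assoc, ← Real.rpow_natCast, ← Real.rpow_add hs]
  congr 2; push_cast; ring

/-- The constant in front of the dissipative term. -/
noncomputable def stepConst (a b : ℝ) : ℝ := ∫ z, stepKer a b 1 z ∂(volPos.prod volPos)

lemma integrable_mul_stepKer {a b : ℝ} {p : ℝ → ℝ} (ha : 0 < a) (ha1 : a < 1) (hb : 0 < b)
    (hb1 : b < 1) (hp : Measurable p)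
    (hi : IntegrableOn (fun s => p s * s ^ (-(a + b))) (Ioi 0)) :
    Integrable (fun v : ℝ × (ℝ × ℝ) => p v.1 * stepKer a b v.1 v.2)
      (volPos.prod (volPos.prod volPos)) := by
  have hm : Measurable fun v : ℝ × (ℝ × ℝ) => p v.1 * stepKer a b v.1 v.2 :=
    (hp.comp measurable_fst).mul (measurable_stepKer a b)
  rw [integrable_prod_iff hm.aestronglyMeasurable]
  constructor
  · filter_upwards [ae_restrict_mem measurableSet_Ioi] with s hs
    exact (integrable_stepKer ha ha1 hb hb1 hs).const_mul _
  · refine (hi.norm.mul_const (∫ z, |stepKer a b 1 z| ∂(volPos.prod volPos))).congr ?_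
    filter_upwards [ae_restrict_mem measurableSet_Ioi] with s hs
    have hs0 : 0 < s := hs
    simp only [norm_mul]
    rw [integral_const_mul]
    simp only [Real.norm_eq_abs]
    rw [integral_comp_stepKer hs0 (fun x => |x|) fun c x hc => by rw [abs_mul, abs_of_pos hc],
      abs_of_nonneg (Real.rpow_nonneg hs0.le _)]
    ring

/-- The difference of the fractional dissipation of an even function as a second difference. -/
lemma fracDiss_sub_fracDiss_zero {β : ℝ} (h0 : 0 < β) (h1 : β < 1 / 2) {f : ℝ → ℝ} {M : ℝ}
    (hc : Continuous f) (hlip : ∀ x y, |f x - f (x + y)| ≤ 2 * M * min 1 |y|)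
    (heven : ∀ x, f (-x) = f x) (x : ℝ) :
    fracDiss β f x - fracDiss β f 0 = ∫ y in Ioi 0,
      ((f 0 - f (x + y)) + (f 0 - f |x - y|) - 2 * (f 0 - f x) - 2 * (f 0 - f y)) *
        y ^ (-1 - 2 * β) := by
  have key : ∀ x, IntegrableOn (fun y => (2 * f x - f (x + y) - f (x - y)) * y ^ (-1 - 2 * β))
      (Ioi 0) ∧ fracDiss β f x =
      ∫ y in Ioi 0, (2 * f x - f (x + y) - f (x - y)) * y ^ (-1 - 2 * β) := by
    intro x
    have hi := integrable_fracDiss_integrand h0 h1 hc hlip x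
    have e : EqOn (fun y => (f x - f (x + y)) / |y| ^ (1 + 2 * β) +
        (f x - f (x + -y)) / |(-y)| ^ (1 + 2 * β))
        (fun y => (2 * f x - f (x + y) - f (x - y)) * y ^ (-1 - 2 * β)) (Ioi 0) := fun y hy => by
      have hy0 : 0 < y := hy
      simp only [abs_neg, abs_of_pos hy0]
      rw [show -1 - 2 * β = -(1 + 2 * β) by ring, Real.rpow_neg hy0.le, ← sub_eq_add_neg]
      ring
    have i2 : IntegrableOn (fun y => (f x - f (x + y)) / |y| ^ (1 + 2 * β) +
        (f x - f (x + -y)) / |(-y)| ^ (1 + 2 * β)) (Ioi 0) :=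
      hi.integrableOn.add hi.comp_neg.integrableOn
    refine ⟨i2.congr_fun e measurableSet_Ioi, ?_⟩
    rw [← setIntegral_congr_fun measurableSet_Ioi e,
      integral_add hi.integrableOn hi.comp_neg.integrableOn,
      integral_comp_neg_Ioi 0 fun y => (f x - f (x + y)) / |y| ^ (1 + 2 * β), neg_zero, fracDiss,
      ← intervalIntegral.integral_Iic_add_Ioi hi.integrableOn hi.integrableOn, add_comm]
  rw [(key x).2, (key 0).2, ← integral_sub (key x).1 (key 0).1]
  refine setIntegral_congr_fun measurableSet_Ioi fun y hy => ?_
  have e1 : f |x - y| = f (x - y) := by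
    rcases abs_cases (x - y) with ⟨h, _⟩ | ⟨h, _⟩ <;> rw [h]
    exact heven _
  have e2 : f (0 - y) = f y := by rw [zero_sub, heven]
  simp only [e1, e2, zero_add]
  ring

/-- The weighted integral of the dissipation of an even function. -/
lemma integral_fracDiss_sub {β δ : ℝ} (h0 : 0 < β) (h1 : β < 1 / 2) (hδ : 0 < δ) (hδ1 : δ < 1)
    {f f' : ℝ → ℝ} {M : ℝ} (hf : ∀ x, HasDerivAt f (f' x) x) (hc' : Continuous f')
    (hlip : ∀ x y, |f x - f (x + y)| ≤ 2 * M * min 1 |y|) (heven : ∀ x, f (-x) = f x)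
    (hi : IntegrableOn (fun s => -f' s * s ^ (-(δ + 2 * β))) (Ioi 0)) :
    ∫ x in Ioi 0, (fracDiss β f x - fracDiss β f 0) * x ^ (-1 - δ) =
      stepConst δ (2 * β) * ∫ s in Ioi 0, -f' s * s ^ (-(δ + 2 * β)) := by
  have hc : Continuous f := continuous_iff_continuousAt.2 fun x => (hf x).continuousAt
  have hI := integrable_mul_stepKer hδ hδ1 (b := 2 * β) (by linarith) (by linarith)
    (p := fun s => -f' s) hc'.neg.measurable hi
  have hstep : ∀ z, 0 ≤ z → Integrable (fun s => -f' s * stepFn s z) volPos ∧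
      ∫ s in Ioi 0, -f' s * stepFn s z = f 0 - f z := by
    intro z hz
    have e : (fun s => -f' s * stepFn s z) = (Iio z).indicator fun s => -f' s := by
      ext s
      by_cases h : s < z
      · rw [indicator_of_mem (show s ∈ Iio z from h)]; simp [stepFn, h]
      · rw [indicator_of_notMem (show s ∉ Iio z from h)]; simp [stepFn, h]
    rw [e, integrable_indicator_iff measurableSet_Iio, IntegrableOn,
      Measure.restrict_restrict measurableSet_Iio,
      setIntegral_indicator measurableSet_Iio, inter_comm, Ioi_inter_Iio,
      ← integral_Ioc_eq_integral_Ioo, ← intervalIntegral.integral_of_le hz]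
    constructor
    · exact (hc'.neg.integrableOn_Icc (a := 0) (b := z)).mono_set Ioo_subset_Icc_self
    · rw [intervalIntegral.integral_neg, intervalIntegral.integral_eq_sub_of_hasDerivAt
        (fun s _ => hf s) (hc'.intervalIntegrable _ _)]
      ring
  have hinner : ∀ x y : ℝ, 0 < x → 0 < y →
      ∫ s in Ioi 0, -f' s * stepKer δ (2 * β) s (x, y) =
      ((f 0 - f (x + y)) + (f 0 - f |x - y|) - 2 * (f 0 - f x) - 2 * (f 0 - f y)) *
        (x ^ (-1 - δ) * y ^ (-1 - 2 * β)) := by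
    intro x y hx hy
    obtain ⟨i1, v1⟩ := hstep (x + y) (by linarith)
    obtain ⟨i2, v2⟩ := hstep |x - y| (abs_nonneg _)
    obtain ⟨i3, v3⟩ := hstep x hx.le
    obtain ⟨i4, v4⟩ := hstep y hy.le
    have i12 : Integrable (fun s => -f' s * stepFn s (x + y) + -f' s * stepFn s |x - y|) volPos :=
      i1.add i2
    have i123 : Integrable (fun s => -f' s * stepFn s (x + y) + -f' s * stepFn s |x - y| -
      2 * (-f' s * stepFn s x)) volPos := i12.sub (i3.const_mul 2)
    rw [← v1, ← v2, ← v3, ← v4, ← integral_const_mul, ← integral_const_mul, ← integral_add i1 i2,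
      ← integral_sub i12 (i3.const_mul 2), ← integral_sub i123 (i4.const_mul 2),
      ← integral_mul_const]
    congr 1; ext s; simp only [stepKer, stepDiff]; ring
  have hsw := integral_integral_swap
    (f := fun (s : ℝ) (z : ℝ × ℝ) => -f' s * stepKer δ (2 * β) s z) hI
  have hleft : ∫ s, (∫ z, -f' s * stepKer δ (2 * β) s z ∂(volPos.prod volPos)) ∂volPos =
      stepConst δ (2 * β) * ∫ s in Ioi 0, -f' s * s ^ (-(δ + 2 * β)) := by
    rw [← integral_const_mul]
    refine setIntegral_congr_fun measurableSet_Ioi fun s hs => ?_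
    rw [integral_const_mul, integral_comp_stepKer hs (fun x => x) fun c x _ => rfl, stepConst]
    ring
  rw [← hleft, hsw]
  have hI2 : Integrable (fun z => ∫ s in Ioi 0, -f' s * stepKer δ (2 * β) s z)
    (volPos.prod volPos) := hI.integral_prod_right
  rw [integral_prod _ hI2]
  refine setIntegral_congr_fun measurableSet_Ioi fun x hx => ?_
  have hx0 : 0 < x := hx
  rw [fracDiss_sub_fracDiss_zero h0 h1 hc hlip heven x, ← integral_mul_const]
  refine setIntegral_congr_fun measurableSet_Ioi fun y hy => ?_
  rw [hinner x y hx0 hy]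
  ring

lemma integral_rpow_mul_primitive {q : ℝ → ℝ} {c : ℝ} (hq : Measurable q) (hc : 0 < c)
    (hi : IntegrableOn (fun s => q s * s ^ (-c)) (Ioi 0)) :
    IntegrableOn (fun z : ℝ => z ^ (-1 - c) * ∫ s in Ioo 0 z, q s) (Ioi 0) ∧
    ∫ z in Ioi 0, z ^ (-1 - c) * ∫ s in Ioo 0 z, q s = c⁻¹ * ∫ s in Ioi 0, q s * s ^ (-c) := by
  set G : ℝ × ℝ → ℝ := {v : ℝ × ℝ | v.1 < v.2}.indicator fun v => q v.1 * v.2 ^ (-1 - c) with hG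
  have hGm : Measurable G := by
    refine Measurable.indicator ?_ (measurableSet_lt measurable_fst measurable_snd)
    fun_prop
  have hsec : ∀ s z, G (s, z) = (Ioi s).indicator (fun z => q s * z ^ (-1 - c)) z := fun s z => by
    simp only [hG, indicator]; rfl
  have hsec' : ∀ s z, G (s, z) = z ^ (-1 - c) * (Iio z).indicator q s := fun s z => by
    simp only [hG, indicator, mul_ite, mul_zero]
    rw [mul_comm]; rfl
  have hint : ∀ s : ℝ, 0 < s → ∀ A : ℝ,
      ∫ z in Ioi 0, (Ioi s).indicator (fun z => A * z ^ (-1 - c)) z = A * (s ^ (-c) / c) := by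
    intro s hs A
    rw [setIntegral_indicator measurableSet_Ioi, Ioi_inter_Ioi, max_eq_right hs.le,
      integral_const_mul, integral_Ioi_rpow_of_lt (by linarith) hs]
    rw [show -1 - c + 1 = -c by ring, neg_div_neg_eq]
  have hGi : Integrable G (volPos.prod volPos) := by
    rw [integrable_prod_iff hGm.aestronglyMeasurable]
    constructor
    · filter_upwards [ae_restrict_mem measurableSet_Ioi] with s hs
      simp only [hsec]
      refine Integrable.mono_measure ?_ Measure.restrict_le_self
      rw [integrable_indicator_iff measurableSet_Ioi]
      exact (integrableOn_Ioi_rpow_of_lt (by linarith) hs).const_mul _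
    · refine (hi.norm.const_mul c⁻¹).congr ?_
      filter_upwards [ae_restrict_mem measurableSet_Ioi] with s hs
      have hs0 : 0 < s := hs
      have e : ∀ z, ‖G (s, z)‖ = (Ioi s).indicator (fun z => |q s| * z ^ (-1 - c)) z := fun z => by
        rw [hsec, norm_indicator_eq_indicator_norm]
        simp only [indicator]
        split_ifs with h
        · have hz : 0 < z := hs0.trans h
          rw [norm_mul, Real.norm_eq_abs, Real.norm_eq_abs, abs_of_nonneg (Real.rpow_nonneg hz.le _)]
        · rfl
      simp only [e]
      rw [hint s hs0, norm_mul, Real.norm_eq_abs, Real.norm_eq_abs,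
        abs_of_nonneg (Real.rpow_nonneg hs0.le _)]
      ring
  have hval : ∀ z : ℝ, ∫ s in Ioi 0, G (s, z) = z ^ (-1 - c) * ∫ s in Ioo 0 z, q s := fun z => by
    simp only [hsec']
    rw [integral_const_mul, setIntegral_indicator measurableSet_Iio, Ioi_inter_Iio]
  have h1 := hGi.integral_prod_right
  simp only [hval] at h1
  refine ⟨h1, ?_⟩
  have h2 := integral_integral_swap (f := fun s z => G (s, z)) hGi
  simp only [hval] at h2
  rw [← h2, ← integral_const_mul]
  refine setIntegral_congr_fun measurableSet_Ioi fun s hs => ?_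
  simp only [hsec]
  rw [hint s hs]
  ring

/-- Integrability against a power weight from a linear bound near the origin and a bound at
infinity. -/
lemma integrableOn_Ioi_of_bounds {F : ℝ → ℝ} {B r : ℝ} {G : ℝ → ℝ} (hF : Measurable F)
    (hr : -1 < r) (h0 : ∀ x, 0 < x → x < 1 → |F x| ≤ B * x ^ r)
    (hG : IntegrableOn G (Ici 1)) (h1 : ∀ x, 1 ≤ x → |F x| ≤ G x) :
    IntegrableOn F (Ioi 0) := by
  have hu : Ioi (0 : ℝ) = Ioo 0 1 ∪ Ici 1 := (Ioo_union_Ici_eq_Ioi one_pos).symm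
  rw [hu, integrableOn_union]
  constructor
  · refine (((intervalIntegral.integrableOn_Ioo_rpow_iff one_pos).2 hr).const_mul B).mono'
      hF.aestronglyMeasurable ?_
    filter_upwards [ae_restrict_mem measurableSet_Ioo] with x hx using h0 x hx.1 hx.2
  · refine hG.mono' hF.aestronglyMeasurable ?_
    filter_upwards [ae_restrict_mem measurableSet_Ici] with x hx using h1 x hx

/-- Interpolation of a weighted first moment by a weighted square. -/
lemma abs_integral_rpow_mul_le {P : ℝ → ℝ} {δ τ l : ℝ} (hl : 0 < l) (hτ : 0 < τ)
    (hδτ : 0 < 1 + δ - 2 * τ) (hP : ∀ z, 1 ≤ z → |P z| ≤ 4 * z)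
    (hD : IntegrableOn (fun z : ℝ => z ^ (-4 - δ) * P z ^ 2) (Ioi 0))
    (hi : IntegrableOn (fun z : ℝ => z ^ (-2 - τ) * P z) (Ioi 0)) :
    |∫ z in Ioi 0, z ^ (-2 - τ) * P z| ≤ l / 2 * (∫ z in Ioi 0, z ^ (-4 - δ) * P z ^ 2) +
      (2 * l * (1 + δ - 2 * τ))⁻¹ + 4 / τ := by
  have hu : Ioi (0 : ℝ) = Ioc 0 1 ∪ Ioi 1 := (Ioc_union_Ioi_eq_Ioi zero_le_one).symm
  have hdis : Disjoint (Ioc (0 : ℝ) 1) (Ioi 1) := by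
    rw [Set.disjoint_left]; intro x hx hx'; exact absurd hx.2 (not_le.2 hx')
  have hs1 : Ioc (0 : ℝ) 1 ⊆ Ioi 0 := fun x hx => hx.1
  have hs2 : Ioi (1 : ℝ) ⊆ Ioi 0 := Ioi_subset_Ioi zero_le_one
  have hsplit : ∫ z in Ioi 0, z ^ (-2 - τ) * P z =
      (∫ z in Ioc 0 1, z ^ (-2 - τ) * P z) + ∫ z in Ioi 1, z ^ (-2 - τ) * P z := by
    conv_lhs => rw [hu]
    exact setIntegral_union hdis measurableSet_Ioi (hi.mono_set hs1) (hi.mono_set hs2)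
  have hr : IntegrableOn (fun z : ℝ => z ^ (δ - 2 * τ)) (Ioc 0 1) := by
    rw [integrableOn_Ioc_iff_integrableOn_Ioo]
    exact (intervalIntegral.integrableOn_Ioo_rpow_iff one_pos).2 (by linarith)
  have b1 : |∫ z in Ioc 0 1, z ^ (-2 - τ) * P z| ≤
      l / 2 * (∫ z in Ioi 0, z ^ (-4 - δ) * P z ^ 2) + (2 * l * (1 + δ - 2 * τ))⁻¹ := by
    calc |∫ z in Ioc 0 1, z ^ (-2 - τ) * P z|
        ≤ ∫ z in Ioc 0 1, (l / 2 * (z ^ (-4 - δ) * P z ^ 2) + (2 * l)⁻¹ * z ^ (δ - 2 * τ)) := by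
          rw [← Real.norm_eq_abs]
          refine norm_integral_le_of_norm_le
            (((hD.mono_set hs1).const_mul (l / 2)).add (hr.const_mul (2 * l)⁻¹)) ?_
          filter_upwards [ae_restrict_mem measurableSet_Ioc] with z hz
          have hz0 : 0 < z := hz.1
          set A := z ^ (-2 - δ / 2) with hA
          set Bz := z ^ (δ / 2 - τ) with hBz
          have e1 : z ^ (-2 - τ) = A * Bz := by
            rw [hA, hBz, ← Real.rpow_add hz0]; congr 1; ring
          have e2 : z ^ (-4 - δ) = A ^ 2 := by
            rw [hA, ← Real.rpow_natCast, ← Real.rpow_mul hz0.le]; congr 1; push_cast; ring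
          have e3 : z ^ (δ - 2 * τ) = Bz ^ 2 := by
            rw [hBz, ← Real.rpow_natCast, ← Real.rpow_mul hz0.le]; congr 1; push_cast; ring
          have hB0 : 0 < Bz := by positivity
          have hA0 : 0 < A := by positivity
          rw [e1, e2, e3, Real.norm_eq_abs, abs_mul, abs_of_pos (mul_pos hA0 hB0), ← sq_abs (P z)]
          have h1 : 0 ≤ (2 * l)⁻¹ * (l * (A * |P z|) - Bz) ^ 2 := by positivity
          have h2 : (2 * l)⁻¹ * (l * (A * |P z|) - Bz) ^ 2 = l / 2 * (A ^ 2 * |P z| ^ 2) +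
              (2 * l)⁻¹ * Bz ^ 2 - A * Bz * |P z| := by
            field_simp; ring
          linarith
      _ = l / 2 * (∫ z in Ioc 0 1, z ^ (-4 - δ) * P z ^ 2) +
          (2 * l)⁻¹ * ∫ z in Ioc (0 : ℝ) 1, z ^ (δ - 2 * τ) := by
          rw [integral_add ((hD.mono_set hs1).const_mul (l / 2)) (hr.const_mul (2 * l)⁻¹),
            integral_const_mul, integral_const_mul]
      _ ≤ _ := by
          have i1 : ∫ z in Ioc (0 : ℝ) 1, z ^ (δ - 2 * τ) = (1 + δ - 2 * τ)⁻¹ := by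
            rw [← intervalIntegral.integral_of_le zero_le_one, integral_rpow (Or.inl (by linarith)),
              Real.one_rpow, Real.zero_rpow (by linarith), sub_zero, one_div]
            congr 1; ring
          have i2 : ∫ z in Ioc 0 1, z ^ (-4 - δ) * P z ^ 2 ≤
              ∫ z in Ioi 0, z ^ (-4 - δ) * P z ^ 2 := by
            refine setIntegral_mono_set hD ?_ (Eventually.of_forall hs1)
            filter_upwards [ae_restrict_mem measurableSet_Ioi] with z hz
            have hz0 : 0 < z := hz
            simp only [Pi.zero_apply]
            positivity
          rw [i1, mul_inv (2 * l)]
          gcongr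
  have b2 : |∫ z in Ioi 1, z ^ (-2 - τ) * P z| ≤ 4 / τ := by
    calc |∫ z in Ioi 1, z ^ (-2 - τ) * P z| ≤ ∫ z in Ioi (1 : ℝ), 4 * z ^ (-1 - τ) := by
          rw [← Real.norm_eq_abs]
          refine norm_integral_le_of_norm_le
            ((integrableOn_Ioi_rpow_of_lt (show -1 - τ < -1 by linarith) one_pos).const_mul 4) ?_
          filter_upwards [ae_restrict_mem measurableSet_Ioi] with z hz
          have hz1 : 1 < z := hz
          have hz0 : 0 < z := by linarith
          have e : z ^ (-1 - τ) = z ^ (-2 - τ) * z := by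
            rw [← Real.rpow_add_one hz0.ne']; congr 1; ring
          have hA0 : 0 < z ^ (-2 - τ) := by positivity
          rw [Real.norm_eq_abs, abs_mul, abs_of_pos hA0, e]
          have := mul_le_mul_of_nonneg_left (hP z hz1.le) hA0.le
          linarith
      _ = 4 / τ := by
          rw [integral_const_mul, integral_Ioi_rpow_of_lt (by linarith) one_pos, Real.one_rpow,
            show -1 - τ + 1 = -τ by ring, neg_div_neg_eq]
          ring
  rw [hsplit]
  exact (abs_add_le _ _).trans (by linarith)

lemma slice_estimates {β δ B : ℝ} {f f' h : ℝ → ℝ} (h0 : 0 < β) (hδ : 0 < δ)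
    (hβδ : δ + 4 * β < 1) (hβδ' : 1 < 2 * δ + 4 * β)
    (hf : ∀ x, HasDerivAt f (f' x) x) (hc' : Continuous f') (hb : ∀ x, |f x| ≤ 1) (hB : 1 ≤ B)
    (hb' : ∀ x, |f' x| ≤ B) (heven : ∀ x, f (-x) = f x) (hi : Integrable fun x => f' x ^ 2)
    (hh : ∀ x, Tendsto (fun R => ∫ y in (0 : ℝ)..R, symmQuot f x y) atTop (𝓝 (h x))) :
    ∃ D, (3 + δ) * D ≤ (∫ x in Ioi 0, h x * -f' x * x ^ (-1 - δ)) ∧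
      (∀ l, 0 < l → |∫ x in Ioi 0, (fracDiss β f x - fracDiss β f 0) * x ^ (-1 - δ)| ≤
        |stepConst δ (2 * β)| * (1 + (δ + 2 * β)) *
          (l / 2 * D + (2 * l * (1 + δ - 2 * (δ + 2 * β)))⁻¹ + 4 / (δ + 2 * β))) ∧
      (∀ l, 0 < l → δ / (1 + δ) * (∫ x in Ioi 0, (f 0 - f x) * x ^ (-1 - δ)) ≤
        l / 2 * D + (2 * l * (1 + δ - 2 * δ))⁻¹ + 4 / δ) := by
  have hc : Continuous f := continuous_iff_continuousAt.2 fun x => (hf x).continuousAt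
  set τ := δ + 2 * β with hτ
  set P : ℝ → ℝ := fun z => ∫ x in Ioo 0 z, -f' x * x with hP
  have hm' : Measurable f' := hc'.measurable
  have hm : Measurable f := hc.measurable
  have hlip := abs_sub_add_le_min hf (fun x => (hb x).trans hB) hb'
  have hg : ∀ x, 0 < x → |f 0 - f x| ≤ B * x := fun x hx => by
    have := abs_sub_le_of_hasDerivAt hf hb' 0 x
    rwa [zero_sub, abs_neg, abs_of_pos hx] at this
  have hg2 : ∀ x, |f 0 - f x| ≤ 2 := fun x => by
    have := abs_sub (f 0) (f x)
    linarith [hb 0, hb x]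
  have i_sq : IntegrableOn (fun x => f' x ^ 2 * x ^ (-δ)) (Ioi 0) := by
    refine integrableOn_Ioi_of_bounds (B := B ^ 2) (r := -δ) (by fun_prop) (by linarith)
      (fun x hx _ => ?_) hi.integrableOn fun x hx => ?_
    · have : 0 < x ^ (-δ) := by positivity
      rw [abs_mul, abs_of_pos this, abs_sq, ← sq_abs]
      gcongr
      exact hb' x
    · have h1 : x ^ (-δ) ≤ 1 := Real.rpow_le_one_of_one_le_of_nonpos hx (by linarith)
      have h2 : 0 ≤ x ^ (-δ) := Real.rpow_nonneg (by linarith) _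
      rw [abs_mul, abs_of_nonneg h2, abs_sq]
      nlinarith [sq_nonneg (f' x)]
  have i_tau : IntegrableOn (fun s => -f' s * s ^ (-τ)) (Ioi 0) := by
    have hpow : IntegrableOn (fun s : ℝ => s ^ (-2 * τ)) (Ici 1) := by
      rw [integrableOn_Ici_iff_integrableOn_Ioi]
      exact integrableOn_Ioi_rpow_of_lt (by linarith) one_pos
    refine integrableOn_Ioi_of_bounds (B := B) (r := -τ) (by fun_prop) (by linarith)
      (fun x hx _ => ?_) (hi.integrableOn.add hpow) fun x hx => ?_
    · have : 0 < x ^ (-τ) := by positivity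
      rw [abs_mul, abs_of_pos this, abs_neg]
      gcongr
      exact hb' x
    · have hx0 : 0 < x := by linarith
      have h2 : 0 < x ^ (-τ) := by positivity
      have h3 : x ^ (-2 * τ) = (x ^ (-τ)) ^ 2 := by
        rw [← Real.rpow_natCast, ← Real.rpow_mul hx0.le]; congr 1; push_cast; ring
      simp only [Pi.add_apply]
      rw [abs_mul, abs_of_pos h2, abs_neg, h3, ← sq_abs (f' x)]
      nlinarith [sq_nonneg (|f' x| - x ^ (-τ)), sq_nonneg |f' x|, sq_nonneg (x ^ (-τ))]
  have i_g : IntegrableOn (fun x => (f 0 - f x) * x ^ (-1 - δ)) (Ioi 0) := by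
    have hpow : IntegrableOn (fun s : ℝ => 2 * s ^ (-1 - δ)) (Ici 1) := by
      rw [integrableOn_Ici_iff_integrableOn_Ioi]
      exact (integrableOn_Ioi_rpow_of_lt (by linarith) one_pos).const_mul 2
    refine integrableOn_Ioi_of_bounds (B := B) (r := -δ) (by fun_prop) (by linarith)
      (fun x hx _ => ?_) hpow fun x hx => ?_
    · have h2 : 0 < x ^ (-1 - δ) := by positivity
      have h3 : x ^ (-δ) = x * x ^ (-1 - δ) := by
        rw [mul_comm, ← Real.rpow_add_one hx.ne']; congr 1; ring
      rw [abs_mul, abs_of_pos h2, h3, ← mul_assoc]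
      gcongr
      exact hg x hx
    · have hx0 : 0 < x := by linarith
      have h2 : 0 < x ^ (-1 - δ) := by positivity
      rw [abs_mul, abs_of_pos h2]
      gcongr
      exact hg2 x
  obtain ⟨i_D, hD⟩ := le_integral_hilbert_mul_deriv hδ (by linarith) hf hc' heven i_sq hh
  have hparts : ∀ z, 0 < z → P z = z * (f 0 - f z) - ∫ x in Ioo 0 z, (f 0 - f x) := by
    intro z hz
    have hd : ∀ x ∈ uIcc 0 z, HasDerivAt (fun x => x * (f 0 - f x)) ((f 0 - f x) + -f' x * x) x :=
      fun x _ => (((hasDerivAt_id x).mul ((hf x).const_sub (f 0))).congr_deriv (by simp; ring))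
    have h1 := intervalIntegral.integral_eq_sub_of_hasDerivAt hd
      (Continuous.intervalIntegrable (by fun_prop) _ _)
    rw [intervalIntegral.integral_add (Continuous.intervalIntegrable (by fun_prop) _ _)
      (Continuous.intervalIntegrable (by fun_prop) _ _)] at h1
    simp only [hP]
    rw [← integral_Ioc_eq_integral_Ioo, ← integral_Ioc_eq_integral_Ioo,
      ← intervalIntegral.integral_of_le hz.le, ← intervalIntegral.integral_of_le hz.le]
    linarith
  have hP4 : ∀ z, 1 ≤ z → |P z| ≤ 4 * z := by
    intro z hz
    have hz0 : 0 < z := by linarith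
    have h1 : |∫ x in Ioo 0 z, (f 0 - f x)| ≤ 2 * z := by
      rw [← integral_Ioc_eq_integral_Ioo, ← intervalIntegral.integral_of_le hz0.le,
        ← Real.norm_eq_abs]
      refine (intervalIntegral.norm_integral_le_of_norm_le_const (C := 2) fun x _ => hg2 x).trans ?_
      rw [sub_zero, abs_of_pos hz0]
    have h2 : |z * (f 0 - f z)| ≤ 2 * z := by
      rw [abs_mul, abs_of_pos hz0]; nlinarith [hg2 z]
    rw [hparts z hz0]
    exact (abs_sub _ _).trans (by linarith)
  -- the dissipative term
  have i_tau' : IntegrableOn (fun s => (-f' s * s) * s ^ (-(1 + τ))) (Ioi 0) := by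
    refine i_tau.congr_fun (fun s hs => ?_) measurableSet_Ioi
    have hs0 : 0 < s := hs
    simp only
    rw [mul_assoc, mul_comm s, ← Real.rpow_add_one hs0.ne']; congr 2; ring
  have hv_tau : ∫ s in Ioi 0, -f' s * s ^ (-τ) = ∫ s in Ioi 0, (-f' s * s) * s ^ (-(1 + τ)) := by
    refine setIntegral_congr_fun measurableSet_Ioi fun s hs => ?_
    have hs0 : 0 < s := hs
    rw [mul_assoc, mul_comm s, ← Real.rpow_add_one hs0.ne']; congr 2; ring
  obtain ⟨j1, j2⟩ := integral_rpow_mul_primitive (c := 1 + τ) (hm'.neg.mul measurable_id)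
    (by linarith) i_tau'
  have i_g' : IntegrableOn (fun x => (f 0 - f x) * x ^ (-(1 + δ))) (Ioi 0) := by
    rwa [show -(1 + δ) = -1 - δ by ring]
  obtain ⟨k1, k2⟩ := integral_rpow_mul_primitive (c := 1 + δ) (q := fun x => f 0 - f x)
    (by fun_prop) (by linarith) i_g'
  rw [show -1 - (1 + τ) = -2 - τ by ring] at j1 j2
  rw [show -1 - (1 + δ) = -2 - δ by ring] at k1 k2
  have hPd : EqOn (fun z => (f 0 - f z) * z ^ (-1 - δ) - z ^ (-2 - δ) * ∫ x in Ioo 0 z, (f 0 - f x))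
      (fun z => z ^ (-2 - δ) * P z) (Ioi 0) := fun z hz => by
    have hz0 : 0 < z := hz
    have e : z ^ (-1 - δ) = z ^ (-2 - δ) * z := by
      rw [← Real.rpow_add_one hz0.ne']; congr 1; ring
    simp only
    rw [hparts z hz0, e]; ring
  have k3 : IntegrableOn (fun z => z ^ (-2 - δ) * P z) (Ioi 0) := by
    have : IntegrableOn (fun z => (f 0 - f z) * z ^ (-1 - δ) -
      z ^ (-2 - δ) * ∫ x in Ioo 0 z, (f 0 - f x)) (Ioi 0) := i_g.sub k1
    exact this.congr_fun hPd measurableSet_Ioi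
  have k4 : ∫ z in Ioi 0, z ^ (-2 - δ) * P z =
      δ / (1 + δ) * ∫ x in Ioi 0, (f 0 - f x) * x ^ (-1 - δ) := by
    rw [← setIntegral_congr_fun measurableSet_Ioi hPd, integral_sub i_g k1, k2,
      show -(1 + δ) = -1 - δ by ring]
    field_simp
    ring
  refine ⟨_, hD, fun l hl => ?_, fun l hl => ?_⟩
  · have h1 := abs_integral_rpow_mul_le (P := P) hl (by linarith) (by linarith) hP4 i_D j1
    rw [integral_fracDiss_sub h0 (by linarith) hδ (by linarith) hf hc' hlip heven i_tau,
      ← hτ, hv_tau, abs_mul, mul_assoc]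
    have h2 : |∫ s in Ioi 0, (-f' s * s) * s ^ (-(1 + τ))| =
        (1 + τ) * |∫ z in Ioi 0, z ^ (-2 - τ) * P z| := by
      have h3 : ∫ z in Ioi 0, z ^ (-2 - τ) * P z =
        (1 + τ)⁻¹ * ∫ s in Ioi 0, (-f' s * s) * s ^ (-(1 + τ)) := j2
      rw [h3, abs_mul, abs_of_pos (inv_pos.2 (by linarith : 0 < 1 + τ)), ← mul_assoc,
        mul_inv_cancel₀ (by linarith), one_mul]
    rw [h2]
    have : 0 < 1 + τ := by linarith
    gcongr
  · rw [← k4]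
    exact (le_abs_self _).trans
      (abs_integral_rpow_mul_le (P := P) hl hδ (by linarith) hP4 i_D k3)

set_option maxHeartbeats 1000000 in
/-- The weighted integral of a slice satisfies a quadratic differential inequality as soon as it
is large. -/
lemma exists_quadratic_growth {β δ : ℝ} (h0 : 0 < β) (hδ : 0 < δ)
    (hβδ : δ + 4 * β < 1) (hβδ' : 1 < 2 * δ + 4 * β) :
    ∃ c > 0, ∃ J₀ > 0, ∀ (κ B : ℝ) (f f' h : ℝ → ℝ), 0 ≤ κ → κ ≤ 1 →
      (∀ x, HasDerivAt f (f' x) x) → Continuous f' → (∀ x, |f x| ≤ 1) → 1 ≤ B →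
      (∀ x, |f' x| ≤ B) → (∀ x, f (-x) = f x) → (Integrable fun x => f' x ^ 2) →
      (∀ x, Tendsto (fun R => ∫ y in (0 : ℝ)..R, symmQuot f x y) atTop (𝓝 (h x))) →
      J₀ ≤ (∫ x in Ioi 0, (f 0 - f x) * x ^ (-1 - δ)) →
      c * (∫ x in Ioi 0, (f 0 - f x) * x ^ (-1 - δ)) ^ 2 ≤
        Real.pi⁻¹ * (∫ x in Ioi 0, h x * -f' x * x ^ (-1 - δ)) +
        κ * ∫ x in Ioi 0, (fracDiss β f x - fracDiss β f 0) * x ^ (-1 - δ) := by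
  have hpi := Real.pi_pos
  set C := |stepConst δ (2 * β)| * (1 + (δ + 2 * β)) + 1 with hC
  have hC0 : 0 < C := by positivity
  set l₀ := Real.pi⁻¹ / C with hl₀
  have hl₀0 : 0 < l₀ := by positivity
  set C₁ := C * ((2 * l₀ * (1 + δ - 2 * (δ + 2 * β)))⁻¹ + 4 / (δ + 2 * β)) with hC₁
  have hpos : 0 < 1 + δ - 2 * (δ + 2 * β) := by linarith
  have hC₁0 : 0 < C₁ := by positivity
  set e := δ / (1 + δ) with he
  have he0 : 0 < e := by positivity
  set K := (1 + δ - 2 * δ)⁻¹ with hK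
  have hK0 : 0 < K := inv_pos.2 (by linarith)
  set k := Real.pi⁻¹ * e ^ 2 / (2 * K) with hk
  have hk0 : 0 < k := by positivity
  refine ⟨k / 2, by positivity, max (16 / (e * δ)) (1 + 2 * C₁ / k), by positivity, ?_⟩
  intro κ B f f' h hκ hκ1 hf hc' hb hB hb' heven hi hh hJ
  obtain ⟨D, hD1, hD2, hD3⟩ := slice_estimates h0 hδ hβδ hβδ' hf hc' hb hB hb' heven hi hh
  set J := ∫ x in Ioi 0, (f 0 - f x) * x ^ (-1 - δ) with hJdef
  set L := ∫ x in Ioi 0, (fracDiss β f x - fracDiss β f 0) * x ^ (-1 - δ) with hL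
  set N := ∫ x in Ioi 0, h x * -f' x * x ^ (-1 - δ) with hN
  have hJ1 : 16 / (e * δ) ≤ J := (le_max_left _ _).trans hJ
  have hJ2 : 1 + 2 * C₁ / k ≤ J := (le_max_right _ _).trans hJ
  have hJ0 : 0 < J := lt_of_lt_of_le (by positivity) hJ1
  -- lower bound for the weighted square
  have hDlow : e ^ 2 * J ^ 2 / (2 * K) ≤ D := by
    have h1 := hD3 (K / (e * J)) (by positivity)
    have e1 : (2 * (K / (e * J)) * (1 + δ - 2 * δ))⁻¹ = e * J / 2 := by
      rw [mul_inv, ← hK, mul_inv, inv_div]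
      field_simp
    rw [e1] at h1
    have h2 : e * J / 2 ≤ K / (e * J) / 2 * D + 4 / δ := by linarith
    have h3 : 16 / δ ≤ e * J := by
      rw [div_le_iff₀ (by positivity)] at hJ1 ⊢
      linarith
    have h4 : e * J / 4 ≤ K / (e * J) / 2 * D := by
      have : 4 / δ = (16 / δ) / 4 := by ring
      linarith
    rw [div_le_iff₀ (by positivity)]
    have h5 : K / (e * J) / 2 * D = K * D / (2 * (e * J)) := by field_simp
    rw [h5, le_div_iff₀ (by positivity)] at h4
    linear_combination 2 * h4
  have hD0 : 0 ≤ D := le_trans (by positivity) hDlow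
  have hLlow : -(l₀ * C / 2 * D + C₁) ≤ κ * L := by
    have h1 := hD2 l₀ hl₀0
    have h2 : |L| ≤ C * (l₀ / 2 * D + (2 * l₀ * (1 + δ - 2 * (δ + 2 * β)))⁻¹ +
        4 / (δ + 2 * β)) := by
      refine h1.trans (mul_le_mul_of_nonneg_right (by linarith) (by positivity))
    have h3 : |κ * L| ≤ |L| := by
      rw [abs_mul, abs_of_nonneg hκ]
      nlinarith [abs_nonneg L]
    have h4 := neg_abs_le (κ * L)
    have h5 : C * (l₀ / 2 * D + (2 * l₀ * (1 + δ - 2 * (δ + 2 * β)))⁻¹ + 4 / (δ + 2 * β)) =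
      l₀ * C / 2 * D + C₁ := by rw [hC₁]; ring
    linarith
  have hlC : l₀ * C = Real.pi⁻¹ := by rw [hl₀]; field_simp
  rw [hlC] at hLlow
  have hNlow : 3 * Real.pi⁻¹ * D ≤ Real.pi⁻¹ * N := by
    have : 0 < Real.pi⁻¹ := by positivity
    have h1 : 3 * D ≤ N := by linarith [mul_nonneg hδ.le hD0]
    calc 3 * Real.pi⁻¹ * D = Real.pi⁻¹ * (3 * D) := by ring
      _ ≤ _ := by gcongr
  have hkD : k * J ^ 2 ≤ Real.pi⁻¹ * D := by
    have : 0 < Real.pi⁻¹ := by positivity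
    calc k * J ^ 2 = Real.pi⁻¹ * (e ^ 2 * J ^ 2 / (2 * K)) := by rw [hk]; ring
      _ ≤ _ := by gcongr
  have hkJ : C₁ ≤ k / 2 * J ^ 2 := by
    have h1 : 2 * C₁ / k ≤ J := by linarith
    rw [div_le_iff₀ hk0] at h1
    have h2 : 1 ≤ J := le_trans (by linarith [div_nonneg (by linarith : 0 ≤ 2 * C₁) hk0.le]) hJ2
    nlinarith [mul_pos hk0 hJ0]
  have : 0 ≤ Real.pi⁻¹ * D := by positivity
  linarith

lemma integrableOn_min_one_mul_rpow {δ : ℝ} (hδ : 0 < δ) (hδ1 : δ < 1) :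
    IntegrableOn (fun x : ℝ => min 1 x * x ^ (-1 - δ)) (Ioi 0) := by
  refine integrableOn_Ioi_of_bounds (B := 1) (r := -δ) (G := fun x => x ^ (-1 - δ)) (by fun_prop)
    (by linarith) (fun x h0 h1 => ?_) ?_ fun x h1 => ?_
  · rw [min_eq_right h1.le, ← Real.rpow_one_add' h0.le (by linarith), one_mul,
      abs_of_nonneg (by positivity)]
    exact le_of_eq (by congr 1; ring)
  · rw [integrableOn_Ici_iff_integrableOn_Ioi]
    exact integrableOn_Ioi_rpow_of_lt (show -1 - δ < -1 by linarith) one_pos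
  · have : (0 : ℝ) ≤ x := by linarith
    rw [min_eq_left h1, one_mul, abs_of_nonneg (by positivity)]

lemma integrableOn_mul_rpow_of_abs_le_min {δ C : ℝ} {F : ℝ → ℝ} (hδ : 0 < δ) (hδ1 : δ < 1)
    (hF : Measurable F) (hb : ∀ x, 0 < x → |F x| ≤ C * min 1 x) :
    IntegrableOn (fun x : ℝ => F x * x ^ (-1 - δ)) (Ioi 0) := by
  refine Integrable.mono' ((integrableOn_min_one_mul_rpow hδ hδ1).const_mul C)
    (by fun_prop) ?_
  filter_upwards [ae_restrict_mem measurableSet_Ioi] with x hx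
  have hx : 0 < x := hx
  rw [Real.norm_eq_abs, abs_mul, abs_of_nonneg (show 0 ≤ x ^ (-1 - δ) by positivity), ← mul_assoc]
  gcongr
  exact hb x hx

lemma le_mul_min_one {u C D x : ℝ} (hu : u ≤ C) (hu' : u ≤ D * x) (hx : 0 < x) (hC : 0 ≤ C)
    (hD : 0 ≤ D) : u ≤ (C + D) * min 1 x := by
  rcases min_cases 1 x with ⟨h, _⟩ | ⟨h, _⟩ <;> rw [h]
  · linarith
  · nlinarith

/-- The weighted moment `∫₀^∞ (f(0) - f(x)) x^{-1-δ} dx`. -/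
noncomputable def moment (δ : ℝ) (f : ℝ → ℝ) : ℝ := ∫ x in Ioi 0, (f 0 - f x) * x ^ (-1 - δ)

lemma integrableOn_moment {δ M : ℝ} {f f' : ℝ → ℝ} (hδ : 0 < δ) (hδ1 : δ < 1)
    (hf : ∀ x, HasDerivAt f (f' x) x) (hM : ∀ x, |f x| ≤ M) (hb : ∀ x, |f' x| ≤ M) :
    IntegrableOn (fun x : ℝ => (f 0 - f x) * x ^ (-1 - δ)) (Ioi 0) := by
  have hc : Continuous f := continuous_iff_continuousAt.2 fun x => (hf x).continuousAt
  refine integrableOn_mul_rpow_of_abs_le_min (C := 2 * M) (F := fun x => f 0 - f x) hδ hδ1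
    (by fun_prop) fun x hx => ?_
  simpa [abs_of_pos hx] using abs_sub_add_le_min hf hM hb 0 x

namespace IsSolution

variable {β κ : ℝ} {θ a : ℝ → ℝ → ℝ}

lemma continuousOn_moment (h : IsSolution β κ θ a) {δ T : ℝ} (hδ : 0 < δ) (hδ1 : δ < 1)
    (hT : 0 < T) : ContinuousOn (fun t => moment δ fun x => θ x t) (Icc 0 T) := by
  obtain ⟨M, hM0, hM, hMj⟩ := h.exists_bound hT
  refine continuousOn_of_dominated (bound := fun x => 2 * M * (min 1 x * x ^ (-1 - δ)))
    (fun t ht => (integrableOn_moment hδ hδ1 (h.hasDerivAt_space ht.1) (hM t ht)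
      (hMj 1 (by norm_num) t ht)).aestronglyMeasurable) (fun t ht => ?_)
    ((integrableOn_min_one_mul_rpow hδ hδ1).const_mul _) ?_
  · filter_upwards [ae_restrict_mem measurableSet_Ioi] with x hx
    have hx : 0 < x := hx
    rw [Real.norm_eq_abs, abs_mul, abs_of_nonneg (show 0 ≤ x ^ (-1 - δ) by positivity),
      ← mul_assoc]
    gcongr
    simpa [abs_of_pos hx] using abs_sub_add_le_min (h.hasDerivAt_space ht.1) (hM t ht)
      (hMj 1 (by norm_num) t ht) 0 x
  · exact Eventually.of_forall fun x =>
      ((h.continuousOn_time 0 T).sub (h.continuousOn_time x T)).mul continuousOn_const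

lemma hasDerivAt_moment (h : IsSolution β κ θ a) (h0 : 0 < β) (h1 : β < 1 / 2) (hκ : 0 ≤ κ)
    {δ T : ℝ} (hδ : 0 < δ) (hδ1 : δ < 1) (hT : 0 < T) (hA : ∀ t ∈ Icc 0 T, a 0 t = 0)
    (hi : Integrable fun x => θ x 0 ^ 2) (hi' : Integrable fun x => dx θ 1 x 0 ^ 2) {t : ℝ}
    (ht : t ∈ Ioo 0 T) :
    HasDerivAt (fun t => moment δ fun x => θ x t)
      (Real.pi⁻¹ * (∫ x in Ioi 0, Real.pi * a x t * -dx θ 1 x t * x ^ (-1 - δ)) +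
        κ * ∫ x in Ioi 0, (fracDiss β (fun x' => θ x' t) x - fracDiss β (fun x' => θ x' t) 0) *
          x ^ (-1 - δ)) t := by
  have hA' : ∀ t ∈ Icc 0 T, |a 0 t| ≤ 0 := fun t ht => by simp [hA t ht]
  obtain ⟨B, hB0, hB, hBj, -, haB'⟩ := h.exists_bound_a h0 hT hA'
  obtain ⟨C, hC⟩ := h.exists_bound_sq h0 h1 hκ hT hA' hi hi'
  have hC0 : 0 ≤ C := (integral_nonneg fun x => sq_nonneg _).trans (hC 0 ⟨le_rfl, hT.le⟩).1.2
  set K := ∫ y, truncKer β y with hK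
  have hK0 : 0 ≤ K := integral_nonneg fun y => truncKer_nonneg β y
  have hB1 := hBj 1 (by norm_num)
  have hB2 := hBj 2 (by norm_num)
  have hB3 := hBj 3 (by norm_num)
  set D := 2 * B + 2 * √(C + 1) with hD
  have hD0 : 0 ≤ D := by positivity
  have haD : ∀ t ∈ Icc 0 T, ∀ x, |a x t| ≤ D := fun t ht x => by
    have := (abs_hilbert_le_of_sq (h.hasDerivAt_space ht.1) (hB1 t ht) (hC t ht).1.1
      ((hC t ht).1.2.trans (le_add_of_nonneg_right zero_le_one)) (by linarith)
      (h.hilbert t ht.1) x).2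
    rw [abs_mul, abs_of_pos Real.pi_pos] at this
    nlinarith [Real.pi_gt_three, abs_nonneg (a x t)]
  have hadv : ∀ t ∈ Icc 0 T, ∀ x, 0 < x →
      |a x t * -dx θ 1 x t| ≤ (D * B + B * B) * min 1 x := fun t ht x hx => by
    have e := abs_sub_le_of_hasDerivAt (h.hasDerivAt_a ht.1) (haB' t ht) x 0
    rw [hA t ht, sub_zero, sub_zero, abs_of_pos hx] at e
    rw [abs_mul, abs_neg]
    refine le_mul_min_one ?_ ?_ hx (by positivity) (by positivity)
    · exact mul_le_mul (haD t ht x) (hB1 t ht x) (abs_nonneg _) hD0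
    · calc _ ≤ (B * x) * B := mul_le_mul e (hB1 t ht x) (abs_nonneg _) (by positivity)
        _ = _ := by ring
  have hLd : ∀ t ∈ Icc 0 T, ∀ x, HasDerivAt (fracDiss β fun x' => θ x' t)
      (fracDiss β (fun x' => dx θ 1 x' t) x) x := fun t ht =>
    hasDerivAt_fracDiss h0 h1 (h.hasDerivAt_space ht.1) (h.hasDerivAt_dx ht.1 1) (hB t ht)
      (hB1 t ht) (hB2 t ht)
  have hdiss : ∀ t ∈ Icc 0 T, ∀ x, 0 < x →
      |fracDiss β (fun x' => θ x' t) x - fracDiss β (fun x' => θ x' t) 0| ≤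
        (4 * B * K + 2 * B * K) * min 1 x := fun t ht x hx => by
    have hb := abs_fracDiss_le h0 h1
      (abs_sub_add_le_min (h.hasDerivAt_space ht.1) (hB t ht) (hB1 t ht))
    have e := abs_sub_le_of_hasDerivAt (hLd t ht) (fun x => abs_fracDiss_le h0 h1
      (abs_sub_add_le_min (h.hasDerivAt_dx ht.1 1) (hB1 t ht) (hB2 t ht)) x) x 0
    rw [sub_zero, abs_of_pos hx] at e
    refine le_mul_min_one ?_ e hx (by positivity) (by positivity)
    calc _ ≤ _ := abs_sub _ _
      _ ≤ 2 * B * K + 2 * B * K := add_le_add (hb x) (hb 0)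
      _ = _ := by ring
  have hIc : t ∈ Icc 0 T := ⟨ht.1.le, ht.2.le⟩
  have hca : ∀ t ∈ Icc 0 T, Continuous fun x => a x t := fun t ht =>
    continuous_iff_continuousAt.2 fun x => (h.hasDerivAt_a ht.1 x).continuousAt
  have hcL : ∀ t ∈ Icc 0 T, Continuous (fracDiss β fun x' => θ x' t) := fun t ht =>
    continuous_iff_continuousAt.2 fun x => (hLd t ht x).continuousAt
  have i1 : IntegrableOn (fun x => a x t * -dx θ 1 x t * x ^ (-1 - δ)) (Ioi 0) :=
    integrableOn_mul_rpow_of_abs_le_min hδ hδ1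
      ((hca t hIc).mul (h.continuous_dx ht.1.le 1).neg).measurable (hadv t hIc)
  have i2 : IntegrableOn (fun x => (fracDiss β (fun x' => θ x' t) x -
      fracDiss β (fun x' => θ x' t) 0) * x ^ (-1 - δ)) (Ioi 0) :=
    integrableOn_mul_rpow_of_abs_le_min hδ hδ1
      ((hcL t hIc).sub continuous_const).measurable (hdiss t hIc)
  set E := (D * B + B * B) + κ * (4 * B * K + 2 * B * K) with hE
  have key := (hasDerivAt_integral_of_dominated_loc_of_deriv_le
    (μ := volume.restrict (Ioi (0 : ℝ)))
    (F := fun t x => (θ 0 t - θ x t) * x ^ (-1 - δ))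
    (F' := fun t x => a x t * -dx θ 1 x t * x ^ (-1 - δ) +
      κ * ((fracDiss β (fun x' => θ x' t) x - fracDiss β (fun x' => θ x' t) 0) * x ^ (-1 - δ)))
    (bound := fun x => E * (min 1 x * x ^ (-1 - δ))) (Ioo_mem_nhds ht.1 ht.2) ?_ ?_ ?_ ?_ ?_ ?_).2
  · refine key.congr_deriv ?_
    rw [integral_add i1 (i2.const_mul κ), integral_const_mul]
    congr 1
    rw [← integral_const_mul]
    refine integral_congr_ae (Eventually.of_forall fun x => ?_)
    have := Real.pi_ne_zero
    field_simp
  · filter_upwards [Ioo_mem_nhds ht.1 ht.2] with s hs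
    have hs' : s ∈ Icc 0 T := ⟨hs.1.le, hs.2.le⟩
    exact (integrableOn_moment hδ hδ1 (h.hasDerivAt_space hs.1.le) (hB s hs')
      (hB1 s hs')).aestronglyMeasurable
  · exact integrableOn_moment hδ hδ1 (h.hasDerivAt_space ht.1.le) (hB t hIc) (hB1 t hIc)
  · exact (i1.add (i2.const_mul κ)).aestronglyMeasurable
  · filter_upwards [ae_restrict_mem measurableSet_Ioi] with x hx s hs
    have hs' : s ∈ Icc 0 T := ⟨hs.1.le, hs.2.le⟩
    have hx : 0 < x := hx
    have hp : 0 ≤ x ^ (-1 - δ) := by positivity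
    calc _ = |a x s * -dx θ 1 x s + κ * (fracDiss β (fun x' => θ x' s) x -
            fracDiss β (fun x' => θ x' s) 0)| * x ^ (-1 - δ) := by
          rw [Real.norm_eq_abs, ← mul_assoc, ← add_mul, abs_mul, abs_of_nonneg hp]
      _ ≤ ((D * B + B * B) * min 1 x + κ * ((4 * B * K + 2 * B * K) * min 1 x)) *
            x ^ (-1 - δ) := by
          gcongr
          refine (abs_add_le _ _).trans (add_le_add (hadv s hs' x hx) ?_)
          rw [abs_mul, abs_of_nonneg hκ]
          exact mul_le_mul_of_nonneg_left (hdiss s hs' x hx) hκ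
      _ = _ := by rw [hE]; ring
  · exact (integrableOn_min_one_mul_rpow hδ hδ1).const_mul _
  · refine Eventually.of_forall fun x s hs => ?_
    refine (((h.hasDerivAt_time 0 hs.1).sub (h.hasDerivAt_time x hs.1)).mul_const _).congr_deriv ?_
    rw [hA s ⟨hs.1.le, hs.2.le⟩]
    ring

end IsSolution

/-- A quantity satisfying the Riccati inequality `J' ≥ c J²` above a threshold stays above it and
cannot exist for long. -/
lemma riccati_bound {J J' : ℝ → ℝ} {c J₀ T : ℝ} (hc : 0 < c) (hJ₀ : 0 < J₀) (hT : 0 ≤ T)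
    (hcont : ContinuousOn J (Icc 0 T)) (hd : ∀ t ∈ Ioo 0 T, HasDerivAt J (J' t) t)
    (hg : ∀ t ∈ Ioo 0 T, J₀ ≤ J t → c * J t ^ 2 ≤ J' t) (hJ : J₀ < J 0) :
    (∀ t ∈ Icc 0 T, J₀ < J t) ∧ c * J₀ * T ≤ 1 := by
  have hpos : ∀ t ∈ Icc 0 T, J₀ < J t := by
    by_contra! hne
    obtain ⟨t₂, ht₂, hJt₂⟩ := hne
    have hcpt : IsCompact (Icc 0 T ∩ J ⁻¹' Iic J₀) :=
      isCompact_Icc.of_isClosed_subset (hcont.preimage_isClosed_of_isClosed isClosed_Icc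
        isClosed_Iic) inter_subset_left
    obtain ⟨t₁, ⟨ht₁, hJt₁⟩, hmin⟩ := hcpt.exists_isLeast ⟨t₂, ht₂, hJt₂⟩
    have hJt₁ : J t₁ ≤ J₀ := hJt₁
    have hmono : MonotoneOn J (Icc 0 t₁) := by
      refine monotoneOn_of_hasDerivWithinAt_nonneg (convex_Icc _ _)
        (hcont.mono (Icc_subset_Icc_right ht₁.2)) (f' := J') ?_ ?_ <;>
        rw [interior_Icc] <;> intro t ht
      · exact (hd t ⟨ht.1, ht.2.trans_le ht₁.2⟩).hasDerivWithinAt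
      · have hIoo : t ∈ Ioo 0 T := ⟨ht.1, ht.2.trans_le ht₁.2⟩
        refine le_trans (by positivity) (hg t hIoo ?_)
        by_contra! hlt
        exact absurd (hmin ⟨⟨hIoo.1.le, hIoo.2.le⟩, hlt.le⟩) (not_le.2 ht.2)
    have := hmono ⟨le_rfl, ht₁.1⟩ ⟨ht₁.1, le_rfl⟩ ht₁.1
    linarith
  refine ⟨hpos, ?_⟩
  have hmono : MonotoneOn (fun t => -(J t)⁻¹ - c * t) (Icc 0 T) := by
    refine monotoneOn_of_hasDerivWithinAt_nonneg (convex_Icc _ _)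
      (((hcont.inv₀ fun t ht => (hJ₀.trans (hpos t ht)).ne').neg).sub (by fun_prop))
      (f' := fun t => J' t / J t ^ 2 - c) ?_ ?_ <;>
      rw [interior_Icc] <;> intro t ht <;>
      have hJt := hpos t ⟨ht.1.le, ht.2.le⟩ <;> have hJt0 := hJ₀.trans hJt
    · refine ((((hd t ht).inv hJt0.ne').neg).sub ((hasDerivAt_id t).const_mul c)).congr_deriv ?_
        |>.hasDerivWithinAt
      ring
    · have := hg t ht hJt.le
      rw [sub_nonneg, le_div_iff₀ (by positivity)]
      exact this
  have h1 := hmono ⟨le_rfl, hT⟩ ⟨hT, le_rfl⟩ hT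
  have h2 : 0 < (J T)⁻¹ := inv_pos.2 (hJ₀.trans (hpos T ⟨hT, le_rfl⟩))
  have h3 : (J 0)⁻¹ ≤ J₀⁻¹ := inv_anti₀ hJ₀ hJ.le
  have h4 : c * T ≤ J₀⁻¹ := by simp only [mul_zero, sub_zero] at h1; linarith
  calc c * J₀ * T = c * T * J₀ := by ring
    _ ≤ J₀⁻¹ * J₀ := by gcongr
    _ = 1 := inv_mul_cancel₀ hJ₀.ne'

namespace IsSolution

variable {β κ : ℝ} {θ a : ℝ → ℝ → ℝ}

/-- There is a threshold for the initial moment above which the moment stays above it and the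
solution has bounded lifespan, as long as the velocity vanishes at the origin. -/
lemma exists_moment_threshold {δ : ℝ} (h0 : 0 < β) (hδ : 0 < δ) (hβδ : δ + 4 * β < 1)
    (hβδ' : 1 < 2 * δ + 4 * β) :
    ∃ J₀ > 0, ∃ T₀ > 0, ∀ (κ : ℝ) (θ a : ℝ → ℝ → ℝ), 0 ≤ κ → κ ≤ 1 → IsSolution β κ θ a →
      (∀ x, |θ x 0| ≤ 1) → (∀ x, θ (-x) 0 = θ x 0) → Integrable (fun x => θ x 0 ^ 2) →
      Integrable (fun x => dx θ 1 x 0 ^ 2) → J₀ < moment δ (fun x => θ x 0) →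
      ∀ T > 0, (∀ t ∈ Icc 0 T, a 0 t = 0) →
        (∀ t ∈ Icc 0 T, J₀ < moment δ fun x => θ x t) ∧ T < T₀ := by
  obtain ⟨c, hc, J₀, hJ₀, H⟩ := exists_quadratic_growth h0 hδ hβδ hβδ'
  refine ⟨J₀, hJ₀, 2 / (c * J₀), by positivity, ?_⟩
  intro κ θ a hκ hκ1 h hm heven hi hi' hJ T hT hA
  have h1 : β < 1 / 2 := by linarith
  have hA' : ∀ t ∈ Icc 0 T, |a 0 t| ≤ 0 := fun t ht => by simp [hA t ht]
  obtain ⟨B, hB0, hB, hBj⟩ := h.exists_bound hT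
  obtain ⟨C, hC⟩ := h.exists_bound_sq h0 h1 hκ hT hA' hi hi'
  have := riccati_bound hc hJ₀ hT.le (h.continuousOn_moment hδ (by linarith) hT)
    (fun t ht => h.hasDerivAt_moment h0 h1 hκ hδ (by linarith) hT hA hi hi' ht)
    (fun t ht hJt => ?_) hJ
  · refine ⟨this.1, ?_⟩
    rw [lt_div_iff₀ (by positivity)]
    linarith [this.2]
  · have hIc : t ∈ Icc 0 T := ⟨ht.1.le, ht.2.le⟩
    exact H κ (B + 1) (fun x => θ x t) (fun x => dx θ 1 x t) (fun x => Real.pi * a x t) hκ hκ1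
      (h.hasDerivAt_space ht.1.le) (h.continuous_dx ht.1.le 1)
      (h.abs_le_of_initial h0 h1 hκ hT hA' hm t hIc) (by linarith)
      (fun x => (hBj 1 (by norm_num) t hIc x).trans (by linarith))
      (h.even_of_initial h0 h1 hκ hT hA' hi hi' heven t hIc) (hC t hIc).2.1
      (h.hilbert t ht.1.le) hJt

end IsSolution

namespace IsSolution

variable {β κ : ℝ} {θ a : ℝ → ℝ → ℝ}

/-- Wherever the solution is not spatially constant, the equation itself controls the velocity
for a short time. -/
lemma exists_bound_velocity (h : IsSolution β κ θ a) (h0 : 0 < β) (h1 : β < 1 / 2) (hκ : 0 ≤ κ)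
    {τ x₀ : ℝ} (hτ : 0 ≤ τ) (hx₀ : dx θ 1 x₀ τ ≠ 0) :
    ∃ η > 0, ∃ A, ∀ t ∈ Icc τ (τ + η), |a 0 t| ≤ A := by
  have hT : 0 < τ + 1 := by linarith
  obtain ⟨M, hM0, hM, hMj⟩ := h.exists_bound hT
  have hsm : ContDiffOn ℝ (⊤ : ℕ∞) (fun s => θ x₀ s) (Ici 0) :=
    h.smooth.comp (f := fun s : ℝ => (x₀, s)) (by fun_prop) fun s hs => ⟨mem_univ _, hs⟩
  have hdc : ContinuousOn (derivWithin (fun s => θ x₀ s) (Ici 0)) (Icc 0 (τ + 1)) :=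
    (hsm.continuousOn_derivWithin (uniqueDiffOn_Ici 0) (by simp)).mono Icc_subset_Ici_self
  obtain ⟨D, hD⟩ := isCompact_Icc.exists_bound_of_continuousOn hdc
  set K := ∫ y, truncKer β y with hK
  set m := |dx θ 1 x₀ τ| / 2 with hm
  have hm0 : 0 < m := by positivity
  have hτI : τ ∈ Icc 0 (τ + 1) := ⟨hτ, by linarith⟩
  have hev : ∀ᶠ t in 𝓝[Icc 0 (τ + 1)] τ, m < |dx θ 1 x₀ t| :=
    ((h.continuousOn_time_dx x₀ (τ + 1)) τ hτI).abs.eventually_const_lt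
      (by rw [hm]; linarith [abs_pos.2 hx₀])
  obtain ⟨ε, hε, hball⟩ := Metric.mem_nhdsWithin_iff.1 hev
  refine ⟨min (ε / 2) 1, by positivity,
    (D + κ * (2 * M * K)) / m + (8 * M + 4 * M * Real.log (1 + |x₀|)), fun t ht => ?_⟩
  have ht1 : t ≤ τ + 1 := ht.2.trans (by linarith [min_le_right (ε / 2) 1])
  have htI : t ∈ Icc 0 (τ + 1) := ⟨hτ.trans ht.1, ht1⟩
  have hmt : m < |dx θ 1 x₀ t| := by
    refine hball ⟨?_, htI⟩
    rw [Metric.mem_ball, Real.dist_eq, abs_of_nonneg (by linarith [ht.1])]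
    linarith [ht.2, min_le_left (ε / 2) 1]
  have hder := (h.eqn x₀ t htI.1).derivWithin (uniqueDiffOn_Ici 0 t htI.1)
  have hDt := hD t htI
  rw [hder, Real.norm_eq_abs] at hDt
  have hL := abs_fracDiss_le h0 h1 (abs_sub_add_le_min (h.hasDerivAt_space htI.1) (hM t htI)
    (hMj 1 (by norm_num) t htI)) x₀
  have hprod : |a x₀ t| * m ≤ D + κ * (2 * M * K) := by
    calc |a x₀ t| * m ≤ |a x₀ t| * |dx θ 1 x₀ t| := by gcongr
      _ = |(a x₀ t * dx θ 1 x₀ t - κ * fracDiss β (fun x' => θ x' t) x₀) +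
            κ * fracDiss β (fun x' => θ x' t) x₀| := by rw [← abs_mul]; congr 1; ring
      _ ≤ _ := (abs_add_le _ _).trans (add_le_add hDt (by
          rw [abs_mul, abs_of_nonneg hκ]; exact mul_le_mul_of_nonneg_left hL hκ))
  have hx : |a x₀ t| ≤ (D + κ * (2 * M * K)) / m := (le_div_iff₀ hm0).2 hprod
  have hlog := abs_hilbert_sub_le_log (a := fun x => a x t) (h.hasDerivAt_space htI.1)
    (h.hasDerivAt_dx htI.1 1) (hM t htI) (hMj 1 (by norm_num) t htI) (hMj 2 (by norm_num) t htI)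
    (h.hilbert t htI.1) x₀
  have := abs_sub_abs_le_abs_sub (a 0 t) (a x₀ t)
  rw [abs_sub_comm] at this
  linarith

/-- If the moment stays positive as long as the velocity vanishes at the origin, then the velocity
vanishes at the origin at all times. -/
lemma velocity_zero_of_moment_pos (h : IsSolution β κ θ a) (h0 : 0 < β) (h1 : β < 1 / 2)
    (hκ : 0 ≤ κ) {δ T : ℝ} (hT : 0 ≤ T) (heven : ∀ x, θ (-x) 0 = θ x 0)
    (hi : Integrable fun x => θ x 0 ^ 2) (hi' : Integrable fun x => dx θ 1 x 0 ^ 2)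
    (hmom : ∀ τ ≥ 0, (∀ t ∈ Icc 0 τ, a 0 t = 0) → 0 < moment δ fun x => θ x τ) :
    ∀ t ∈ Icc 0 T, a 0 t = 0 := by
  have hzero : a 0 0 = 0 := h.a_zero_of_even le_rfl heven
  have hext : ∀ τ > 0, ∀ A, (∀ t ∈ Icc 0 τ, |a 0 t| ≤ A) → ∀ t ∈ Icc 0 τ, a 0 t = 0 :=
    fun τ hτ A hA t ht =>
      h.a_zero_of_even ht.1 (h.even_of_initial h0 h1 hκ hτ hA hi hi' heven t ht)
  set s : Set ℝ := {τ | ∀ t ∈ Icc 0 τ, a 0 t = 0} with hs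
  suffices hsub : Icc 0 T ⊆ s from hsub ⟨hT, le_rfl⟩
  refine IsClosed.Icc_subset_of_forall_exists_gt ?_ ?_ ?_
  · refine isClosed_of_closure_subset fun τ hτ => ?_
    have hτI : τ ∈ Icc 0 T := closure_minimal inter_subset_right isClosed_Icc hτ
    refine ⟨?_, hτI⟩
    have hlt : ∀ t ∈ Ico 0 τ, a 0 t = 0 := fun t ht => by
      obtain ⟨τ', hτ', hτ's⟩ := mem_closure_iff.1 hτ (Ioi t) isOpen_Ioi ht.2
      exact hτ's.1 t ⟨ht.1, le_of_lt hτ'⟩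
    rcases hτI.1.eq_or_lt with rfl | hpos
    · intro t ht
      rw [le_antisymm ht.2 ht.1, hzero]
    · refine hext τ hpos |a 0 τ| fun t ht => ?_
      rcases ht.2.eq_or_lt with rfl | hlt'
      · exact le_rfl
      · rw [hlt t ⟨ht.1, hlt'⟩, abs_zero]; positivity
  · intro t ht
    rw [le_antisymm ht.2 ht.1, hzero]
  · intro τ hτ y hy
    have hy : τ < y := hy
    have hτ0 : 0 ≤ τ := hτ.2.1
    obtain ⟨x₀, hx₀⟩ : ∃ x₀, dx θ 1 x₀ τ ≠ 0 := by
      by_contra! hall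
      have hconst : ∀ x, θ 0 τ - θ x τ = 0 := fun x => by
        have := abs_sub_le_of_hasDerivAt (M := 0) (h.hasDerivAt_space hτ0)
          (fun x => by simp [hall x]) 0 x
        simpa using this
      have := hmom τ hτ0 hτ.1
      simp [moment, hconst] at this
    obtain ⟨η, hη, A, hA⟩ := h.exists_bound_velocity h0 h1 hκ hτ0 hx₀
    have hm : τ < min y (τ + η) := lt_min hy (by linarith)
    refine ⟨min y (τ + η), ?_, hm, min_le_left _ _⟩
    refine hext _ (hτ0.trans_lt hm) (max A 0) fun t ht => ?_
    rcases le_total t τ with hle | hle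
    · rw [hτ.1 t ⟨ht.1, hle⟩, abs_zero]
      exact le_max_right _ _
    · exact (hA t ⟨hle, ht.2.trans (min_le_right _ _)⟩).trans (le_max_left _ _)

end IsSolution

/-- The Lorentzian profile of width `r`. -/
noncomputable def lorentzian (r x : ℝ) : ℝ := (1 + (x / r) ^ 2)⁻¹

lemma lorentzian_pos (r x : ℝ) : 0 < lorentzian r x := by unfold lorentzian; positivity

lemma lorentzian_le_one (r x : ℝ) : lorentzian r x ≤ 1 :=
  inv_le_one_of_one_le₀ (by nlinarith [sq_nonneg (x / r)])

lemma sq_mul_lorentzian_le (r x : ℝ) : (x / r) ^ 2 * lorentzian r x ≤ 1 := by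
  unfold lorentzian
  rw [← div_eq_mul_inv, div_le_one (by positivity)]
  linarith

lemma contDiff_lorentzian (r : ℝ) {n : WithTop ℕ∞} : ContDiff ℝ n (lorentzian r) := by
  unfold lorentzian
  exact ContDiff.inv (by fun_prop) fun x => by positivity

lemma hasDerivAt_lorentzian (r x : ℝ) :
    HasDerivAt (lorentzian r) (-(2 / r) * (x / r) * lorentzian r x ^ 2) x := by
  have h1 : HasDerivAt (fun x : ℝ => 1 + (x / r) ^ 2) (2 * (x / r) * (1 / r)) x := by
    simpa using (((hasDerivAt_id x).div_const r).pow 2).const_add 1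
  refine (h1.inv (by positivity)).congr_deriv ?_
  unfold lorentzian
  field_simp

lemma sq_deriv_lorentzian_le (r x : ℝ) :
    (-(2 / r) * (x / r) * lorentzian r x ^ 2) ^ 2 ≤ (2 / r) ^ 2 * lorentzian r x := by
  have h0 := (lorentzian_pos r x).le
  have h1 := lorentzian_le_one r x
  calc _ = (2 / r) ^ 2 * (((x / r) ^ 2 * lorentzian r x) * (lorentzian r x ^ 2 * lorentzian r x)) :=
        by ring
    _ ≤ (2 / r) ^ 2 * (1 * (1 * lorentzian r x)) := by
        gcongr
        · exact sq_mul_lorentzian_le r x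
        · exact pow_le_one₀ h0 h1
    _ = _ := by ring

lemma integrable_lorentzian {r : ℝ} (hr : r ≠ 0) : Integrable (lorentzian r) :=
  integrable_inv_one_add_sq.comp_div hr

lemma antitoneOn_lorentzian {r : ℝ} (hr : 0 < r) : AntitoneOn (lorentzian r) (Ioi 0) := by
  intro x hx y hy hxy
  have hx : 0 < x := hx
  unfold lorentzian
  gcongr

lemma le_moment_lorentzian {δ r : ℝ} (hδ : 0 < δ) (hδ1 : δ < 1) (hr : 0 < r) :
    r ^ (-δ) / (2 * δ) ≤ moment δ (lorentzian r) := by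
  have hint : IntegrableOn (fun x : ℝ => (lorentzian r 0 - lorentzian r x) * x ^ (-1 - δ))
      (Ioi 0) := by
    refine integrableOn_moment (M := 1 + 2 / r) hδ hδ1 (hasDerivAt_lorentzian r)
      (fun x => ?_) fun x => ?_
    · rw [abs_of_pos (lorentzian_pos r x)]
      have : 0 < 2 / r := by positivity
      linarith [lorentzian_le_one r x]
    · refine abs_le_of_sq_le_sq ((sq_deriv_lorentzian_le r x).trans ?_) (by positivity)
      calc _ ≤ (2 / r) ^ 2 * 1 := by gcongr; exact lorentzian_le_one r x
        _ ≤ _ := by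
          rw [mul_one]
          gcongr
          linarith
  have h0 : lorentzian r 0 = 1 := by simp [lorentzian]
  calc r ^ (-δ) / (2 * δ) = ∫ x in Ioi r, 1 / 2 * x ^ (-1 - δ) := by
        rw [integral_const_mul, integral_Ioi_rpow_of_lt (by linarith) hr,
          show -1 - δ + 1 = -δ by ring]
        field_simp
    _ ≤ ∫ x in Ioi r, (lorentzian r 0 - lorentzian r x) * x ^ (-1 - δ) := by
        refine setIntegral_mono_on
          ((integrableOn_Ioi_rpow_of_lt (show -1 - δ < -1 by linarith) hr).const_mul _)
          (hint.mono_set (Ioi_subset_Ioi hr.le)) measurableSet_Ioi fun x hx => ?_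
        have hx : r < x := hx
        have hx0 : 0 < x := hr.trans hx
        have hone : 1 ≤ (x / r) ^ 2 := one_le_pow₀ ((one_le_div hr).2 hx.le)
        have hhalf : lorentzian r x ≤ 1 / 2 := by
          unfold lorentzian
          rw [inv_le_comm₀ (by positivity) (by norm_num)]
          linarith
        gcongr
        linarith
    _ ≤ moment δ (lorentzian r) := by
        refine setIntegral_mono_set hint ?_ (Ioi_subset_Ioi hr.le).eventuallyLE
        filter_upwards [ae_restrict_mem measurableSet_Ioi] with x hx
        have hx : 0 < x := hx
        have := lorentzian_le_one r x
        exact mul_nonneg (by linarith) (by positivity)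

/-- A solution in the sense of principal values is an `IsSolution`, with dissipation strength `κ`
equal to `0` or `1`. -/
lemma isSolution_of_principalValue {α : ℝ} (hα0 : 0 ≤ α) (hα : α < 1 / 4) {θ Hθ Lθ : ℝ → ℝ → ℝ}
    (hsm : ContDiffOn ℝ (⊤ : ℕ∞) (fun p : ℝ × ℝ => θ p.1 p.2) (univ ×ˢ Ici 0))
    (hbd : ∀ T > (0 : ℝ), ∀ j : ℕ, ∃ M, ∀ x, ∀ t ∈ Icc (0 : ℝ) T,
      |iteratedDeriv j (fun x' => θ x' t) x| ≤ M)
    (hH : ∀ t ∈ Ici (0 : ℝ), ∀ x, HilbertPVAt (fun x' => θ x' t) x (Real.pi * Hθ x t))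
    (hL0 : α = 0 → ∀ x t, Lθ x t = 0)
    (hL : 0 < α → ∀ t ∈ Ici (0 : ℝ), ∀ x, Tendsto (fun ε => ∫ y in {y : ℝ | ε < |y|},
      (θ x t - θ (x + y) t) / |y| ^ (1 + 2 * α)) (nhdsWithin 0 (Ioi 0)) (nhds (Lθ x t)))
    (heq : ∀ x, ∀ t ∈ Ici (0 : ℝ), HasDerivWithinAt (fun s => θ x s)
      (Hθ x t * deriv (fun x' => θ x' t) x - Lθ x t) (Ici 0) t) :
    IsSolution (if α = 0 then 1 / 8 else α) (if α = 0 then 0 else 1) θ Hθ := by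
  have hslice : ∀ t ∈ Ici (0 : ℝ), ContDiff ℝ (⊤ : ℕ∞) fun x' => θ x' t := fun t ht =>
    contDiffOn_univ.1 (hsm.comp (f := fun x : ℝ => (x, t)) (by fun_prop)
      fun x _ => ⟨mem_univ _, ht⟩)
  have hder : ∀ t ∈ Ici (0 : ℝ), ∀ x,
      HasDerivAt (fun x' => θ x' t) (deriv (fun x' => θ x' t) x) x := fun t ht x =>
    ((hslice t ht).differentiable (by simp) x).hasDerivAt
  have hbdd : ∀ t ∈ Ici (0 : ℝ), ∃ M, (∀ x, |θ x t| ≤ M) ∧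
      ∀ x, |deriv (fun x' => θ x' t) x| ≤ M := fun t ht => by
    have ht : 0 ≤ t := ht
    obtain ⟨M₀, hM₀⟩ := hbd (t + 1) (by linarith) 0
    obtain ⟨M₁, hM₁⟩ := hbd (t + 1) (by linarith) 1
    have htI : t ∈ Icc 0 (t + 1) := ⟨ht, by linarith⟩
    refine ⟨max M₀ M₁, fun x => le_max_of_le_left ?_, fun x => le_max_of_le_right ?_⟩
    · simpa using hM₀ x t htI
    · simpa [iteratedDeriv_one] using hM₁ x t htI
  refine ⟨hsm, hbd, fun t ht x => ?_, fun x t ht => ?_⟩ <;> obtain ⟨M, hM, hM'⟩ := hbdd t ht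
  · exact (hH t ht x).tendsto_symmQuot (hder t ht) hM'
  · refine (heq x t ht).congr_deriv ?_
    rw [dx, iteratedDeriv_one]
    congr 1
    split_ifs with h
    · rw [hL0 h, zero_mul]
    · rw [one_mul]
      have hpos : 0 < α := lt_of_le_of_ne hα0 (Ne.symm h)
      exact tendsto_nhds_unique (hL hpos t ht x) (tendsto_setIntegral_fracDiss hpos (by linarith)
        (hslice t ht).continuous (abs_sub_add_le_min (hder t ht) hM hM') x)

/-- **Finite time blow up for the supercritical Córdoba–Córdoba–Fontelos model.**
For `0 ≤ α < 1/4` there is smooth, bounded, positive, even initial data `θ₀`, nonincreasing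
on `(0,∞)` and integrable, such that no globally smooth bounded solution (with all spatial
derivatives bounded on each `[0,T]`) of `∂_t θ = (Hθ)∂_x θ − L_α θ` on `ℝ × [0,∞)` starts
from `θ₀`: the solution forms a singularity in finite time. -/
theorem supercritical_ccf_blowup (α : ℝ) (hα0 : 0 ≤ α) (hα : α < 1/4) :
    ∃ θ₀ : ℝ → ℝ,
      ContDiff ℝ (⊤ : ℕ∞) θ₀ ∧ (∃ M, ∀ x, |θ₀ x| ≤ M) ∧ (∀ x, 0 < θ₀ x) ∧
      (∀ x, θ₀ (-x) = θ₀ x) ∧ AntitoneOn θ₀ (Ioi 0) ∧ Integrable θ₀ ∧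
      ¬ ∃ θ Hθ Lθ : ℝ → ℝ → ℝ,
        ContDiffOn ℝ (⊤ : ℕ∞) (fun p : ℝ × ℝ => θ p.1 p.2) (univ ×ˢ Ici 0) ∧
        (∃ M, ∀ x, ∀ t ∈ Ici (0:ℝ), |θ x t| ≤ M) ∧
        (∀ T > (0:ℝ), ∀ j : ℕ, ∃ M, ∀ x, ∀ t ∈ Icc (0:ℝ) T,
          |iteratedDeriv j (fun x' => θ x' t) x| ≤ M) ∧
        (∀ t ∈ Ici (0:ℝ), ∀ x, HilbertPVAt (fun x' => θ x' t) x (Real.pi * Hθ x t)) ∧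
        (α = 0 → ∀ x t, Lθ x t = 0) ∧
        (0 < α → ∀ t ∈ Ici (0:ℝ), ∀ x,
          Tendsto (fun ε => ∫ y in {y : ℝ | ε < |y|},
              (θ x t - θ (x + y) t) / |y| ^ (1 + 2*α))
            (nhdsWithin 0 (Ioi 0)) (nhds (Lθ x t))) ∧
        (∀ x, ∀ t ∈ Ici (0:ℝ),
          HasDerivWithinAt (fun s => θ x s)
            (Hθ x t * deriv (fun x' => θ x' t) x - Lθ x t) (Ici 0) t) ∧
        (∀ x, θ x 0 = θ₀ x) := by
  set β : ℝ := if α = 0 then 1 / 8 else α with hβ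
  set κ : ℝ := if α = 0 then 0 else 1 with hκ
  have hβ0 : 0 < β := by
    rw [hβ]; split_ifs with h
    · norm_num
    · exact lt_of_le_of_ne hα0 (Ne.symm h)
  have hβ1 : β < 1 / 4 := by rw [hβ]; split_ifs <;> linarith
  have hκ0 : 0 ≤ κ := by rw [hκ]; split_ifs <;> norm_num
  have hκ1 : κ ≤ 1 := by rw [hκ]; split_ifs <;> norm_num
  set δ := 3 / 4 * (1 - 4 * β) with hδ
  have hδ0 : 0 < δ := by rw [hδ]; linarith
  have hδ1 : δ < 1 := by rw [hδ]; linarith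
  obtain ⟨J₀, hJ₀, T₀, hT₀, H⟩ := IsSolution.exists_moment_threshold (δ := δ) hβ0 hδ0
    (by rw [hδ]; linarith) (by rw [hδ]; linarith)
  obtain ⟨r, hr, hrJ⟩ : ∃ r > 0, J₀ < moment δ (lorentzian r) := by
    refine ⟨(2 * δ * (J₀ + 1)) ^ (-δ⁻¹), by positivity, ?_⟩
    refine lt_of_lt_of_le ?_ (le_moment_lorentzian hδ0 hδ1 (by positivity))
    rw [← Real.rpow_mul (by positivity), neg_mul_neg, inv_mul_cancel₀ hδ0.ne', Real.rpow_one,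
      mul_div_cancel_left₀ _ (by positivity)]
    linarith
  have habs : ∀ x, |lorentzian r x| ≤ 1 := fun x => by
    rw [abs_of_pos (lorentzian_pos r x)]; exact lorentzian_le_one r x
  have heven : ∀ x, lorentzian r (-x) = lorentzian r x := fun x => by
    simp [lorentzian, neg_div]
  have hcont : Continuous (lorentzian r) := (contDiff_lorentzian r (n := 0)).continuous
  refine ⟨lorentzian r, contDiff_lorentzian r, ⟨1, habs⟩, lorentzian_pos r, heven,
    antitoneOn_lorentzian hr, integrable_lorentzian hr.ne', ?_⟩
  rintro ⟨θ, Hθ, Lθ, hsm, -, hbd, hH, hL0, hL, heq, hinit⟩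
  have h := isSolution_of_principalValue hα0 hα hsm hbd hH hL0 hL heq
  have hfun : (fun x => θ x 0) = lorentzian r := funext hinit
  have hi : Integrable fun x => θ x 0 ^ 2 := by
    simp_rw [hinit]
    refine (integrable_lorentzian hr.ne').mono' (by fun_prop) (Eventually.of_forall fun x => ?_)
    rw [Real.norm_eq_abs, abs_of_nonneg (sq_nonneg _)]
    exact pow_le_of_le_one (lorentzian_pos r x).le (lorentzian_le_one r x) two_ne_zero
  have hi' : Integrable fun x => dx θ 1 x 0 ^ 2 := by
    have hdx : ∀ x, dx θ 1 x 0 = -(2 / r) * (x / r) * lorentzian r x ^ 2 := fun x => by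
      rw [dx, iteratedDeriv_one, hfun]; exact (hasDerivAt_lorentzian r x).deriv
    simp_rw [hdx]
    refine ((integrable_lorentzian hr.ne').const_mul ((2 / r) ^ 2)).mono' (by fun_prop)
      (Eventually.of_forall fun x => ?_)
    rw [Real.norm_eq_abs, abs_of_nonneg (sq_nonneg _)]
    exact sq_deriv_lorentzian_le r x
  have hthr := H κ θ Hθ hκ0 hκ1 h (fun x => by rw [hinit]; exact habs x)
    (fun x => by rw [hinit, hinit, heven]) hi hi' (by rw [hfun]; exact hrJ)
  refine lt_irrefl T₀ (hthr T₀ hT₀ ?_).2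
  refine h.velocity_zero_of_moment_pos (δ := δ) hβ0 (by linarith) hκ0 hT₀.le
    (fun x => by rw [hinit, hinit, heven]) hi hi' fun τ hτ hz => ?_
  rcases (show 0 ≤ τ from hτ).eq_or_lt with rfl | hpos
  · rw [hfun]; exact hJ₀.trans hrJ
  · exact hJ₀.trans ((hthr τ hpos hz).1 τ ⟨hτ, le_rfl⟩)
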